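/- Let n and m be integers with n > 1 and m > 4n. Then in every non-homotopic drawing in the plane with n vertices and m edges, the number of crossing pairs of edges is at least m²/(24n). -/

import Mathlib

open unitInterval ENNReal

/-- A drawing in the plane with `n` vertices and `m` edges: a finite set `V ⊆ ℂ` of
`n` vertices together with continuous curves `f e : [0,1] → ℂ` whose endpoints are
vertices and whose interiors avoid the vertices. -/
structure PlaneDrawing (n m : ℕ) where
  V : Set ℂ
  finV : V.Finite
  cardV : V.ncard = n
  f : Fin m → I → ℂ
  cont : ∀ e, Continuous (f e)
  source_mem : ∀ e, f e 0 ∈ V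
  target_mem : ∀ e, f e 1 ∈ V
  interior_not_mem : ∀ e, ∀ t : I, t ≠ 0 → t ≠ 1 → f e t ∉ V

/-- Homotopy between two curves, fixing the endpoints of the first, with interior
avoiding the vertex set `V`. -/
def HomotopicIn (V : Set ℂ) (a b : I → ℂ) : Prop :=
  ∃ g : I × I → ℂ, Continuous g ∧
    (∀ t, g (0, t) = a t) ∧ (∀ t, g (1, t) = b t) ∧
    (∀ s, g (s, 0) = a 0) ∧ (∀ s, g (s, 1) = a 1) ∧
    (∀ s t : I, s ≠ 0 → s ≠ 1 → t ≠ 0 → t ≠ 1 → g (s, t) ∉ V)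

/-- Two edges are homotopic if one is homotopic to the other or to its reversal. -/
def EdgeHomotopic (V : Set ℂ) (a b : I → ℂ) : Prop :=
  HomotopicIn V a b ∨ HomotopicIn V (fun t => a (σ t)) b

/-- An edge is a trivial loop if it is homotopic to the constant map at its endpoint. -/
def IsTrivialLoop (V : Set ℂ) (a : I → ℂ) : Prop :=
  EdgeHomotopic V a fun _ => a 0

/-- A drawing is non-homotopic if no two distinct edges are homotopic and
no edge is a trivial loop. -/
def PlaneDrawing.NonHomotopic {n m : ℕ} (D : PlaneDrawing n m) : Prop :=
  (∀ e e' : Fin m, e ≠ e' → ¬ EdgeHomotopic D.V (D.f e) (D.f e')) ∧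
  (∀ e : Fin m, ¬ IsTrivialLoop D.V (D.f e))

/-- The crossing number: half the cardinality of the set of ordered crossings. -/
noncomputable def PlaneDrawing.crossingNumber {n m : ℕ} (D : PlaneDrawing n m) : ℝ≥0∞ :=
  (({p : (Fin m × I) × (Fin m × I) |
      p.1 ≠ p.2 ∧ p.1.2 ≠ 0 ∧ p.1.2 ≠ 1 ∧ p.2.2 ≠ 0 ∧ p.2.2 ≠ 1 ∧
      D.f p.1.1 p.1.2 = D.f p.2.1 p.2.2}).encard : ℝ≥0∞) / 2

/-- The set of ordered pairs of distinct edges that cross. -/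
def PlaneDrawing.crossingEdgePairs {n m : ℕ} (D : PlaneDrawing n m) : Set (Fin m × Fin m) :=
  {q | q.1 ≠ q.2 ∧ ∃ t t' : I, t ≠ 0 ∧ t ≠ 1 ∧ t' ≠ 0 ∧ t' ≠ 1 ∧ D.f q.1 t = D.f q.2 t'}

namespace TriLattice

/-- Adjacency of cells of the triangular lattice on `ℤ × ℤ`. -/
def Adj (u v : ℤ × ℤ) : Prop :=
  (-1 ≤ v.1 - u.1 ∧ v.1 - u.1 ≤ 1) ∧ (-1 ≤ v.2 - u.2 ∧ v.2 - u.2 ≤ 1) ∧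
  (-1 ≤ v.1 - u.1 + (v.2 - u.2) ∧ v.1 - u.1 + (v.2 - u.2) ≤ 1) ∧ ¬ (v.1 = u.1 ∧ v.2 = u.2)

instance : DecidableRel Adj := fun u v => by unfold Adj; infer_instance

theorem Adj.symm {u v : ℤ × ℤ} (h : Adj u v) : Adj v u := by
  unfold Adj at *; omega

theorem adj_comm {u v : ℤ × ℤ} : Adj u v ↔ Adj v u := ⟨Adj.symm, Adj.symm⟩

theorem not_adj_self (u : ℤ × ℤ) : ¬ Adj u u := by
  unfold Adj; omega

theorem Adj.ne {u v : ℤ × ℤ} (h : Adj u v) : u ≠ v := by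
  rintro rfl; exact not_adj_self _ h

/-- Indicator of adjacency. -/
def ind (u v : ℤ × ℤ) : ℤ := if Adj u v then 1 else 0

theorem ind_comm (u v : ℤ × ℤ) : ind u v = ind v u := by
  simp only [ind, adj_comm]

theorem ind_self (u : ℤ × ℤ) : ind u u = 0 := by simp [ind, not_adj_self]

theorem ind_of_adj {u v : ℤ × ℤ} (h : Adj u v) : ind u v = 1 := by simp [ind, h]

theorem ind_of_not_adj {u v : ℤ × ℤ} (h : ¬ Adj u v) : ind u v = 0 := by simp [ind, h]

theorem ind_nonneg (u v : ℤ × ℤ) : 0 ≤ ind u v := by unfold ind; split <;> simp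

/-- Number of adjacent pairs between two sets of cells. -/
def E (A B : Finset (ℤ × ℤ)) : ℤ := ∑ u ∈ A, ∑ v ∈ B, ind u v

/-- Number of triangles with a vertex in each of three sets of cells. -/
def T (A B C : Finset (ℤ × ℤ)) : ℤ :=
  ∑ u ∈ A, ∑ v ∈ B, ∑ w ∈ C, ind u v * ind v w * ind u w

/-- Six times the Euler characteristic of the complex spanned by a set of cells. -/
def X (A : Finset (ℤ × ℤ)) : ℤ := 6 * A.card - 3 * E A A + T A A A

/-- Defect of additivity of the Euler characteristic. -/
def J (A B : Finset (ℤ × ℤ)) : ℤ := 2 * E A B - T A A B - T A B B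

theorem E_comm (A B : Finset (ℤ × ℤ)) : E A B = E B A := by
  unfold E; rw [Finset.sum_comm]
  exact Finset.sum_congr rfl fun _ _ => Finset.sum_congr rfl fun _ _ => ind_comm _ _

theorem T_swap_left (A B C : Finset (ℤ × ℤ)) : T A B C = T B A C := by
  unfold T; rw [Finset.sum_comm]
  refine Finset.sum_congr rfl fun u _ => Finset.sum_congr rfl fun v _ =>
    Finset.sum_congr rfl fun w _ => ?_
  rw [ind_comm u v]; ring

theorem T_swap_right (A B C : Finset (ℤ × ℤ)) : T A B C = T A C B := by
  unfold T
  refine Finset.sum_congr rfl fun u _ => ?_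
  rw [Finset.sum_comm]
  refine Finset.sum_congr rfl fun v _ => Finset.sum_congr rfl fun w _ => ?_
  rw [ind_comm v w]; ring

theorem E_union_left {A B : Finset (ℤ × ℤ)} (h : Disjoint A B) (C : Finset (ℤ × ℤ)) :
    E (A ∪ B) C = E A C + E B C := by
  unfold E; rw [Finset.sum_union h]

theorem E_union_right {B C : Finset (ℤ × ℤ)} (h : Disjoint B C) (A : Finset (ℤ × ℤ)) :
    E A (B ∪ C) = E A B + E A C := by
  rw [E_comm, E_union_left h, E_comm B, E_comm C]

theorem T_union_left {A B : Finset (ℤ × ℤ)} (h : Disjoint A B) (C D : Finset (ℤ × ℤ)) :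
    T (A ∪ B) C D = T A C D + T B C D := by
  unfold T; rw [Finset.sum_union h]

theorem T_union_mid {A B : Finset (ℤ × ℤ)} (h : Disjoint A B) (C D : Finset (ℤ × ℤ)) :
    T C (A ∪ B) D = T C A D + T C B D := by
  rw [T_swap_left, T_union_left h, T_swap_left A, T_swap_left B]

theorem T_union_right {A B : Finset (ℤ × ℤ)} (h : Disjoint A B) (C D : Finset (ℤ × ℤ)) :
    T C D (A ∪ B) = T C D A + T C D B := by
  rw [T_swap_right, T_union_mid h, T_swap_right C A, T_swap_right C B]

theorem T_nonneg (A B C : Finset (ℤ × ℤ)) : 0 ≤ T A B C :=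
  Finset.sum_nonneg fun _ _ => Finset.sum_nonneg fun _ _ => Finset.sum_nonneg fun _ _ =>
    mul_nonneg (mul_nonneg (ind_nonneg _ _) (ind_nonneg _ _)) (ind_nonneg _ _)

theorem J_comm (A B : Finset (ℤ × ℤ)) : J A B = J B A := by
  unfold J
  rw [E_comm A B, T_swap_right A A B, T_swap_left A B A, T_swap_left A B B,
    T_swap_right B A B]
  ring

theorem X_union {A B : Finset (ℤ × ℤ)} (h : Disjoint A B) :
    X (A ∪ B) = X A + X B - 3 * J A B := by
  unfold X J
  simp only [Finset.card_union_of_disjoint h, E_union_left h, E_union_right h, T_union_left h,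
    T_union_mid h, T_union_right h]
  rw [E_comm B A, T_swap_right A B A, T_swap_left B A A, T_swap_right A B A,
    T_swap_left B A B, T_swap_right B B A, T_swap_left B A B]
  push_cast; ring

/-- No adjacency between two sets of cells. -/
def Apart (A B : Finset (ℤ × ℤ)) : Prop := ∀ u ∈ A, ∀ v ∈ B, ¬ Adj u v

theorem Apart.symm {A B : Finset (ℤ × ℤ)} (h : Apart A B) : Apart B A :=
  fun u hu v hv hh => h v hv u hu hh.symm

theorem Apart.E_eq {A B : Finset (ℤ × ℤ)} (h : Apart A B) : E A B = 0 :=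
  Finset.sum_eq_zero fun u hu => Finset.sum_eq_zero fun v hv => ind_of_not_adj (h u hu v hv)

theorem Apart.T_eq {A B : Finset (ℤ × ℤ)} (h : Apart A B) (C : Finset (ℤ × ℤ)) :
    T A B C = 0 :=
  Finset.sum_eq_zero fun u hu => Finset.sum_eq_zero fun v hv => Finset.sum_eq_zero fun w _ => by
    rw [ind_of_not_adj (h u hu v hv)]; ring

theorem Apart.J_eq {A B : Finset (ℤ × ℤ)} (h : Apart A B) : J A B = 0 := by
  unfold J
  rw [h.E_eq, T_swap_right A A B, h.T_eq, h.T_eq]; ring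

theorem J_union_right {A B C : Finset (ℤ × ℤ)} (h : Disjoint B C) :
    J A (B ∪ C) = J A B + J A C - 2 * T A B C := by
  unfold J
  simp only [E_union_right h, T_union_right h, T_union_mid h]
  rw [T_swap_right A C B]
  ring

theorem common_iff {u v : ℤ × ℤ} (h : Adj u v) (w : ℤ × ℤ) :
    (Adj u w ∧ Adj v w) ↔
      w = (u.1 - (v.2 - u.2), u.2 + (v.1 - u.1 + (v.2 - u.2))) ∨
      w = (u.1 + (v.1 - u.1 + (v.2 - u.2)), u.2 - (v.1 - u.1)) := by
  unfold Adj at *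
  rw [Prod.ext_iff, Prod.ext_iff]
  dsimp only
  obtain ⟨u1, u2⟩ := u
  obtain ⟨v1, v2⟩ := v
  obtain ⟨w1, w2⟩ := w
  dsimp only at *
  omega

theorem sum_common {u v : ℤ × ℤ} (h : Adj u v) {S : Finset (ℤ × ℤ)}
    (hS : ∀ w, Adj u w → Adj v w → w ∈ S) :
    ∑ w ∈ S, ind v w * ind u w = 2 := by
  set p : ℤ × ℤ := (u.1 - (v.2 - u.2), u.2 + (v.1 - u.1 + (v.2 - u.2))) with hp
  set q : ℤ × ℤ := (u.1 + (v.1 - u.1 + (v.2 - u.2)), u.2 - (v.1 - u.1)) with hq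
  have hpq : p ≠ q := by
    rw [hp, hq, Ne, Prod.ext_iff]; dsimp only
    unfold Adj at h; omega
  have h1 := (common_iff h p).2 (Or.inl rfl)
  have h2 := (common_iff h q).2 (Or.inr rfl)
  have hsub : ({p, q} : Finset (ℤ × ℤ)) ⊆ S := by
    intro w hw
    simp only [Finset.mem_insert, Finset.mem_singleton] at hw
    rcases hw with rfl | rfl
    · exact hS _ h1.1 h1.2
    · exact hS _ h2.1 h2.2
  rw [← Finset.sum_subset hsub, Finset.sum_pair hpq, ind_of_adj h1.1, ind_of_adj h1.2,
    ind_of_adj h2.1, ind_of_adj h2.2]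
  · norm_num
  · intro w _ hw
    by_contra hne
    have h3 : Adj v w := by
      by_contra h3; exact hne (by rw [ind_of_not_adj h3]; ring)
    have h4 : Adj u w := by
      by_contra h4; exact hne (by rw [ind_of_not_adj h4]; ring)
    exact hw (by simpa using (common_iff h w).1 ⟨h4, h3⟩)

theorem two_E_eq {A B S : Finset (ℤ × ℤ)}
    (hS : ∀ u ∈ A, ∀ v ∈ B, Adj u v → ∀ w, Adj u w → Adj v w → w ∈ S) :
    2 * E A B = T A B S := by
  unfold E T
  rw [Finset.mul_sum]
  refine Finset.sum_congr rfl fun u hu => ?_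
  rw [Finset.mul_sum]
  refine Finset.sum_congr rfl fun v hv => ?_
  by_cases h : Adj u v
  · simp only [mul_assoc, ← Finset.mul_sum]
    rw [sum_common h (hS u hu v hv h)]; ring
  · simp [ind_of_not_adj h]

theorem J_eq_T {A B C : Finset (ℤ × ℤ)} (hAB : Disjoint A B) (hC : Disjoint (A ∪ B) C)
    (hS : ∀ u ∈ A, ∀ v ∈ B, Adj u v → ∀ w, Adj u w → Adj v w → w ∉ A → w ∉ B → w ∈ C) :
    J A B = T A B C := by
  have := two_E_eq (A := A) (B := B) (S := A ∪ B ∪ C) (by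
    intro u hu v hv h w h1 h2
    by_cases ha : w ∈ A
    · simp [ha]
    by_cases hb : w ∈ B
    · simp [hb]
    · simp [hS u hu v hv h w h1 h2 ha hb])
  rw [T_union_right hC, T_union_right hAB] at this
  unfold J
  rw [this, T_swap_right A A B]; ring

/-- The cells adjacent to some cell of a set. -/
noncomputable def nbhd (A : Finset (ℤ × ℤ)) : Finset (ℤ × ℤ) :=
  A.biUnion fun u =>
    (Finset.Icc (u.1 - 1) (u.1 + 1) ×ˢ Finset.Icc (u.2 - 1) (u.2 + 1)).filter (Adj u)

theorem mem_nbhd {A : Finset (ℤ × ℤ)} {w : ℤ × ℤ} : w ∈ nbhd A ↔ ∃ u ∈ A, Adj u w := by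
  unfold nbhd
  simp only [Finset.mem_biUnion, Finset.mem_filter, Finset.mem_product, Finset.mem_Icc]
  constructor
  · rintro ⟨u, hu, _, h⟩; exact ⟨u, hu, h⟩
  · rintro ⟨u, hu, h⟩
    refine ⟨u, hu, ?_, h⟩
    unfold Adj at h; omega

theorem J_nonneg {A B : Finset (ℤ × ℤ)} (hAB : Disjoint A B) : 0 ≤ J A B := by
  rw [J_eq_T hAB (C := nbhd A \ (A ∪ B)) Finset.disjoint_sdiff]
  · exact T_nonneg _ _ _
  · intro u hu v _ _ w h1 _ h3 h4
    simp only [Finset.mem_sdiff, Finset.mem_union, not_or]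
    exact ⟨mem_nbhd.2 ⟨u, hu, h1⟩, h3, h4⟩

/-- Adding one cell. -/
theorem X_insert {z : ℤ × ℤ} {R : Finset (ℤ × ℤ)} (hz : z ∉ R) :
    X (insert z R) = X R + 6 - 6 * ∑ u ∈ R, ind z u +
      3 * ∑ u ∈ R, ∑ v ∈ R, ind z u * ind u v * ind z v := by
  have hd : Disjoint {z} R := by simpa using hz
  rw [Finset.insert_eq, X_union hd]
  have h1 : X {z} = 6 := by simp [X, E, T, ind_self]
  have h2 : J {z} R = 2 * ∑ u ∈ R, ind z u - ∑ u ∈ R, ∑ v ∈ R, ind z u * ind u v * ind z v := by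
    simp [J, E, T, ind_self]
  rw [h1, h2]; ring

theorem X_empty : X ∅ = 0 := by simp [X, E, T]

theorem X_singleton (z : ℤ × ℤ) : X {z} = 6 := by simp [X, E, T, ind_self]

end TriLattice

namespace TriLattice

/-- A finite set of cells is connected if it is nonempty and every property that
propagates along adjacency and holds somewhere holds everywhere. -/
def Conn (R : Finset (ℤ × ℤ)) : Prop :=
  R.Nonempty ∧ ∀ P : ℤ × ℤ → Prop, (∃ u ∈ R, P u) →
    (∀ u ∈ R, ∀ v ∈ R, Adj u v → P u → P v) → ∀ v ∈ R, P v

theorem conn_singleton (z : ℤ × ℤ) : Conn {z} :=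
  ⟨by simp, fun P h _ v hv => by
    obtain ⟨u, hu, hP⟩ := h
    simp only [Finset.mem_singleton] at hu hv
    rw [hv, ← hu]; exact hP⟩

theorem Conn.union {A B : Finset (ℤ × ℤ)} (hA : Conn A) (hB : Conn B)
    (h : ∃ u ∈ A, ∃ v ∈ B, u = v ∨ Adj u v) : Conn (A ∪ B) := by
  refine ⟨hA.1.mono Finset.subset_union_left, fun P hP hstep => ?_⟩
  have sA : ∀ u ∈ A, ∀ v ∈ A, Adj u v → P u → P v := fun u hu v hv =>
    hstep u (Finset.mem_union_left _ hu) v (Finset.mem_union_left _ hv)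
  have sB : ∀ u ∈ B, ∀ v ∈ B, Adj u v → P u → P v := fun u hu v hv =>
    hstep u (Finset.mem_union_right _ hu) v (Finset.mem_union_right _ hv)
  obtain ⟨a, ha, b, hb, hab⟩ := h
  have key : (∀ v ∈ A, P v) ∧ (∀ v ∈ B, P v) := by
    obtain ⟨u, hu, hPu⟩ := hP
    rcases Finset.mem_union.1 hu with hu | hu
    · have h1 := hA.2 P ⟨u, hu, hPu⟩ sA
      refine ⟨h1, hB.2 P ⟨b, hb, ?_⟩ sB⟩
      rcases hab with rfl | hab
      · exact h1 _ ha
      · exact hstep a (Finset.mem_union_left _ ha) b (Finset.mem_union_right _ hb) hab (h1 _ ha)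
    · have h1 := hB.2 P ⟨u, hu, hPu⟩ sB
      refine ⟨hA.2 P ⟨a, ha, ?_⟩ sA, h1⟩
      rcases hab with rfl | hab
      · exact h1 _ hb
      · exact hstep b (Finset.mem_union_right _ hb) a (Finset.mem_union_left _ ha) hab.symm
          (h1 _ hb)
  intro v hv
  rcases Finset.mem_union.1 hv with hv | hv
  exacts [key.1 v hv, key.2 v hv]

theorem Conn.insert_cell {R : Finset (ℤ × ℤ)} (hR : Conn R) {z l : ℤ × ℤ} (hl : l ∈ R)
    (hz : Adj z l) : Conn (insert z R) := by
  rw [Finset.insert_eq]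
  exact (conn_singleton z).union hR ⟨z, by simp, l, hl, Or.inr hz⟩

open Classical in
/-- The component of a cell in a finite set of cells. -/
noncomputable def comp (S : Finset (ℤ × ℤ)) (u : ℤ × ℤ) : Finset (ℤ × ℤ) :=
  S.filter fun v => Relation.ReflTransGen (fun x y => Adj x y ∧ x ∈ S ∧ y ∈ S) u v

theorem comp_subset (S : Finset (ℤ × ℤ)) (u : ℤ × ℤ) : comp S u ⊆ S := by
  intro v hv
  simp only [comp, Finset.mem_filter] at hv
  exact hv.1

theorem self_mem_comp {S : Finset (ℤ × ℤ)} {u : ℤ × ℤ} (hu : u ∈ S) : u ∈ comp S u := by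
  simp [comp, hu, Relation.ReflTransGen.refl]

theorem comp_closed {S : Finset (ℤ × ℤ)} {u v w : ℤ × ℤ} (hv : v ∈ comp S u) (hw : w ∈ S)
    (h : Adj v w) : w ∈ comp S u := by
  simp only [comp, Finset.mem_filter] at *
  exact ⟨hw, hv.2.tail ⟨h, hv.1, hw⟩⟩

theorem comp_conn {S : Finset (ℤ × ℤ)} {u : ℤ × ℤ} (hu : u ∈ S) : Conn (comp S u) := by
  refine ⟨⟨u, self_mem_comp hu⟩, fun P hP hstep => ?_⟩
  have hstep' : ∀ x y, Adj x y → x ∈ comp S u → y ∈ S → (P x ↔ P y) := fun x y h hx hy =>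
    ⟨hstep x hx y (comp_closed hx hy h) h, hstep y (comp_closed hx hy h) x hx h.symm⟩
  have key : ∀ v, Relation.ReflTransGen (fun x y => Adj x y ∧ x ∈ S ∧ y ∈ S) u v →
      (P u ↔ P v) := by
    intro v hv
    induction hv with
    | refl => rfl
    | tail hb hc ih =>
      refine ih.trans (hstep' _ _ hc.1 ?_ hc.2.2)
      simp only [comp, Finset.mem_filter]
      exact ⟨hc.2.1, hb⟩
  obtain ⟨w, hw, hPw⟩ := hP
  intro v hv
  simp only [comp, Finset.mem_filter] at hw hv
  exact (key v hv.2).1 ((key w hw.2).2 hPw)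

theorem comp_eq_of_mem {S : Finset (ℤ × ℤ)} {u v : ℤ × ℤ} (hv : v ∈ comp S u) :
    comp S v = comp S u := by
  have hs : ∀ x y, Relation.ReflTransGen (fun x y => Adj x y ∧ x ∈ S ∧ y ∈ S) x y →
      Relation.ReflTransGen (fun x y => Adj x y ∧ x ∈ S ∧ y ∈ S) y x := by
    intro x y h
    induction h with
    | refl => exact .refl
    | tail _ hc ih => exact (Relation.ReflTransGen.single ⟨hc.1.symm, hc.2.2, hc.2.1⟩).trans ih
  ext w
  simp only [comp, Finset.mem_filter] at *
  exact ⟨fun h => ⟨h.1, hv.2.trans h.2⟩, fun h => ⟨h.1, (hs _ _ hv.2).trans h.2⟩⟩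

/-- The three neighbours of a cell that precede it in lexicographic order. -/
theorem sum_lower {z : ℤ × ℤ} {R : Finset (ℤ × ℤ)} (hz : z ∉ R)
    (hmax : ∀ u ∈ R, u.1 < z.1 ∨ u.1 = z.1 ∧ u.2 ≤ z.2) (f : ℤ × ℤ → ℤ) :
    ∑ u ∈ R, ind z u * f u =
      (if (z.1 - 1, z.2 + 1) ∈ R then f (z.1 - 1, z.2 + 1) else 0) +
      (if (z.1 - 1, z.2) ∈ R then f (z.1 - 1, z.2) else 0) +
      (if (z.1, z.2 - 1) ∈ R then f (z.1, z.2 - 1) else 0) := by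
  obtain ⟨z1, z2⟩ := z
  dsimp only at *
  have h1 : ∑ u ∈ R, ind (z1, z2) u * f u = ∑ u ∈ R,
      ((if (z1 - 1, z2 + 1) = u then f u else 0) + (if (z1 - 1, z2) = u then f u else 0) +
        (if (z1, z2 - 1) = u then f u else 0)) := by
    refine Finset.sum_congr rfl fun u hu => ?_
    have hm := hmax u hu
    have hne : u ≠ (z1, z2) := fun h => hz (h ▸ hu)
    obtain ⟨u1, u2⟩ := u
    by_cases h : Adj (z1, z2) (u1, u2)
    · rw [ind_of_adj h]
      unfold Adj at h
      simp only [ne_eq, Prod.mk.injEq] at *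
      have : (z1 - 1 = u1 ∧ z2 + 1 = u2) ∨ (z1 - 1 = u1 ∧ z2 = u2) ∨ (z1 = u1 ∧ z2 - 1 = u2) := by
        omega
      rcases this with ⟨rfl, rfl⟩ | ⟨rfl, rfl⟩ | ⟨rfl, rfl⟩ <;> simp <;> omega
    · rw [ind_of_not_adj h]
      unfold Adj at h
      simp only [ne_eq, Prod.mk.injEq] at *
      have h1 : ¬ (z1 - 1 = u1 ∧ z2 + 1 = u2) := by omega
      have h2 : ¬ (z1 - 1 = u1 ∧ z2 = u2) := by omega
      have h3 : ¬ (z1 = u1 ∧ z2 - 1 = u2) := by omega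
      simp [h1, h2, h3]
  rw [h1, Finset.sum_add_distrib, Finset.sum_add_distrib]
  simp only [Finset.sum_ite_eq]

theorem adj_lower {z u : ℤ × ℤ} {R : Finset (ℤ × ℤ)} (hz : z ∉ R)
    (hmax : ∀ u ∈ R, u.1 < z.1 ∨ u.1 = z.1 ∧ u.2 ≤ z.2) (hu : u ∈ R) (h : Adj z u) :
    u = (z.1 - 1, z.2 + 1) ∨ u = (z.1 - 1, z.2) ∨ u = (z.1, z.2 - 1) := by
  have hm := hmax u hu
  have hne : u ≠ z := fun h => hz (h ▸ hu)
  obtain ⟨z1, z2⟩ := z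
  obtain ⟨u1, u2⟩ := u
  simp only [ne_eq, Prod.mk.injEq, Adj] at *
  omega

theorem X_insert_lower {z : ℤ × ℤ} {R : Finset (ℤ × ℤ)} (hz : z ∉ R)
    (hmax : ∀ u ∈ R, u.1 < z.1 ∨ u.1 = z.1 ∧ u.2 ≤ z.2) :
    X (insert z R) = X R + 6
      - 6 * ((if (z.1 - 1, z.2 + 1) ∈ R then 1 else 0) + (if (z.1 - 1, z.2) ∈ R then 1 else 0) +
        (if (z.1, z.2 - 1) ∈ R then 1 else 0))
      + 6 * ((if (z.1 - 1, z.2 + 1) ∈ R ∧ (z.1 - 1, z.2) ∈ R then 1 else 0) +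
        (if (z.1, z.2 - 1) ∈ R ∧ (z.1 - 1, z.2) ∈ R then 1 else 0)) := by
  rw [X_insert hz]
  have h1 := sum_lower hz hmax (fun _ => 1)
  simp only [mul_one] at h1
  rw [h1]
  have h2 : ∀ u ∈ R, ∑ v ∈ R, ind z u * ind u v * ind z v =
      ind z u * ∑ v ∈ R, ind z v * ind u v := by
    intro u _
    rw [Finset.mul_sum]
    exact Finset.sum_congr rfl fun v _ => by ring
  rw [Finset.sum_congr rfl h2, sum_lower hz hmax (fun u => ∑ v ∈ R, ind z v * ind u v)]
  simp only [sum_lower hz hmax]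
  have e1 : ind (z.1 - 1, z.2 + 1) (z.1 - 1, z.2) = 1 :=
    ind_of_adj (by unfold Adj; dsimp only; omega)
  have e2 : ind (z.1 - 1, z.2) (z.1, z.2 - 1) = 1 :=
    ind_of_adj (by unfold Adj; dsimp only; omega)
  have e3 : ind (z.1 - 1, z.2 + 1) (z.1, z.2 - 1) = 0 :=
    ind_of_not_adj (by unfold Adj; dsimp only; omega)
  rw [ind_comm (z.1 - 1, z.2) (z.1 - 1, z.2 + 1), ind_comm (z.1, z.2 - 1) (z.1 - 1, z.2),
    ind_comm (z.1, z.2 - 1) (z.1 - 1, z.2 + 1), e1, e2, e3]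
  simp only [ind_self]
  split_ifs <;> first | omega | simp_all

theorem exists_lex_max {R : Finset (ℤ × ℤ)} (hR : R.Nonempty) :
    ∃ z ∈ R, ∀ u ∈ R.erase z, u.1 < z.1 ∨ u.1 = z.1 ∧ u.2 ≤ z.2 := by
  obtain ⟨z, hz, h⟩ := R.exists_max_image (fun u => toLex u) hR
  refine ⟨z, hz, fun u hu => ?_⟩
  have := h u (Finset.mem_of_mem_erase hu)
  rwa [Prod.Lex.le_iff] at this

theorem six_dvd_X (R : Finset (ℤ × ℤ)) : (6 : ℤ) ∣ X R := by
  induction hn : R.card generalizing R with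
  | zero => rw [Finset.card_eq_zero.1 hn, X_empty]; exact dvd_zero _
  | succ n ih =>
    obtain ⟨z, hz, h⟩ := exists_lex_max (R := R) (Finset.card_pos.1 (by omega))
    have h1 := ih (R.erase z) (by rw [Finset.card_erase_of_mem hz]; omega)
    rw [← Finset.insert_erase hz, X_insert_lower (Finset.notMem_erase z R) h]
    omega

theorem two_dvd_J {A B : Finset (ℤ × ℤ)} (h : Disjoint A B) : (2 : ℤ) ∣ J A B := by
  have h1 := X_union h
  have := six_dvd_X (A ∪ B)
  have := six_dvd_X A
  have := six_dvd_X B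
  omega

/-- Induction principle for connected regions, adding lexicographically largest cells. -/
theorem Conn.induction {motive : Finset (ℤ × ℤ) → Prop}
    (single : ∀ z, motive {z})
    (cone : ∀ R z l, Conn R → z ∉ R → l ∈ R → Adj z l →
      (∀ w ∈ R, Adj z w → w = l ∨ Adj l w) → X (insert z R) = X R → motive R →
      motive (insert z R))
    (bridge : ∀ R z l l', Conn R → z ∉ R → l ∈ R → l' ∈ R → Adj z l → Adj z l' →
      (∀ w ∈ R, Adj z w → w = l ∨ w = l') → X (insert z R) = X R - 6 → motive R →
      motive (insert z R))
    (join : ∀ A B z l l', Conn A → Conn B → Disjoint A B → Apart A B → z ∉ A → z ∉ B →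
      l ∈ A → l' ∈ B → Adj z l → Adj z l' →
      (∀ w ∈ A, Adj z w → w = l) → (∀ w ∈ B, Adj z w → w = l') →
      X (insert z (A ∪ B)) = X A + X B - 6 → motive A → motive B → motive (insert z (A ∪ B)))
    {R : Finset (ℤ × ℤ)} (hR : Conn R) : motive R := by
  induction hn : R.card using Nat.strong_induction_on generalizing R with
  | _ n ih =>
  obtain ⟨z, hz, hmax⟩ := exists_lex_max hR.1
  set S := R.erase z with hS
  have hzS : z ∉ S := Finset.notMem_erase z R
  have hRS : R = insert z S := (Finset.insert_erase hz).symm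
  have hcard : S.card < n := by
    rw [hS, Finset.card_erase_of_mem hz, hn]
    have := Finset.card_pos.2 hR.1
    omega
  have hX := X_insert_lower hzS hmax
  have hlow := fun u hu h => adj_lower (u := u) hzS hmax hu h
  set l1 : ℤ × ℤ := (z.1 - 1, z.2 + 1) with hl1
  set l2 : ℤ × ℤ := (z.1 - 1, z.2) with hl2
  set l3 : ℤ × ℤ := (z.1, z.2 - 1) with hl3
  have a1 : Adj z l1 := by unfold Adj; simp only [hl1]; omega
  have a2 : Adj z l2 := by unfold Adj; simp only [hl2]; omega
  have a3 : Adj z l3 := by unfold Adj; simp only [hl3]; omega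
  have a12 : Adj l2 l1 := by unfold Adj; simp only [hl1, hl2]; omega
  have a23 : Adj l2 l3 := by unfold Adj; simp only [hl2, hl3]; omega
  -- every component of `S` touches `z`
  have touch : ∀ C ⊆ S, C.Nonempty → (∀ u ∈ C, ∀ v ∈ S, Adj u v → v ∈ C) →
      (∀ w ∈ S, Adj z w → w ∈ C) → C = S := by
    intro C hC hne hcl hw
    refine Finset.Subset.antisymm hC fun v hv => ?_
    have := hR.2 (fun x => x ∈ C ∨ x = z) ⟨z, hz, Or.inr rfl⟩ (by
      intro u hu v hv huv h
      by_cases hvz : v = z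
      · exact Or.inr hvz
      have hvS : v ∈ S := Finset.mem_erase.2 ⟨hvz, hv⟩
      rcases h with h | rfl
      · exact Or.inl (hcl u h v hvS huv)
      · exact Or.inl (hw v hvS huv)) v (Finset.mem_of_mem_erase hv)
    rcases this with h | h
    · exact h
    · exact absurd (h ▸ hv) hzS
  have connS : ∀ l ∈ S, (∀ w ∈ S, Adj z w → w ∈ comp S l) → Conn S := by
    intro l hl hw
    rw [← touch (comp S l) (comp_subset _ _) ⟨l, self_mem_comp hl⟩
      (fun u hu v hv h => comp_closed hu hv h) hw]
    exact comp_conn hl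
  have coneS : ∀ l ∈ S, Adj z l → (∀ w ∈ S, Adj z w → w = l ∨ Adj l w) →
      X (insert z S) = X S → motive R := by
    intro l hl hzl hw hXS
    have hc : Conn S := connS l hl (fun w hwS hzw => by
      rcases hw w hwS hzw with rfl | h
      · exact self_mem_comp hl
      · exact comp_closed (self_mem_comp hl) hwS h)
    rw [hRS]
    exact cone S z l hc hzS hl hzl hw hXS (ih _ hcard hc rfl)
  by_cases h2 : l2 ∈ S
  · refine coneS l2 h2 a2 (fun w hw hzw => ?_) ?_
    · rcases hlow w hw hzw with rfl | rfl | rfl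
      exacts [Or.inr a12, Or.inl rfl, Or.inr a23]
    · rw [hX]; simp only [h2, and_true]; split_ifs <;> omega
  by_cases h1 : l1 ∈ S
  · by_cases h3 : l3 ∈ S
    · have hX' : X (insert z S) = X S - 6 := by
        rw [hX]; simp only [h1, h2, h3, if_true, if_false, and_false]; omega
      have hn13 : ∀ w ∈ S, Adj z w → w = l1 ∨ w = l3 := fun w hw hzw => by
        rcases hlow w hw hzw with rfl | rfl | rfl
        exacts [Or.inl rfl, absurd hw h2, Or.inr rfl]
      by_cases hc : l3 ∈ comp S l1
      · have hcS : Conn S := connS l1 h1 (fun w hw hzw => by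
          rcases hn13 w hw hzw with rfl | rfl
          exacts [self_mem_comp h1, hc])
        rw [hRS]
        exact bridge S z l1 l3 hcS hzS h1 h3 a1 a3 hn13 hX' (ih _ hcard hcS rfl)
      · set A := comp S l1 with hA
        set B := comp S l3 with hB
        have hAS : A ⊆ S := comp_subset _ _
        have hBS : B ⊆ S := comp_subset _ _
        have hdis : Disjoint A B := by
          rw [Finset.disjoint_left]
          intro w hwA hwB
          have e1 := comp_eq_of_mem hwA
          have e2 := comp_eq_of_mem hwB
          exact hc (by rw [hA, ← e1, e2]; exact self_mem_comp h3)
        have hap : Apart A B := fun u hu v hv h =>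
          Finset.disjoint_left.1 hdis (comp_closed hu (hBS hv) h) hv
        have hAB : A ∪ B = S := by
          refine touch _ (Finset.union_subset hAS hBS) ⟨l1, ?_⟩ ?_ ?_
          · exact Finset.mem_union_left _ (self_mem_comp h1)
          · intro u hu v hv h
            rcases Finset.mem_union.1 hu with hu | hu
            · exact Finset.mem_union_left _ (comp_closed hu hv h)
            · exact Finset.mem_union_right _ (comp_closed hu hv h)
          · intro w hw hzw
            rcases hn13 w hw hzw with rfl | rfl
            · exact Finset.mem_union_left _ (self_mem_comp h1)
            · exact Finset.mem_union_right _ (self_mem_comp h3)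
        have hXS : X S = X A + X B := by rw [← hAB, X_union hdis, hap.J_eq]; ring
        rw [hRS, ← hAB]
        refine join A B z l1 l3 (comp_conn h1) (comp_conn h3) hdis hap (fun h => hzS (hAS h))
          (fun h => hzS (hBS h)) (self_mem_comp h1) (self_mem_comp h3) a1 a3 ?_ ?_ ?_
          (ih _ (lt_of_le_of_lt (Finset.card_le_card hAS) hcard) (comp_conn h1) rfl)
          (ih _ (lt_of_le_of_lt (Finset.card_le_card hBS) hcard) (comp_conn h3) rfl)
        · intro w hw hzw
          rcases hn13 w (hAS hw) hzw with h | h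
          · exact h
          · exact absurd (h ▸ hw) (Finset.disjoint_right.1 hdis (self_mem_comp h3))
        · intro w hw hzw
          rcases hn13 w (hBS hw) hzw with h | h
          · exact absurd (h ▸ hw) (Finset.disjoint_left.1 hdis (self_mem_comp h1))
          · exact h
        · rw [hAB, hX', hXS]
    · refine coneS l1 h1 a1 (fun w hw hzw => ?_) ?_
      · rcases hlow w hw hzw with rfl | rfl | rfl
        exacts [Or.inl rfl, absurd hw h2, absurd hw h3]
      · rw [hX]; simp only [h1, h2, h3, if_true, if_false, and_false]; omega
  · by_cases h3 : l3 ∈ S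
    · refine coneS l3 h3 a3 (fun w hw hzw => ?_) ?_
      · rcases hlow w hw hzw with rfl | rfl | rfl
        exacts [absurd hw h1, absurd hw h2, Or.inl rfl]
      · rw [hX]; simp only [h1, h2, h3, if_true, if_false, and_false]; omega
    · have : (∅ : Finset (ℤ × ℤ)) = S ∨ S = ∅ := by
        by_cases hne : S = ∅
        · exact Or.inr hne
        · obtain ⟨u, hu⟩ := Finset.nonempty_iff_ne_empty.2 hne
          left
          exfalso
          have := hR.2 (· ∈ S) ⟨u, Finset.mem_of_mem_erase hu, hu⟩ (by
            intro x hx y hy hxy hxS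
            refine Finset.mem_erase.2 ⟨?_, hy⟩
            rintro rfl
            rcases hlow x hxS hxy.symm with rfl | rfl | rfl
            exacts [h1 hxS, h2 hxS, h3 hxS]) z hz
          exact hzS this
      have hS0 : S = ∅ := by rcases this with h | h; exacts [h.symm, h]
      rw [hRS, hS0]
      exact single z

theorem Conn.X_le {R : Finset (ℤ × ℤ)} (hR : Conn R) : X R ≤ 6 := by
  refine Conn.induction (R := R) (motive := fun R => X R ≤ 6) (fun z => (X_singleton z).le)
    ?_ ?_ ?_ hR
  · intro R z l _ _ _ _ _ h ih; rw [h]; exact ih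
  · intro R z l l' _ _ _ _ _ _ _ h ih; rw [h]; omega
  · intro A B z l l' _ _ _ _ _ _ _ _ _ _ _ _ h ih1 ih2; rw [h]; omega

end TriLattice

namespace TriLattice

/-- A cocycle on a connected region is a coboundary modulo the span of few vectors. -/
theorem Conn.exists_potential {H : Type*} [AddCommGroup H] [Module (ZMod 2) H]
    (φ : ℤ × ℤ → ℤ × ℤ → H) (hs : ∀ u v, φ u v = φ v u) {R : Finset (ℤ × ℤ)} (hR : Conn R)
    (ht : ∀ u ∈ R, ∀ v ∈ R, ∀ w ∈ R, Adj u v → Adj v w → Adj u w → φ u v + φ v w = φ u w) :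
    ∃ (S : Finset H) (g : ℤ × ℤ → H), 6 * (S.card : ℤ) ≤ 6 - X R ∧
      ∀ u ∈ R, ∀ v ∈ R, Adj u v →
        φ u v + g u + g v ∈ Submodule.span (ZMod 2) (S : Set H) := by
  classical
  have two : ∀ x : H, x + x = 0 := ZModModule.add_self
  -- it suffices to treat pairs in `A` and pairs from `z` to `A`
  have ins : ∀ (A : Finset (ℤ × ℤ)) (z : ℤ × ℤ) (g : ℤ × ℤ → H) (M : Submodule (ZMod 2) H),
      (∀ u ∈ A, ∀ v ∈ A, Adj u v → φ u v + g u + g v ∈ M) →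
      (∀ w ∈ A, Adj z w → φ z w + g z + g w ∈ M) →
      ∀ u ∈ insert z A, ∀ v ∈ insert z A, Adj u v → φ u v + g u + g v ∈ M := by
    intro A z g M h1 h2 u hu v hv h
    rcases Finset.mem_insert.1 hu with rfl | hu' <;> rcases Finset.mem_insert.1 hv with rfl | hv'
    · exact absurd h (not_adj_self _)
    · exact h2 v hv' h
    · have := h2 u hu' h.symm
      rw [hs]; convert this using 1; abel
    · exact h1 u hu' v hv' h
  revert ht
  refine Conn.induction (R := R) (motive := fun R => (∀ u ∈ R, ∀ v ∈ R, ∀ w ∈ R, Adj u v →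
    Adj v w → Adj u w → φ u v + φ v w = φ u w) → ∃ (S : Finset H) (g : ℤ × ℤ → H),
      6 * (S.card : ℤ) ≤ 6 - X R ∧ ∀ u ∈ R, ∀ v ∈ R, Adj u v →
        φ u v + g u + g v ∈ Submodule.span (ZMod 2) (S : Set H)) ?_ ?_ ?_ ?_ hR
  · intro z _
    refine ⟨∅, 0, by simp [X_singleton], fun u hu v hv h => ?_⟩
    simp only [Finset.mem_singleton] at hu hv
    subst hu hv
    exact absurd h (not_adj_self _)
  · intro R z l hR hz hl hzl hw hX ih ht
    obtain ⟨S, g, hS, hg⟩ := ih (fun u hu v hv w hw => ht u (Finset.mem_insert_of_mem hu) v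
      (Finset.mem_insert_of_mem hv) w (Finset.mem_insert_of_mem hw))
    have hne : ∀ u ∈ R, u ≠ z := fun u hu h => hz (h ▸ hu)
    refine ⟨S, Function.update g z (g l + φ z l), by rw [hX]; exact hS, ?_⟩
    apply ins
    · intro u hu v hv h
      rw [Function.update_of_ne (hne u hu), Function.update_of_ne (hne v hv)]
      exact hg u hu v hv h
    · intro w hwR hzw
      rw [Function.update_self, Function.update_of_ne (hne w hwR)]
      rcases hw w hwR hzw with rfl | hlw
      · have : φ z w + (g w + φ z w) + g w = (φ z w + φ z w) + (g w + g w) := by abel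
        rw [this, two, two, add_zero]; exact Submodule.zero_mem _
      · have h1 := ht z (Finset.mem_insert_self _ _) l (Finset.mem_insert_of_mem hl) w
          (Finset.mem_insert_of_mem hwR) hzl hlw hzw
        have : φ z w + (g l + φ z l) + g w = φ l w + g l + g w := by
          rw [← h1, show φ z l + φ l w + (g l + φ z l) + g w =
            φ l w + g l + g w + (φ z l + φ z l) by abel, two, add_zero]
        rw [this]
        exact hg l hl w hwR hlw
  · intro R z l l' hR hz hl hl' hzl hzl' hw hX ih ht
    obtain ⟨S, g, hS, hg⟩ := ih (fun u hu v hv w hw => ht u (Finset.mem_insert_of_mem hu) v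
      (Finset.mem_insert_of_mem hv) w (Finset.mem_insert_of_mem hw))
    have hne : ∀ u ∈ R, u ≠ z := fun u hu h => hz (h ▸ hu)
    refine ⟨insert (φ z l' + (g l + φ z l) + g l') S, Function.update g z (g l + φ z l), ?_, ?_⟩
    · rw [hX]
      have := Finset.card_insert_le (φ z l' + (g l + φ z l) + g l') S
      omega
    apply ins
    · intro u hu v hv h
      rw [Function.update_of_ne (hne u hu), Function.update_of_ne (hne v hv)]
      exact Submodule.span_mono (by simp) (hg u hu v hv h)
    · intro w hwR hzw
      rw [Function.update_self, Function.update_of_ne (hne w hwR)]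
      rcases hw w hwR hzw with rfl | rfl
      · have : φ z w + (g w + φ z w) + g w = (φ z w + φ z w) + (g w + g w) := by abel
        rw [this, two, two, add_zero]; exact Submodule.zero_mem _
      · exact Submodule.subset_span (by simp)
  · intro A B z l l' hA hB hdis hap hzA hzB hl hl' hzl hzl' hwA hwB hX ihA ihB ht
    obtain ⟨SA, gA, hSA, hgA⟩ := ihA (fun u hu v hv w hw => ht u
      (Finset.mem_insert_of_mem (Finset.mem_union_left _ hu)) v
      (Finset.mem_insert_of_mem (Finset.mem_union_left _ hv)) w
      (Finset.mem_insert_of_mem (Finset.mem_union_left _ hw)))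
    obtain ⟨SB, gB, hSB, hgB⟩ := ihB (fun u hu v hv w hw => ht u
      (Finset.mem_insert_of_mem (Finset.mem_union_right _ hu)) v
      (Finset.mem_insert_of_mem (Finset.mem_union_right _ hv)) w
      (Finset.mem_insert_of_mem (Finset.mem_union_right _ hw)))
    set k : H := gA l + φ z l with hk
    set c : H := φ z l' + k + gB l' with hc
    let g : ℤ × ℤ → H := fun u => if u = z then k else if u ∈ A then gA u else gB u + c
    have gz : g z = k := by simp [g]
    have gAe : ∀ u ∈ A, g u = gA u := fun u hu => by
      have : u ≠ z := fun h => hzA (h ▸ hu)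
      simp [g, this, hu]
    have gBe : ∀ u ∈ B, g u = gB u + c := fun u hu => by
      have h1 : u ≠ z := fun h => hzB (h ▸ hu)
      have h2 : u ∉ A := Finset.disjoint_right.1 hdis hu
      simp [g, h1, h2]
    refine ⟨SA ∪ SB, g, ?_, ?_⟩
    · rw [hX]
      have := Finset.card_union_le SA SB
      omega
    apply ins
    · intro u hu v hv h
      rcases Finset.mem_union.1 hu with hu | hu <;> rcases Finset.mem_union.1 hv with hv | hv
      · rw [gAe u hu, gAe v hv]
        exact Submodule.span_mono (by simp) (hgA u hu v hv h)
      · exact absurd h (hap u hu v hv)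
      · exact absurd h.symm (hap v hv u hu)
      · rw [gBe u hu, gBe v hv, show φ u v + (gB u + c) + (gB v + c) =
          φ u v + gB u + gB v + (c + c) by abel, two, add_zero]
        exact Submodule.span_mono (by simp) (hgB u hu v hv h)
    · intro w hw hzw
      rcases Finset.mem_union.1 hw with hw | hw
      · obtain rfl := hwA w hw hzw
        rw [gz, gAe w hw, hk, show φ z w + (gA w + φ z w) + gA w =
          (φ z w + φ z w) + (gA w + gA w) by abel, two, two, add_zero]
        exact Submodule.zero_mem _
      · obtain rfl := hwB w hw hzw
        rw [gz, gBe w hw, hc, show φ z w + k + (gB w + (φ z w + k + gB w)) =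
          (φ z w + φ z w) + (k + k) + (gB w + gB w) by abel]
        simp only [two]
        exact Submodule.zero_mem _

/-- A compatible system of relations on a simply connected region has a section through
every value at a given cell. -/
theorem Conn.exists_section {Z : Type*} (valid : ℤ × ℤ → Z → Prop)
    (ρ : ℤ × ℤ → ℤ × ℤ → Z → Z → Prop) {R : Finset (ℤ × ℤ)} (hR : Conn R) (hX : X R = 6)
    (hs : ∀ u ∈ R, ∀ v ∈ R, ∀ x y, Adj u v → ρ u v x y → ρ v u y x)
    (ht : ∀ u ∈ R, ∀ v ∈ R, ∀ w ∈ R, Adj u v → Adj v w → Adj u w → ∀ x y z,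
      ρ u v x y → ρ v w y z → ρ u w x z)
    {r : ℤ × ℤ} (hr : r ∈ R) {z : Z} (hz : valid r z)
    (he : ∀ u ∈ R, ∀ v ∈ R, Adj u v → v ≠ r → ∀ x, valid u x → ∃ y, valid v y ∧ ρ u v x y) :
    ∃ s : ℤ × ℤ → Z, s r = z ∧ (∀ u ∈ R, valid u (s u)) ∧
      ∀ u ∈ R, ∀ v ∈ R, Adj u v → ρ u v (s u) (s v) := by
  classical
  revert hX hs ht r z
  refine Conn.induction (R := R) (motive := fun R => X R = 6 →
    (∀ u ∈ R, ∀ v ∈ R, ∀ x y, Adj u v → ρ u v x y → ρ v u y x) →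
    (∀ u ∈ R, ∀ v ∈ R, ∀ w ∈ R, Adj u v → Adj v w → Adj u w → ∀ x y z,
      ρ u v x y → ρ v w y z → ρ u w x z) → ∀ {r : ℤ × ℤ}, r ∈ R → ∀ {z : Z}, valid r z →
    (∀ u ∈ R, ∀ v ∈ R, Adj u v → v ≠ r → ∀ x, valid u x → ∃ y, valid v y ∧ ρ u v x y) →
    ∃ s : ℤ × ℤ → Z, s r = z ∧ (∀ u ∈ R, valid u (s u)) ∧
      ∀ u ∈ R, ∀ v ∈ R, Adj u v → ρ u v (s u) (s v)) ?_ ?_ ?_ ?_ hR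
  · intro c _ _ _ r hr z hz _
    refine ⟨fun _ => z, rfl, ?_, ?_⟩
    · intro u hu
      rw [Finset.mem_singleton] at hu hr
      rw [hu, ← hr]; exact hz
    · intro u hu v hv h
      rw [Finset.mem_singleton] at hu hv
      subst hu hv
      exact absurd h (not_adj_self _)
  · intro R c l hR hc hl hcl hw hX ih hX' hs ht r hr z hz he
    have sub : ∀ {u}, u ∈ R → u ∈ insert c R := fun h => Finset.mem_insert_of_mem h
    have hcc := Finset.mem_insert_self c R
    have hne : ∀ u ∈ R, u ≠ c := fun u hu h => hc (h ▸ hu)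
    have ih' := @ih (by rw [← hX]; exact hX') (fun u hu v hv => hs u (sub hu) v (sub hv))
      (fun u hu v hv w hw => ht u (sub hu) v (sub hv) w (sub hw))
    have key : ∃ s : ℤ × ℤ → Z, ∃ y : Z, ((∀ u ∈ R, valid u (s u)) ∧
      (∀ u ∈ R, ∀ v ∈ R, Adj u v → ρ u v (s u) (s v))) ∧ valid c y ∧ ρ c l y (s l) ∧
        (r ∈ R → s r = z) ∧ (r = c → y = z) := by
      rcases Finset.mem_insert.1 hr with rfl | hrR
      · obtain ⟨y, hy, hzy⟩ := he r hr l (sub hl) hcl (hne l hl) z hz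
        obtain ⟨s, hs1, hs2, hs3⟩ := @ih' l hl y hy
          (fun u hu v hv huv _ => he u (sub hu) v (sub hv) huv (hne v hv))
        exact ⟨s, z, ⟨hs2, hs3⟩, hz, hs1 ▸ hzy, fun h => absurd h hc, fun _ => rfl⟩
      · obtain ⟨s, hs1, hs2, hs3⟩ := @ih' r hrR z hz
          (fun u hu v hv huv hvr => he u (sub hu) v (sub hv) huv hvr)
        obtain ⟨y, hy, hly⟩ := he l (sub hl) c hcc hcl.symm (hne r hrR).symm (s l) (hs2 l hl)
        exact ⟨s, y, ⟨hs2, hs3⟩, hy, hs l (sub hl) c hcc _ _ hcl.symm hly, fun _ => hs1,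
          fun h => absurd h (hne r hrR)⟩
    obtain ⟨s, y, ⟨hs2, hs3⟩, hy, hcy, hr1, hr2⟩ := key
    have hcw : ∀ w ∈ R, Adj c w → ρ c w y (s w) := by
      intro w hwR hcw
      rcases hw w hwR hcw with rfl | hlw
      · exact hcy
      · exact ht c hcc l (sub hl) w (sub hwR) hcl hlw hcw _ _ _ hcy (hs3 l hl w hwR hlw)
    refine ⟨Function.update s c y, ?_, ?_, ?_⟩
    · rcases Finset.mem_insert.1 hr with rfl | hrR
      · rw [Function.update_self]; exact hr2 rfl
      · rw [Function.update_of_ne (hne r hrR)]; exact hr1 hrR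
    · intro u hu
      rcases Finset.mem_insert.1 hu with rfl | hu
      · rw [Function.update_self]; exact hy
      · rw [Function.update_of_ne (hne u hu)]; exact hs2 u hu
    · intro u hu v hv h
      rcases Finset.mem_insert.1 hu with rfl | hu' <;> rcases Finset.mem_insert.1 hv with rfl | hv'
      · exact absurd h (not_adj_self _)
      · rw [Function.update_self, Function.update_of_ne (hne v hv')]; exact hcw v hv' h
      · rw [Function.update_self, Function.update_of_ne (hne u hu')]
        exact hs _ hcc u hu _ _ h.symm (hcw u hu' h.symm)
      · rw [Function.update_of_ne (hne u hu'), Function.update_of_ne (hne v hv')]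
        exact hs3 u hu' v hv' h
  · intro R c l l' hR _ _ _ _ _ _ hX _ hX' _ _ _ _ _ _ _
    have := hR.X_le
    omega
  · intro A B c l l' hA hB hdis hap hcA hcB hl hl' hcl hcl' hwA hwB hX ihA ihB hX' hs ht r hr
      z hz he
    have XA := hA.X_le
    have XB := hB.X_le
    have subA : ∀ {u}, u ∈ A → u ∈ insert c (A ∪ B) := fun h =>
      Finset.mem_insert_of_mem (Finset.mem_union_left _ h)
    have subB : ∀ {u}, u ∈ B → u ∈ insert c (A ∪ B) := fun h =>
      Finset.mem_insert_of_mem (Finset.mem_union_right _ h)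
    have hcc := Finset.mem_insert_self c (A ∪ B)
    have neA : ∀ u ∈ A, u ≠ c := fun u hu h => hcA (h ▸ hu)
    have neB : ∀ u ∈ B, u ≠ c := fun u hu h => hcB (h ▸ hu)
    have nAB : ∀ u ∈ A, u ∉ B := fun u hu => Finset.disjoint_left.1 hdis hu
    have nBA : ∀ u ∈ B, u ∉ A := fun u hu => Finset.disjoint_right.1 hdis hu
    have ihA' := @ihA (by omega) (fun u hu v hv => hs u (subA hu) v (subA hv))
      (fun u hu v hv w hw => ht u (subA hu) v (subA hv) w (subA hw))
    have ihB' := @ihB (by omega) (fun u hu v hv => hs u (subB hu) v (subB hv))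
      (fun u hu v hv w hw => ht u (subB hu) v (subB hv) w (subB hw))
    -- propagate a value at the new cell into either side
    have goA : ∀ y, valid c y → r ∉ A → ∃ s : ℤ × ℤ → Z, ρ c l y (s l) ∧
        (∀ u ∈ A, valid u (s u)) ∧ ∀ u ∈ A, ∀ v ∈ A, Adj u v → ρ u v (s u) (s v) := by
      intro y hy hrA
      have hnr : ∀ v ∈ A, v ≠ r := fun v hv h => hrA (h ▸ hv)
      obtain ⟨t, ht1, ht2⟩ := he c hcc l (subA hl) hcl (hnr l hl) y hy
      obtain ⟨s, h1, h2, h3⟩ := @ihA' l hl t ht1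
        (fun u hu v hv huv _ => he u (subA hu) v (subA hv) huv (hnr v hv))
      exact ⟨s, h1 ▸ ht2, h2, h3⟩
    have goB : ∀ y, valid c y → r ∉ B → ∃ s : ℤ × ℤ → Z, ρ c l' y (s l') ∧
        (∀ u ∈ B, valid u (s u)) ∧ ∀ u ∈ B, ∀ v ∈ B, Adj u v → ρ u v (s u) (s v) := by
      intro y hy hrA
      have hnr : ∀ v ∈ B, v ≠ r := fun v hv h => hrA (h ▸ hv)
      obtain ⟨t, ht1, ht2⟩ := he c hcc l' (subB hl') hcl' (hnr l' hl') y hy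
      obtain ⟨s, h1, h2, h3⟩ := @ihB' l' hl' t ht1
        (fun u hu v hv huv _ => he u (subB hu) v (subB hv) huv (hnr v hv))
      exact ⟨s, h1 ▸ ht2, h2, h3⟩
    have key : ∃ (sA sB : ℤ × ℤ → Z) (y : Z), valid c y ∧ ρ c l y (sA l) ∧ ρ c l' y (sB l') ∧
        ((∀ u ∈ A, valid u (sA u)) ∧ ∀ u ∈ A, ∀ v ∈ A, Adj u v → ρ u v (sA u) (sA v)) ∧
        ((∀ u ∈ B, valid u (sB u)) ∧ ∀ u ∈ B, ∀ v ∈ B, Adj u v → ρ u v (sB u) (sB v)) ∧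
        (r = c → y = z) ∧ (r ∈ A → sA r = z) ∧ (r ∈ B → sB r = z) := by
      rcases Finset.mem_insert.1 hr with rfl | hr'
      · obtain ⟨sA, a1, a2⟩ := goA z hz hcA
        obtain ⟨sB, b1, b2⟩ := goB z hz hcB
        exact ⟨sA, sB, z, hz, a1, b1, a2, b2, fun _ => rfl, fun h => absurd h hcA,
          fun h => absurd h hcB⟩
      rcases Finset.mem_union.1 hr' with hrA | hrB
      · obtain ⟨sA, a1, a2, a3⟩ := @ihA' r hrA z hz
          (fun u hu v hv huv hvr => he u (subA hu) v (subA hv) huv hvr)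
        obtain ⟨y, hy, hly⟩ := he l (subA hl) c hcc hcl.symm (neA r hrA).symm _ (a2 l hl)
        obtain ⟨sB, b1, b2⟩ := goB y hy (nAB r hrA)
        exact ⟨sA, sB, y, hy, hs l (subA hl) c hcc _ _ hcl.symm hly, b1, ⟨a2, a3⟩, b2,
          fun h => absurd h (neA r hrA), fun _ => a1, fun h => absurd h (nAB r hrA)⟩
      · obtain ⟨sB, a1, a2, a3⟩ := @ihB' r hrB z hz
          (fun u hu v hv huv hvr => he u (subB hu) v (subB hv) huv hvr)
        obtain ⟨y, hy, hly⟩ := he l' (subB hl') c hcc hcl'.symm (neB r hrB).symm _ (a2 l' hl')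
        obtain ⟨sA, b1, b2⟩ := goA y hy (nBA r hrB)
        exact ⟨sA, sB, y, hy, b1, hs l' (subB hl') c hcc _ _ hcl'.symm hly, b2, ⟨a2, a3⟩,
          fun h => absurd h (neB r hrB), fun h => absurd h (nBA r hrB), fun _ => a1⟩
    obtain ⟨sA, sB, y, hy, hA1, hB1, ⟨hA2, hA3⟩, ⟨hB2, hB3⟩, r1, r2, r3⟩ := key
    let s : ℤ × ℤ → Z := fun u => if u = c then y else if u ∈ A then sA u else sB u
    have ec : s c = y := by simp [s]
    have eA : ∀ u ∈ A, s u = sA u := fun u hu => by simp [s, neA u hu, hu]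
    have eB : ∀ u ∈ B, s u = sB u := fun u hu => by simp [s, neB u hu, nBA u hu]
    have hcw : ∀ w ∈ A ∪ B, Adj c w → ρ c w y (s w) := by
      intro w hw hcw
      rcases Finset.mem_union.1 hw with hw | hw
      · obtain rfl := hwA w hw hcw
        rw [eA w hw]; exact hA1
      · obtain rfl := hwB w hw hcw
        rw [eB w hw]; exact hB1
    refine ⟨s, ?_, ?_, ?_⟩
    · rcases Finset.mem_insert.1 hr with h | h
      · rw [h, ec]; exact r1 h
      rcases Finset.mem_union.1 h with h | h
      · rw [eA r h]; exact r2 h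
      · rw [eB r h]; exact r3 h
    · intro u hu
      rcases Finset.mem_insert.1 hu with rfl | h
      · rw [ec]; exact hy
      rcases Finset.mem_union.1 h with h | h
      · rw [eA u h]; exact hA2 u h
      · rw [eB u h]; exact hB2 u h
    · intro u hu v hv h
      rcases Finset.mem_insert.1 hu with rfl | hu' <;> rcases Finset.mem_insert.1 hv with rfl | hv'
      · exact absurd h (not_adj_self _)
      · rw [ec]; exact hcw v hv' h
      · rw [ec]; exact hs _ hcc u hu _ _ h.symm (hcw u hu' h.symm)
      · rcases Finset.mem_union.1 hu' with hu' | hu' <;>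
          rcases Finset.mem_union.1 hv' with hv' | hv'
        · rw [eA u hu', eA v hv']; exact hA3 u hu' v hv' h
        · exact absurd h (hap u hu' v hv')
        · exact absurd h.symm (hap v hv' u hu')
        · rw [eB u hu', eB v hv']; exact hB3 u hu' v hv' h

end TriLattice

namespace TriLattice

/-- A family of pairwise disjoint sets of cells without adjacencies between them. -/
def Sep {ι : Type*} (F : ι → Finset (ℤ × ℤ)) : Prop :=
  ∀ i j, i ≠ j → Disjoint (F i) (F j) ∧ Apart (F i) (F j)

theorem Sep.disjoint_biUnion {ι : Type*} [DecidableEq ι] {F : ι → Finset (ℤ × ℤ)} (h : Sep F)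
    {i : ι} {S : Finset ι} (hi : i ∉ S) : Disjoint (F i) (S.biUnion F) := by
  rw [Finset.disjoint_biUnion_right]
  exact fun j hj => (h i j (fun e => hi (e ▸ hj))).1

theorem Sep.apart_biUnion {ι : Type*} [DecidableEq ι] {F : ι → Finset (ℤ × ℤ)} (h : Sep F)
    {i : ι} {S : Finset ι} (hi : i ∉ S) : Apart (F i) (S.biUnion F) := by
  intro u hu v hv
  obtain ⟨j, hj, hv⟩ := Finset.mem_biUnion.1 hv
  exact (h i j (fun e => hi (e ▸ hj))).2 u hu v hv

theorem X_biUnion {ι : Type*} [DecidableEq ι] {F : ι → Finset (ℤ × ℤ)} (h : Sep F)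
    (S : Finset ι) : X (S.biUnion F) = ∑ i ∈ S, X (F i) := by
  induction S using Finset.induction_on with
  | empty => simp [X_empty]
  | insert i S hi ih =>
    rw [Finset.biUnion_insert, X_union (h.disjoint_biUnion hi), (h.apart_biUnion hi).J_eq,
      Finset.sum_insert hi, ih]
    ring

theorem J_empty (A : Finset (ℤ × ℤ)) : J A ∅ = 0 := by simp [J, E, T]

theorem J_biUnion {ι : Type*} [DecidableEq ι] {F : ι → Finset (ℤ × ℤ)} (h : Sep F)
    (A : Finset (ℤ × ℤ)) (S : Finset ι) : J A (S.biUnion F) = ∑ i ∈ S, J A (F i) := by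
  induction S using Finset.induction_on with
  | empty => simp [J_empty]
  | insert i S hi ih =>
    rw [Finset.biUnion_insert, J_union_right (h.disjoint_biUnion hi), Finset.sum_insert hi, ih,
      T_swap_left, T_swap_right, (h.apart_biUnion hi).T_eq]
    ring

theorem T_biUnion_left {ι : Type*} [DecidableEq ι] {F : ι → Finset (ℤ × ℤ)} (S : Finset ι)
    (h : (S : Set ι).PairwiseDisjoint F) (A B : Finset (ℤ × ℤ)) :
    T (S.biUnion F) A B = ∑ i ∈ S, T (F i) A B := by
  unfold T; rw [Finset.sum_biUnion h]

theorem Sep.pairwiseDisjoint {ι : Type*} {F : ι → Finset (ℤ × ℤ)} (h : Sep F) (S : Set ι) :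
    S.PairwiseDisjoint F := fun i _ j _ hij => (h i j hij).1

theorem Conn.union_biUnion {ι : Type*} [DecidableEq ι] {F : ι → Finset (ℤ × ℤ)}
    {A : Finset (ℤ × ℤ)} (hA : Conn A) (S : Finset ι) (hF : ∀ i ∈ S, Conn (F i))
    (ht : ∀ i ∈ S, ∃ u ∈ A, ∃ v ∈ F i, Adj u v) : Conn (A ∪ S.biUnion F) := by
  induction S using Finset.induction_on with
  | empty => simpa using hA
  | insert i S hi ih =>
    have h1 := ih (fun j hj => hF j (Finset.mem_insert_of_mem hj))
      (fun j hj => ht j (Finset.mem_insert_of_mem hj))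
    obtain ⟨u, hu, v, hv, huv⟩ := ht i (Finset.mem_insert_self i S)
    have := h1.union (hF i (Finset.mem_insert_self i S))
      ⟨u, Finset.mem_union_left _ hu, v, hv, Or.inr huv⟩
    rw [Finset.biUnion_insert]
    rwa [Finset.union_assoc, Finset.union_comm (S.biUnion F)] at this

/-- Contacts between a simply connected region and separated simply connected regions:
the number of contact classes is at most half the total number of junctions. -/
theorem contact_card {ι Q : Type*} [Fintype ι] (κ : ℤ × ℤ → ℤ × ℤ → Q) {Y : Finset (ℤ × ℤ)}
    {D : ι → Finset (ℤ × ℤ)} (hY : Conn Y) (hXY : X Y = 6) (hD : ∀ v, Conn (D v))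
    (hXD : ∀ v, X (D v) = 6) (hdis : ∀ v, Disjoint Y (D v)) (hsep : Sep D)
    (κ1 : ∀ u ∈ Y, ∀ u' ∈ Y, ∀ v, ∀ d ∈ D v, Adj u u' → Adj u d → Adj u' d → κ u d = κ u' d)
    (κ2 : ∀ u ∈ Y, ∀ v, ∀ d ∈ D v, ∀ d' ∈ D v, Adj d d' → Adj u d → Adj u d' → κ u d = κ u d')
    (C : Finset ((ℤ × ℤ) × (ℤ × ℤ)))
    (hC : ∀ c ∈ C, c.1 ∈ Y ∧ (∃ v, c.2 ∈ D v) ∧ Adj c.1 c.2)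
    (hinj : ∀ c ∈ C, ∀ c' ∈ C, κ c.1 c.2 = κ c'.1 c'.2 → c = c') :
    2 * (C.card : ℤ) ≤ ∑ v, J Y (D v) := by
  classical
  set K := Finset.univ.biUnion D with hK
  have hYK : Disjoint Y K := by
    rw [hK, Finset.disjoint_biUnion_right]; exact fun v _ => hdis v
  have nYK : ∀ u ∈ Y, u ∉ K := fun u hu => Finset.disjoint_left.1 hYK hu
  have nKY : ∀ u ∈ K, u ∉ Y := fun u hu => Finset.disjoint_right.1 hYK hu
  have κ1' : ∀ u ∈ Y, ∀ u' ∈ Y, ∀ d ∈ K, Adj u u' → Adj u d → Adj u' d → κ u d = κ u' d := by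
    intro u hu u' hu' d hd
    obtain ⟨v, _, hv⟩ := Finset.mem_biUnion.1 hd
    exact κ1 u hu u' hu' v d hv
  have κ2' : ∀ u ∈ Y, ∀ d ∈ K, ∀ d' ∈ K, Adj d d' → Adj u d → Adj u d' → κ u d = κ u d' := by
    intro u hu d hd d' hd' h
    obtain ⟨v, _, hv⟩ := Finset.mem_biUnion.1 hd
    obtain ⟨v', _, hv'⟩ := Finset.mem_biUnion.1 hd'
    by_cases hvv : v = v'
    · subst hvv; exact κ2 u hu v d hv d' hv' h
    · exact absurd h ((hsep v v' hvv).2 d hv d' hv')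
  let α : ℤ × ℤ → ℤ × ℤ → (C → ZMod 2) := fun u d c => if κ u d = κ c.1.1 c.1.2 then 1 else 0
  let φ : ℤ × ℤ → ℤ × ℤ → (C → ZMod 2) := fun u v =>
    if u ∈ Y ∧ v ∈ K then α u v else if v ∈ Y ∧ u ∈ K then α v u else 0
  have two : ∀ x : C → ZMod 2, x + x = 0 := ZModModule.add_self
  have αe : ∀ u d u' d', κ u d = κ u' d' → α u d = α u' d' := fun u d u' d' h => by
    simp only [α, h]
  have φYY : ∀ u ∈ Y, ∀ v ∈ Y, φ u v = 0 := fun u hu v hv => by simp [φ, nYK u hu, nYK v hv]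
  have φKK : ∀ u ∈ K, ∀ v ∈ K, φ u v = 0 := fun u hu v hv => by simp [φ, nKY u hu, nKY v hv]
  have φYK : ∀ u ∈ Y, ∀ v ∈ K, φ u v = α u v := fun u hu v hv => by simp [φ, hu, hv]
  have φKY : ∀ u ∈ K, ∀ v ∈ Y, φ u v = α v u := fun u hu v hv => by
    simp [φ, hu, hv, nKY u hu]
  have hφs : ∀ u v, φ u v = φ v u := by
    intro u v
    by_cases hu : u ∈ Y <;> by_cases hv : v ∈ Y <;> by_cases hu' : u ∈ K <;>
      by_cases hv' : v ∈ K <;> simp [φ, hu, hv, hu', hv']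
    exact absurd hu' (nYK u hu)
  set S := Finset.univ.filter (fun v => ∃ c ∈ C, c.2 ∈ D v) with hS
  have hSK : S.biUnion D ⊆ K :=
    Finset.biUnion_subset_biUnion_of_subset_left _ (Finset.subset_univ _)
  set R := Y ∪ S.biUnion D with hR
  have hRc : Conn R := by
    refine hY.union_biUnion S (fun v _ => hD v) (fun v hv => ?_)
    obtain ⟨c, hc, hcv⟩ := (Finset.mem_filter.1 hv).2
    exact ⟨c.1, (hC c hc).1, c.2, hcv, (hC c hc).2.2⟩
  have hRX : X R = 6 + 6 * S.card - 3 * ∑ v ∈ S, J Y (D v) := by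
    rw [hR, X_union (hYK.mono_right hSK), X_biUnion hsep, J_biUnion hsep, hXY,
      Finset.sum_congr rfl (fun v _ => hXD v)]
    simp; ring
  have hRm : ∀ u ∈ R, u ∈ Y ∨ u ∈ K := fun u hu => by
    rcases Finset.mem_union.1 hu with h | h
    exacts [Or.inl h, Or.inr (hSK h)]
  obtain ⟨B, g, hB, hg⟩ := hRc.exists_potential φ hφs (by
    intro u hu v hv w hw huv hvw huw
    rcases hRm u hu with hu | hu <;> rcases hRm v hv with hv | hv <;>
      rcases hRm w hw with hw | hw
    · rw [φYY u hu v hv, φYY v hv w hw, φYY u hu w hw, add_zero]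
    · rw [φYY u hu v hv, φYK v hv w hw, φYK u hu w hw, zero_add]
      exact αe _ _ _ _ (κ1' v hv u hu w hw huv.symm hvw huw)
    · rw [φYK u hu v hv, φKY v hv w hw, φYY u hu w hw,
        αe _ _ _ _ (κ1' u hu w hw v hv huw huv hvw.symm), two]
    · rw [φYK u hu v hv, φKK v hv w hw, φYK u hu w hw, add_zero]
      exact αe _ _ _ _ (κ2' u hu v hv w hw hvw huv huw)
    · rw [φKY u hu v hv, φYY v hv w hw, φKY u hu w hw, add_zero]
      exact αe _ _ _ _ (κ1' v hv w hw u hu hvw huv.symm huw.symm)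
    · rw [φKY u hu v hv, φYK v hv w hw, φKK u hu w hw,
        αe _ _ _ _ (κ2' v hv u hu w hw huw huv.symm hvw), two]
    · rw [φKK u hu v hv, φKY v hv w hw, φKY u hu w hw, zero_add]
      exact αe _ _ _ _ (κ2' w hw v hv u hu huv.symm hvw.symm huw.symm)
    · rw [φKK u hu v hv, φKK v hv w hw, φKK u hu w hw, add_zero])
  obtain ⟨y0, hy0⟩ := hY.1
  have hd0 : ∀ v, ∃ d, d ∈ D v := fun v => (hD v).1
  choose d0 hd0 using hd0
  set M := Submodule.span (ZMod 2) (B : Set (C → ZMod 2)) with hM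
  have YR : ∀ u ∈ Y, u ∈ R := fun u hu => Finset.mem_union_left _ hu
  have DR : ∀ v ∈ S, ∀ u ∈ D v, u ∈ R := fun v hv u hu =>
    Finset.mem_union_right _ (Finset.mem_biUnion.2 ⟨v, hv, hu⟩)
  have cst : ∀ (A : Finset (ℤ × ℤ)), Conn A → (∀ u ∈ A, u ∈ R) →
      (∀ u ∈ A, ∀ v ∈ A, φ u v = 0) → ∀ a ∈ A, ∀ b ∈ A, g a + g b ∈ M := by
    intro A hA hAR h0 a ha b hb
    refine hA.2 (fun b => g a + g b ∈ M) ⟨a, ha, by rw [two]; exact M.zero_mem⟩ ?_ b hb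
    intro u hu v hv huv h
    have h2 := hg u (hAR u hu) v (hAR v hv) huv
    rw [h0 u hu v hv, zero_add] at h2
    have := M.add_mem h h2
    rwa [show g a + g u + (g u + g v) = g a + g v + (g u + g u) by abel, two, add_zero] at this
  set W : Finset (C → ZMod 2) := B ∪ S.image (fun v => g (d0 v) + g y0) with hW
  have hBW : M ≤ Submodule.span (ZMod 2) (W : Set (C → ZMod 2)) :=
    Submodule.span_mono (by rw [hW]; simp)
  have htop : Submodule.span (ZMod 2) (W : Set (C → ZMod 2)) = ⊤ := by
    rw [eq_top_iff, ← (Pi.basisFun (ZMod 2) C).span_eq, Submodule.span_le]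
    rintro _ ⟨c, rfl⟩
    obtain ⟨h1, ⟨v, h2⟩, h3⟩ := hC c.1 c.2
    have hv : v ∈ S := Finset.mem_filter.2 ⟨Finset.mem_univ _, c.1, c.2, h2⟩
    have hvK : ∀ u ∈ D v, u ∈ K := fun u hu => hSK (Finset.mem_biUnion.2 ⟨v, hv, hu⟩)
    have e1 : Pi.basisFun (ZMod 2) C c = φ c.1.1 c.1.2 := by
      rw [φYK _ h1 _ (hvK _ h2)]
      ext c'
      simp only [Pi.basisFun_apply, Pi.single_apply, α]
      refine if_congr ⟨fun h => by rw [h], fun h => ?_⟩ rfl rfl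
      exact (Subtype.ext (hinj _ c.2 _ c'.2 h)).symm
    have m1 := hg _ (YR _ h1) _ (DR v hv _ h2) h3
    have m2 := cst Y hY YR φYY _ h1 _ hy0
    have m3 := cst (D v) (hD v) (DR v hv) (fun a ha b hb => φKK a (hvK a ha) b (hvK b hb)) _ h2 _
      (hd0 v)
    have m4 : g (d0 v) + g y0 ∈ Submodule.span (ZMod 2) (W : Set (C → ZMod 2)) :=
      Submodule.subset_span (by rw [hW]; simp only [Finset.coe_union, Finset.coe_image]
                                exact Or.inr ⟨v, hv, rfl⟩)
    have m5 := Submodule.add_mem _ (hBW (M.add_mem (M.add_mem m1 m2) m3)) m4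
    rw [SetLike.mem_coe, e1]
    have e2 : φ c.1.1 c.1.2 + g c.1.1 + g c.1.2 + (g c.1.1 + g y0) + (g c.1.2 + g (d0 v)) +
        (g (d0 v) + g y0) = φ c.1.1 c.1.2 + ((g c.1.1 + g c.1.1) + (g c.1.2 + g c.1.2) +
        (g y0 + g y0) + (g (d0 v) + g (d0 v))) := by abel
    rw [e2] at m5
    simpa only [two, add_zero] using m5
  have hcard : C.card ≤ W.card := by
    have := finrank_span_finset_le_card (R := ZMod 2) W
    rw [Set.finrank, htop, finrank_top, Module.finrank_fintype_fun_eq_card] at this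
    simpa using this
  have hWc : W.card ≤ B.card + S.card :=
    (Finset.card_union_le _ _).trans (Nat.add_le_add_left Finset.card_image_le _)
  have hJ : ∑ v ∈ S, J Y (D v) ≤ ∑ v, J Y (D v) :=
    Finset.sum_le_sum_of_subset_of_nonneg (Finset.subset_univ _) fun v _ _ => J_nonneg (hdis v)
  rw [hRX] at hB
  omega

end TriLattice

namespace TriLattice

/-- A rectangular box of cells. -/
noncomputable def box (a b c d : ℤ) : Finset (ℤ × ℤ) := Finset.Icc a b ×ˢ Finset.Icc c d

theorem mem_box {a b c d : ℤ} {u : ℤ × ℤ} :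
    u ∈ box a b c d ↔ (a ≤ u.1 ∧ u.1 ≤ b) ∧ (c ≤ u.2 ∧ u.2 ≤ d) := by
  simp [box]

theorem box_aux {a b c d : ℤ} {R : Finset (ℤ × ℤ)} (hR : R.Nonempty) (hsub : R ⊆ box a b c d)
    (hdown : ∀ u ∈ R, ∀ v ∈ box a b c d, (v.1 < u.1 ∨ v.1 = u.1 ∧ v.2 ≤ u.2) → v ∈ R) :
    Conn R ∧ X R = 6 := by
  induction hn : R.card using Nat.strong_induction_on generalizing R with
  | _ n ih =>
  obtain ⟨z, hz, hmax⟩ := exists_lex_max hR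
  set S := R.erase z with hS
  have hzS : z ∉ S := Finset.notMem_erase z R
  have hRS : R = insert z S := (Finset.insert_erase hz).symm
  have hcard : S.card < n := by
    rw [hS, Finset.card_erase_of_mem hz, hn]
    have := Finset.card_pos.2 hR
    omega
  by_cases hne : S.Nonempty
  · have hzb := mem_box.1 (hsub hz)
    have hsubS : S ⊆ box a b c d := (Finset.erase_subset _ _).trans hsub
    obtain ⟨h1, h2⟩ := ih _ hcard hne hsubS (by
      intro u hu v hv h
      have huR := Finset.mem_of_mem_erase hu
      refine Finset.mem_erase.2 ⟨?_, hdown u huR v hv h⟩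
      rintro rfl
      have := hmax u hu
      have hne : u ≠ v := fun h => hzS (h ▸ hu)
      rw [Ne, Prod.ext_iff] at hne
      omega) rfl
    have mem : ∀ v : ℤ × ℤ, (v.1 < z.1 ∨ v.1 = z.1 ∧ v.2 < z.2) → (v ∈ S ↔ v ∈ box a b c d) := by
      intro v hv
      refine ⟨fun h => hsubS h, fun h => Finset.mem_erase.2 ⟨?_, hdown z hz v h (by omega)⟩⟩
      rintro rfl; omega
    have m1 := mem (z.1 - 1, z.2 + 1) (by dsimp only; omega)
    have m2 := mem (z.1 - 1, z.2) (by dsimp only; omega)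
    have m3 := mem (z.1, z.2 - 1) (by dsimp only; omega)
    rw [mem_box] at m1 m2 m3
    dsimp only at m1 m2 m3
    have hX := X_insert_lower hzS hmax
    by_cases hza : a < z.1
    · have hl2 : (z.1 - 1, z.2) ∈ S := m2.2 (by omega)
      refine ⟨hRS ▸ h1.insert_cell hl2 (by unfold Adj; dsimp only; omega), ?_⟩
      rw [hRS, hX, h2]
      simp only [hl2, and_true]
      split_ifs <;> omega
    · have hl1 : (z.1 - 1, z.2 + 1) ∉ S := fun h => by have := m1.1 h; omega
      have hl2 : (z.1 - 1, z.2) ∉ S := fun h => by have := m2.1 h; omega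
      have hl3 : (z.1, z.2 - 1) ∈ S := by
        obtain ⟨u, hu⟩ := hne
        have hu1 := hmax u hu
        have hu2 := mem_box.1 (hsubS hu)
        have hne : u ≠ z := fun h => hzS (h ▸ hu)
        rw [Ne, Prod.ext_iff] at hne
        exact m3.2 (by omega)
      refine ⟨hRS ▸ h1.insert_cell hl3 (by unfold Adj; dsimp only; omega), ?_⟩
      rw [hRS, hX, h2]
      simp only [hl1, hl2, hl3, if_true, if_false, and_false]
      omega
  · rw [Finset.not_nonempty_iff_eq_empty] at hne
    rw [hRS, hne]
    exact ⟨conn_singleton z, X_singleton z⟩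

theorem box_conn {a b c d : ℤ} (h1 : a ≤ b) (h2 : c ≤ d) : Conn (box a b c d) :=
  (box_aux ⟨(a, c), by rw [mem_box]; dsimp only; omega⟩ (Finset.Subset.refl _)
    (fun _ _ _ hv _ => hv)).1

theorem box_X {a b c d : ℤ} (h1 : a ≤ b) (h2 : c ≤ d) : X (box a b c d) = 6 :=
  (box_aux ⟨(a, c), by rw [mem_box]; dsimp only; omega⟩ (Finset.Subset.refl _)
    (fun _ _ _ hv _ => hv)).2

/-- The boundary of a box is connected. -/
theorem rim_conn {L : ℤ} (hL : 0 ≤ L) :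
    Conn (box (-L) (-L) (-L) L ∪ box (-L) L (-L) (-L) ∪ box L L (-L) L ∪ box (-L) L L L) := by
  have h : -L ≤ L := by omega
  refine ((Conn.union (box_conn le_rfl h) (box_conn h le_rfl)
    ⟨(-L, -L), ?_, (-L, -L), ?_, Or.inl rfl⟩).union (box_conn le_rfl h)
    ⟨(L, -L), ?_, (L, -L), ?_, Or.inl rfl⟩).union (box_conn h le_rfl)
    ⟨(L, L), ?_, (L, L), ?_, Or.inl rfl⟩ <;> simp only [Finset.mem_union, mem_box] <;> omega

variable {ι ε : Type*} [Fintype ι] [Fintype ε] [DecidableEq ι] [DecidableEq ε]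

/-- A system of disjoint regions `D v` (vertices) and `N e` (edges) inside `Λ`, all of whose
neighbours lie in `Λ`. -/
structure Coloring (Λ Λ₀ : Finset (ℤ × ℤ)) (D : ι → Finset (ℤ × ℤ)) (N : ε → Finset (ℤ × ℤ)) :
    Prop where
  sub : Λ₀ ⊆ Λ
  int : ∀ u ∈ Λ₀, ∀ w, Adj u w → w ∈ Λ
  dconn : ∀ v, Conn (D v)
  dX : ∀ v, X (D v) = 6
  dsep : Sep D
  dsub : ∀ v, D v ⊆ Λ₀
  nconn : ∀ e, Conn (N e)
  nsub : ∀ e, N e ⊆ Λ₀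
  ndis : ∀ e e', e ≠ e' → Disjoint (N e) (N e')
  nd : ∀ e v, Disjoint (N e) (D v)
  ktri : ∀ d e, d ≠ e → ∀ u ∈ N d, ∀ v ∈ N e, ∀ w, Adj u v → Adj u w → Adj v w →
    w ∈ N d ∨ w ∈ N e

/-- The cells of `Λ` in none of the regions. -/
def uncol (Λ : Finset (ℤ × ℤ)) (D : ι → Finset (ℤ × ℤ)) (N : ε → Finset (ℤ × ℤ)) :
    Finset (ℤ × ℤ) :=
  Λ \ (Finset.univ.biUnion D ∪ Finset.univ.biUnion N)

theorem mem_uncol {Λ : Finset (ℤ × ℤ)} {D : ι → Finset (ℤ × ℤ)} {N : ε → Finset (ℤ × ℤ)}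
    {u : ℤ × ℤ} : u ∈ uncol Λ D N ↔ u ∈ Λ ∧ (∀ v, u ∉ D v) ∧ ∀ e, u ∉ N e := by
  simp [uncol]

/-- A component of the uncoloured cells. -/
structure IsFace (Λ : Finset (ℤ × ℤ)) (D : ι → Finset (ℤ × ℤ)) (N : ε → Finset (ℤ × ℤ))
    (f : Finset (ℤ × ℤ)) : Prop where
  sub : f ⊆ uncol Λ D N
  conn : Conn f
  closed : ∀ u ∈ f, ∀ w ∈ uncol Λ D N, Adj u w → w ∈ f

namespace Coloring

variable {Λ Λ₀ : Finset (ℤ × ℤ)} {D : ι → Finset (ℤ × ℤ)} {N : ε → Finset (ℤ × ℤ)}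
  (c : Coloring Λ Λ₀ D N)
include c

theorem cases_mem {w : ℤ × ℤ} (hw : w ∈ Λ) :
    (∃ v, w ∈ D v) ∨ (∃ e, w ∈ N e) ∨ w ∈ uncol Λ D N := by
  rw [mem_uncol]
  by_cases h1 : ∃ v, w ∈ D v
  · exact Or.inl h1
  by_cases h2 : ∃ e, w ∈ N e
  · exact Or.inr (Or.inl h2)
  push Not at h1 h2
  exact Or.inr (Or.inr ⟨hw, h1, h2⟩)

theorem same_D {v v' : ι} {x y : ℤ × ℤ} (hx : x ∈ D v) (hy : y ∈ D v') (h : Adj x y) :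
    v = v' := by
  by_contra hne
  exact (c.dsep v v' hne).2 x hx y hy h

theorem J_face_N {f : Finset (ℤ × ℤ)} (hf : IsFace Λ D N f) (e : ε) :
    J f (N e) = T f (Finset.univ.biUnion D) (N e) := by
  rw [T_swap_right]
  refine J_eq_T ?_ ?_ ?_
  · exact Finset.disjoint_left.2 fun u hu he => (mem_uncol.1 (hf.sub hu)).2.2 e he
  · rw [Finset.disjoint_left]
    intro u hu hK
    obtain ⟨v, -, hv⟩ := Finset.mem_biUnion.1 hK
    rcases Finset.mem_union.1 hu with hu | hu
    · exact (mem_uncol.1 (hf.sub hu)).2.1 v hv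
    · exact Finset.disjoint_left.1 (c.nd e v) hu hv
  · intro u hu v hv huv w huw hvw hwf hwe
    rcases c.cases_mem (c.int v (c.nsub e hv) w hvw) with ⟨x, hx⟩ | ⟨e', he'⟩ | hU
    · exact Finset.mem_biUnion.2 ⟨x, Finset.mem_univ _, hx⟩
    · have hne : e ≠ e' := by rintro rfl; exact hwe he'
      rcases c.ktri e e' hne v hv w he' u hvw huv.symm huw.symm with h | h
      · exact absurd h ((mem_uncol.1 (hf.sub hu)).2.2 e)
      · exact absurd h ((mem_uncol.1 (hf.sub hu)).2.2 e')
    · exact absurd (hf.closed u hu w hU huw) hwf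

theorem J_face_D {f : Finset (ℤ × ℤ)} (hf : IsFace Λ D N f) (v : ι) :
    J f (D v) = T f (D v) (Finset.univ.biUnion N) := by
  refine J_eq_T ?_ ?_ ?_
  · exact Finset.disjoint_left.2 fun u hu he => (mem_uncol.1 (hf.sub hu)).2.1 v he
  · rw [Finset.disjoint_left]
    intro u hu hK
    obtain ⟨e, -, he⟩ := Finset.mem_biUnion.1 hK
    rcases Finset.mem_union.1 hu with hu | hu
    · exact (mem_uncol.1 (hf.sub hu)).2.2 e he
    · exact Finset.disjoint_left.1 (c.nd e v) he hu
  · intro u hu x hx hux w huw hxw hwf hwx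
    rcases c.cases_mem (c.int x (c.dsub v hx) w hxw) with ⟨v', hx'⟩ | ⟨e', he'⟩ | hU
    · obtain rfl := c.same_D hx hx' hxw
      exact absurd hx' hwx
    · exact Finset.mem_biUnion.2 ⟨e', Finset.mem_univ _, he'⟩
    · exact absurd (hf.closed u hu w hU huw) hwf

theorem J_N_D (e : ε) (v : ι) : J (N e) (D v) = T (N e) (D v) (uncol Λ D N) := by
  refine J_eq_T (c.nd e v) ?_ ?_
  · rw [Finset.disjoint_left]
    intro u hu hU
    rcases Finset.mem_union.1 hu with hu | hu
    · exact (mem_uncol.1 hU).2.2 e hu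
    · exact (mem_uncol.1 hU).2.1 v hu
  · intro u hu x hx hux w huw hxw hwe hwx
    rcases c.cases_mem (c.int x (c.dsub v hx) w hxw) with ⟨v', hx'⟩ | ⟨e', he'⟩ | hU
    · obtain rfl := c.same_D hx hx' hxw
      exact absurd hx' hwx
    · have hne : e ≠ e' := by rintro rfl; exact hwe he'
      rcases c.ktri e e' hne u hu w he' x huw hux hxw.symm with h | h
      · exact absurd hx (Finset.disjoint_left.1 (c.nd e v) h)
      · exact absurd hx (Finset.disjoint_left.1 (c.nd e' v) h)
    · exact hU

theorem J_N_biUnion {e : ε} {S : Finset ε} (he : e ∉ S) : J (N e) (S.biUnion N) = 0 := by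
  have hT : T (N e) (S.biUnion N) ∅ = 0 := by simp [T]
  rw [← hT]
  refine J_eq_T ?_ (Finset.disjoint_empty_right _) ?_
  · rw [Finset.disjoint_biUnion_right]
    exact fun e' he' => c.ndis e e' (by rintro rfl; exact he he')
  · intro u hu v hv huv w huw hvw hwe hwS
    obtain ⟨e', he', hv⟩ := Finset.mem_biUnion.1 hv
    have hne : e ≠ e' := by rintro rfl; exact he he'
    rcases c.ktri e e' hne u hu v hv w huv huw hvw with h | h
    · exact absurd h hwe
    · exact absurd (Finset.mem_biUnion.2 ⟨e', he', h⟩) hwS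

theorem X_biUnion_N (S : Finset ε) : X (S.biUnion N) = ∑ e ∈ S, X (N e) := by
  induction S using Finset.induction_on with
  | empty => simp [X_empty]
  | insert e S he ih =>
    rw [Finset.biUnion_insert, X_union, c.J_N_biUnion he, Finset.sum_insert he, ih]
    · ring
    · rw [Finset.disjoint_biUnion_right]
      exact fun e' he' => c.ndis e e' (by rintro rfl; exact he he')

theorem T_D_split (A B : Finset (ℤ × ℤ)) :
    T A (Finset.univ.biUnion D) B = ∑ v, T A (D v) B := by
  rw [T_swap_left, T_biUnion_left _ (c.dsep.pairwiseDisjoint _)]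
  exact Finset.sum_congr rfl fun v _ => T_swap_left _ _ _

theorem T_N_split (A B : Finset (ℤ × ℤ)) :
    T A B (Finset.univ.biUnion N) = ∑ e, T A B (N e) := by
  rw [T_swap_right, T_swap_left, T_biUnion_left]
  · refine Finset.sum_congr rfl fun v _ => ?_
    rw [T_swap_left, T_swap_right]
  · exact fun d _ e _ h => c.ndis d e h

/-- Total number of junctions of an edge region. -/
theorem sum_J_N_D (e : ε) :
    ∑ v, J (N e) (D v) = T (N e) (Finset.univ.biUnion D) (uncol Λ D N) := by
  rw [c.T_D_split]
  exact Finset.sum_congr rfl fun v _ => c.J_N_D e v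

theorem sum_J_face_D {f : Finset (ℤ × ℤ)} (hf : IsFace Λ D N f) :
    ∑ v, J f (D v) = ∑ e, T f (Finset.univ.biUnion D) (N e) := by
  rw [← c.T_N_split, c.T_D_split]
  exact Finset.sum_congr rfl fun v _ => c.J_face_D hf v

/-- Merging a face with an adjacent edge region. -/
theorem merge {f : Finset (ℤ × ℤ)} (hf : IsFace Λ D N f) (hfI : f ⊆ Λ₀) {e : ε}
    (htouch : ∃ u ∈ N e, ∃ w ∈ f, Adj u w)
    (hT : ∀ e' ≠ e, T f (Finset.univ.biUnion D) (N e') = 0) :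
    Coloring Λ Λ₀ D (Function.update N e (N e ∪ f)) ∧
    (∀ k, (∀ e', T (N e') (Finset.univ.biUnion D) (uncol Λ D N) ≤ k) →
      ∀ e', T (Function.update N e (N e ∪ f) e') (Finset.univ.biUnion D)
        (uncol Λ D (Function.update N e (N e ∪ f))) ≤ k) := by
  have fN : ∀ u ∈ f, ∀ e', u ∉ N e' := fun u hu => (mem_uncol.1 (hf.sub hu)).2.2
  have fD : ∀ u ∈ f, ∀ v, u ∉ D v := fun u hu => (mem_uncol.1 (hf.sub hu)).2.1
  have hT' : ∀ e' ≠ e, ∀ u ∈ f, ∀ v ∈ N e', ∀ w, Adj u v → Adj u w → Adj v w →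
      w ∈ f ∨ w ∈ N e' := by
    intro e' he' u hu v hv w huv huw hvw
    by_cases hwf : w ∈ f
    · exact Or.inl hwf
    rcases c.cases_mem (c.int v (c.nsub e' hv) w hvw) with ⟨x, hx⟩ | ⟨e'', he''⟩ | hU
    · exfalso
      have h0 := hT e' he'
      unfold T at h0
      have hnn : ∀ a b d, 0 ≤ ind a b * ind b d * ind a d := fun a b d =>
        mul_nonneg (mul_nonneg (ind_nonneg _ _) (ind_nonneg _ _)) (ind_nonneg _ _)
      rw [Finset.sum_eq_zero_iff_of_nonneg (fun _ _ => Finset.sum_nonneg fun _ _ =>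
        Finset.sum_nonneg fun _ _ => hnn _ _ _)] at h0
      have h1 := h0 u hu
      rw [Finset.sum_eq_zero_iff_of_nonneg (fun _ _ =>
        Finset.sum_nonneg fun _ _ => hnn _ _ _)] at h1
      have h2 := h1 w (Finset.mem_biUnion.2 ⟨x, Finset.mem_univ _, hx⟩)
      rw [Finset.sum_eq_zero_iff_of_nonneg (fun _ _ => hnn _ _ _)] at h2
      have h3 := h2 v hv
      rw [ind_of_adj huv, ind_of_adj huw, ind_of_adj hvw.symm] at h3
      norm_num at h3
    · by_cases hee : e'' = e'
      · subst hee; exact Or.inr he''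
      · rcases c.ktri e' e'' (Ne.symm hee) v hv w he'' u hvw huv.symm huw.symm with h | h
        exacts [absurd h (fN u hu _), absurd h (fN u hu _)]
    · exact Or.inl (hf.closed u hu w hU huw)
  constructor
  · refine ⟨c.sub, c.int, c.dconn, c.dX, c.dsep, c.dsub, ?_, ?_, ?_, ?_, ?_⟩
    · intro e'
      by_cases h : e' = e
      · subst h
        rw [Function.update_self]
        obtain ⟨u, hu, w, hw, huw⟩ := htouch
        exact (c.nconn e').union hf.conn ⟨u, hu, w, hw, Or.inr huw⟩
      · rw [Function.update_of_ne h]; exact c.nconn e'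
    · intro e'
      by_cases h : e' = e
      · subst h
        rw [Function.update_self]
        exact Finset.union_subset (c.nsub _) hfI
      · rw [Function.update_of_ne h]; exact c.nsub e'
    · have key : ∀ e', e' ≠ e → Disjoint (N e ∪ f) (N e') := fun e' h =>
        Finset.disjoint_union_left.2 ⟨c.ndis _ _ (Ne.symm h),
          Finset.disjoint_left.2 fun u hu => fN u hu e'⟩
      intro e1 e2 h12
      by_cases h1 : e1 = e
      · subst h1
        rw [Function.update_self, Function.update_of_ne (Ne.symm h12)]
        exact key e2 (Ne.symm h12)
      · by_cases h2 : e2 = e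
        · subst h2
          rw [Function.update_self, Function.update_of_ne h12]
          exact (key e1 h12).symm
        · rw [Function.update_of_ne h1, Function.update_of_ne h2]
          exact c.ndis _ _ h12
    · intro e' v
      by_cases h : e' = e
      · subst h
        rw [Function.update_self]
        exact Finset.disjoint_union_left.2 ⟨c.nd _ _,
          Finset.disjoint_left.2 fun u hu => fD u hu v⟩
      · rw [Function.update_of_ne h]; exact c.nd e' v
    · have key : ∀ e', e' ≠ e → ∀ u ∈ N e ∪ f, ∀ v ∈ N e', ∀ w, Adj u v → Adj u w → Adj v w →
          w ∈ N e ∪ f ∨ w ∈ N e' := by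
        intro e' he' u hu v hv w huv huw hvw
        rcases Finset.mem_union.1 hu with hu | hu
        · rcases c.ktri e e' (Ne.symm he') u hu v hv w huv huw hvw with h | h
          exacts [Or.inl (Finset.mem_union_left _ h), Or.inr h]
        · rcases hT' e' he' u hu v hv w huv huw hvw with h | h
          exacts [Or.inl (Finset.mem_union_right _ h), Or.inr h]
      intro e1 e2 h12
      by_cases h1 : e1 = e
      · subst h1
        rw [Function.update_self, Function.update_of_ne (Ne.symm h12)]
        exact key e2 (Ne.symm h12)
      · by_cases h2 : e2 = e
        · subst h2
          rw [Function.update_self, Function.update_of_ne h12]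
          exact fun u hu v hv w huv huw hvw => (key e1 h12 v hv u hu w huv.symm hvw huw).symm
        · rw [Function.update_of_ne h1, Function.update_of_ne h2]
          exact c.ktri _ _ h12
  · intro k hk e'
    have hU : uncol Λ D N = uncol Λ D (Function.update N e (N e ∪ f)) ∪ f := by
      ext u
      rw [Finset.mem_union]
      constructor
      · intro hu
        by_cases huf : u ∈ f
        · exact Or.inr huf
        refine Or.inl ?_
        rw [mem_uncol] at hu ⊢
        refine ⟨hu.1, hu.2.1, fun e' => ?_⟩
        by_cases h : e' = e
        · subst h
          rw [Function.update_self, Finset.mem_union, not_or]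
          exact ⟨hu.2.2 _, huf⟩
        · rw [Function.update_of_ne h]; exact hu.2.2 e'
      · rintro (hu | hu)
        · rw [mem_uncol] at hu ⊢
          refine ⟨hu.1, hu.2.1, fun e' h' => hu.2.2 e' ?_⟩
          by_cases h : e' = e
          · subst h
            rw [Function.update_self]; exact Finset.mem_union_left _ h'
          · rw [Function.update_of_ne h]; exact h'
        · exact hf.sub hu
    set U' := uncol Λ D (Function.update N e (N e ∪ f)) with hU'
    have hd : Disjoint U' f := by
      rw [Finset.disjoint_left]
      intro u hu huf
      refine (mem_uncol.1 hu).2.2 e ?_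
      rw [Function.update_self]; exact Finset.mem_union_right _ huf
    have hmono : ∀ e', T (N e') (Finset.univ.biUnion D) U' ≤ k := fun e' => by
      have := hk e'
      rw [hU, T_union_right hd] at this
      have := T_nonneg (N e') (Finset.univ.biUnion D) f
      omega
    by_cases h : e' = e
    · subst h
      rw [Function.update_self, T_union_left (Finset.disjoint_right.2 fun u hu => fN u hu e')]
      have hap : Apart f U' := fun u hu w hw h =>
        Finset.disjoint_left.1 hd hw (hf.closed u hu w (hU ▸ Finset.mem_union_left _ hw) h)
      rw [T_swap_right f, hap.T_eq, add_zero]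
      exact hmono e'
    · rw [Function.update_of_ne h]; exact hmono e'

end Coloring

end TriLattice

namespace TriLattice

set_option linter.unusedSectionVars false

variable {ι ε : Type*} [Fintype ι] [Fintype ε] [DecidableEq ι] [DecidableEq ε]

theorem touch_of_T_ne {A B C : Finset (ℤ × ℤ)} (h : T A B C ≠ 0) : ∃ u ∈ C, ∃ w ∈ A, Adj u w := by
  by_contra! hc
  exact h (by rw [T_swap_right, Apart.T_eq fun u hu v hv huv => hc v hv u hu huv.symm])

namespace Coloring

variable {Λ Λ₀ : Finset (ℤ × ℤ)} {D : ι → Finset (ℤ × ℤ)} {N : ε → Finset (ℤ × ℤ)}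
  (c : Coloring Λ Λ₀ D N)
include c

/-- The components of the uncoloured cells. -/
theorem exists_faces : ∃ F : Finset (Finset (ℤ × ℤ)), (∀ f ∈ F, IsFace Λ D N f) ∧
    F.biUnion id = uncol Λ D N ∧ (∀ f ∈ F, ∀ f' ∈ F, f ≠ f' → Disjoint f f' ∧ Apart f f') := by
  have hF : ∀ u ∈ uncol Λ D N, IsFace Λ D N (comp (uncol Λ D N) u) := fun u hu =>
    ⟨comp_subset _ _, comp_conn hu, fun v hv w hw h => comp_closed hv hw h⟩
  refine ⟨(uncol Λ D N).image (comp (uncol Λ D N)), ?_, ?_, ?_⟩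
  · intro f hf
    obtain ⟨u, hu, rfl⟩ := Finset.mem_image.1 hf
    exact hF u hu
  · ext u
    simp only [Finset.mem_biUnion, Finset.mem_image, id]
    constructor
    · rintro ⟨_, ⟨v, hv, rfl⟩, hu⟩
      exact comp_subset _ _ hu
    · exact fun hu => ⟨_, ⟨u, hu, rfl⟩, self_mem_comp hu⟩
  · intro f hf f' hf' hne
    obtain ⟨u, hu, rfl⟩ := Finset.mem_image.1 hf
    obtain ⟨u', hu', rfl⟩ := Finset.mem_image.1 hf'
    constructor
    · rw [Finset.disjoint_left]
      intro x hx hx'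
      exact hne ((comp_eq_of_mem hx).symm.trans (comp_eq_of_mem hx'))
    · intro x hx y hy hxy
      have hy' := comp_closed hx (comp_subset _ _ hy) hxy
      exact hne ((comp_eq_of_mem hy').symm.trans (comp_eq_of_mem hy))

theorem X_total (hΛ : X Λ = 6) : (6 : ℤ) = 6 * Fintype.card ι + ∑ e, X (N e) +
    X (uncol Λ D N) - 3 * ∑ e, ∑ v, J (N e) (D v) := by
  set K := Finset.univ.biUnion D
  set M := Finset.univ.biUnion N
  have hKI : K ⊆ Λ₀ := Finset.biUnion_subset.2 fun v _ => c.dsub v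
  have hMI : M ⊆ Λ₀ := Finset.biUnion_subset.2 fun v _ => c.nsub v
  have hKM : Disjoint K M := by
    rw [Finset.disjoint_biUnion_left]
    intro v _
    rw [Finset.disjoint_biUnion_right]
    exact fun e _ => (c.nd e v).symm
  have hU : Disjoint (K ∪ M) (uncol Λ D N) := Finset.disjoint_sdiff
  have hΛ' : (K ∪ M) ∪ uncol Λ D N = Λ :=
    Finset.union_sdiff_of_subset (Finset.union_subset (hKI.trans c.sub) (hMI.trans c.sub))
  have hJ0 : J (K ∪ M) (uncol Λ D N) = 0 := by
    have hT : T (K ∪ M) (uncol Λ D N) ∅ = 0 := by simp [T]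
    rw [← hT]
    refine J_eq_T hU (Finset.disjoint_empty_right _) ?_
    intro u hu v _ _ w huw _ hwK hwU
    have hw : w ∈ Λ := c.int u (Finset.union_subset hKI hMI hu) w huw
    rw [← hΛ'] at hw
    rcases Finset.mem_union.1 hw with h | h
    exacts [absurd h hwK, absurd h hwU]
  have hJ1 : J K M = ∑ e, ∑ v, J (N e) (D v) := by
    rw [J_eq_T hKM hU (C := uncol Λ D N), T_swap_right, T_swap_right, T_swap_left, T_biUnion_left]
    · exact Finset.sum_congr rfl fun e _ => (c.sum_J_N_D e).symm
    · exact fun e _ e' _ h => c.ndis e e' h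
    · intro u hu v _ _ w huw _ hwK hwM
      have hw : w ∈ Λ := c.int u (hKI hu) w huw
      rw [← hΛ'] at hw
      rcases Finset.mem_union.1 hw with h | h
      · rcases Finset.mem_union.1 h with h | h
        exacts [absurd h hwK, absurd h hwM]
      · exact h
  have h1 : X K = 6 * Fintype.card ι := by
    rw [X_biUnion c.dsep, Finset.sum_congr rfl fun v _ => c.dX v]
    simp [mul_comm]
  have h2 : X M = ∑ e, X (N e) := c.X_biUnion_N _
  have h3 := X_union hU
  rw [hΛ', X_union hKM, hΛ, hJ0, hJ1, h1, h2] at h3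
  linarith

theorem X_faces {F : Finset (Finset (ℤ × ℤ))} (hU : F.biUnion id = uncol Λ D N)
    (hs : ∀ f ∈ F, ∀ f' ∈ F, f ≠ f' → Disjoint f f' ∧ Apart f f') :
    X (uncol Λ D N) = ∑ f ∈ F, X f := by
  have hsep : Sep (fun f : F => (f : Finset (ℤ × ℤ))) := fun f f' h =>
    hs f f.2 f' f'.2 fun h' => h (Subtype.ext h')
  have := X_biUnion hsep Finset.univ
  rw [← Finset.sum_coe_sort F, ← this]
  congr 1
  rw [← hU]
  ext u
  simp

theorem sum_T_faces {F : Finset (Finset (ℤ × ℤ))} (hU : F.biUnion id = uncol Λ D N)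
    (hs : ∀ f ∈ F, ∀ f' ∈ F, f ≠ f' → Disjoint f f' ∧ Apart f f') (e : ε) :
    ∑ f ∈ F, T f (Finset.univ.biUnion D) (N e) = ∑ v, J (N e) (D v) := by
  rw [c.sum_J_N_D, T_swap_left, T_swap_right, T_swap_left, ← hU, T_biUnion_left]
  · rfl
  · exact fun f hf f' hf' h => (hs f hf f' hf' h).1

end Coloring

/-- Two distinct indices whose weighted even values sum to at least six, or the exceptional
pattern. -/
theorem weight_cases {t ω : ε → ℤ} (ht : ∀ e, 0 ≤ t e) (ht2 : ∀ e, (2 : ℤ) ∣ t e)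
    (hω : ∀ e, ω e = 1 ∨ ω e = 2) {e₁ e₂ : ε} (hne : e₁ ≠ e₂) (h1 : t e₁ ≠ 0) (h2 : t e₂ ≠ 0) :
    6 ≤ ∑ e, t e * ω e ∨ (ω e₁ = 1 ∧ ω e₂ = 1 ∧ t e₁ = 2 ∧ t e₂ = 2 ∧ ∑ e, t e = 4) := by
  have hle : ∀ e, t e ≤ t e * ω e := fun e => by
    rcases hω e with h | h <;> rw [h] <;> linarith [ht e]
  have hs : ∀ g : ε → ℤ, ∑ e, g e = g e₁ + (g e₂ + ∑ e ∈ (Finset.univ.erase e₁).erase e₂, g e) := by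
    intro g
    rw [← Finset.add_sum_erase _ _ (Finset.mem_univ e₁), ← Finset.add_sum_erase _ g
      (Finset.mem_erase.2 ⟨hne.symm, Finset.mem_univ e₂⟩)]
  have hr := Finset.sum_le_sum fun e (_ : e ∈ (Finset.univ.erase e₁).erase e₂) => hle e
  have hr0 : 0 ≤ ∑ e ∈ (Finset.univ.erase e₁).erase e₂, t e := Finset.sum_nonneg fun e _ => ht e
  have hr2 : (2 : ℤ) ∣ ∑ e ∈ (Finset.univ.erase e₁).erase e₂, t e :=
    Finset.dvd_sum fun e _ => ht2 e
  have := ht e₁; have := ht e₂; have := ht2 e₁; have := ht2 e₂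
  rw [hs, hs t]
  rcases hω e₁ with h | h <;> rcases hω e₂ with h' | h' <;> rw [h, h'] <;> omega

end TriLattice

namespace TriLattice

set_option linter.unusedSectionVars false

variable {ι ε : Type*} [Fintype ι] [Fintype ε] [DecidableEq ι] [DecidableEq ε]

namespace Coloring

variable {Λ Λ₀ : Finset (ℤ × ℤ)} {D : ι → Finset (ℤ × ℤ)} {N : ε → Finset (ℤ × ℤ)}
  (c : Coloring Λ Λ₀ D N)
include c

theorem exists_two_of_X_eq {f : Finset (ℤ × ℤ)} (hf : IsFace Λ D N f) (hX : X f = 6)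
    (hΛ : Conn Λ) (hne : ¬ Λ ⊆ f)
    (hmax : ∀ e, (∃ u ∈ N e, ∃ w ∈ f, Adj u w) →
      ∃ e' ≠ e, T f (Finset.univ.biUnion D) (N e') ≠ 0) :
    ∃ e₁ e₂, e₁ ≠ e₂ ∧ T f (Finset.univ.biUnion D) (N e₁) ≠ 0 ∧
      T f (Finset.univ.biUnion D) (N e₂) ≠ 0 := by
  by_cases h : ∃ e, ∃ u ∈ N e, ∃ w ∈ f, Adj u w
  · obtain ⟨e, he⟩ := h
    obtain ⟨e₁, -, h1⟩ := hmax e he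
    obtain ⟨e₂, h21, h2⟩ := hmax e₁ (touch_of_T_ne h1)
    exact ⟨e₁, e₂, h21.symm, h1, h2⟩
  exfalso
  have hT : ∀ e, T f (Finset.univ.biUnion D) (N e) = 0 := fun e => by
    by_contra h0
    exact h ⟨e, touch_of_T_ne h0⟩
  have hfD : ∀ v, Disjoint f (D v) := fun v =>
    Finset.disjoint_left.2 fun u hu hv => (mem_uncol.1 (hf.sub hu)).2.1 v hv
  have hJ : ∀ v, J f (D v) = 0 := by
    have := c.sum_J_face_D hf
    rw [Finset.sum_congr rfl fun e _ => hT e, Finset.sum_const_zero,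
      Finset.sum_eq_zero_iff_of_nonneg fun v _ => J_nonneg (hfD v)] at this
    exact fun v => this v (Finset.mem_univ v)
  have hD : ∀ v, Apart f (D v) := by
    intro v u hu w hw huw
    have := (hf.conn.union (c.dconn v) ⟨u, hu, w, hw, Or.inr huw⟩).X_le
    rw [X_union (hfD v), hX, c.dX, hJ] at this
    omega
  apply hne
  intro w hw
  have hfΛ : f ⊆ Λ := fun u hu => (mem_uncol.1 (hf.sub hu)).1
  obtain ⟨u, hu⟩ := hf.conn.1
  refine hΛ.2 (· ∈ f) ⟨u, hfΛ hu, hu⟩ ?_ w hw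
  intro x _ y hy hxy hxf
  rcases c.cases_mem hy with ⟨v, hv⟩ | ⟨e, he⟩ | hU
  · exact absurd hxy (hD v x hxf y hv)
  · exact absurd ⟨e, y, he, x, hxf, hxy.symm⟩ h
  · exact hf.closed x hxf y hU hxy

theorem X_face_le {f : Finset (ℤ × ℤ)} (hf : IsFace Λ D N f)
    (hΛ : Conn Λ) (hne : ¬ Λ ⊆ f)
    (hmax : ∀ e, (∃ u ∈ N e, ∃ w ∈ f, Adj u w) →
      ∃ e' ≠ e, T f (Finset.univ.biUnion D) (N e') ≠ 0)
    (hT4 : ∀ e, T (N e) (Finset.univ.biUnion D) (uncol Λ D N) ≤ 4)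
    (hW2 : ∀ e e', e ≠ e' → ∀ Y, N e ⊆ Y → N e' ⊆ Y → Conn Y → (∀ v, Disjoint Y (D v)) →
      X Y = 6 → ∑ v, J Y (D v) ≤ 4 → False) :
    X f ≤ ∑ e, T f (Finset.univ.biUnion D) (N e) * (if X (N e) = 6 then 1 else 2) := by
  have ht0 : ∀ e, 0 ≤ T f (Finset.univ.biUnion D) (N e) := fun e => T_nonneg _ _ _
  have hfN : ∀ e, Disjoint f (N e) := fun e =>
    Finset.disjoint_left.2 fun u hu hv => (mem_uncol.1 (hf.sub hu)).2.2 e hv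
  have hfD : ∀ v, Disjoint f (D v) := fun v =>
    Finset.disjoint_left.2 fun u hu hv => (mem_uncol.1 (hf.sub hu)).2.1 v hv
  have ht2 : ∀ e, (2 : ℤ) ∣ T f (Finset.univ.biUnion D) (N e) := fun e => by
    rw [← c.J_face_N hf]; exact two_dvd_J (hfN e)
  have hω : ∀ e, (if X (N e) = 6 then 1 else 2 : ℤ) = 1 ∨ (if X (N e) = 6 then 1 else 2 : ℤ) = 2 :=
    fun e => by split_ifs <;> simp
  have hle := hf.conn.X_le
  by_cases hX : X f = 6
  · obtain ⟨e₁, e₂, hne', h1, h2⟩ := c.exists_two_of_X_eq hf hX hΛ hne hmax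
    rcases weight_cases ht0 ht2 hω hne' h1 h2 with h | ⟨w1, w2, t1, t2, hsum⟩
    · rwa [hX]
    exfalso
    have X1 : X (N e₁) = 6 := by
      by_contra h; rw [if_neg h] at w1; norm_num at w1
    have X2 : X (N e₂) = 6 := by
      by_contra h; rw [if_neg h] at w2; norm_num at w2
    have d12 := c.ndis _ _ hne'
    have hd : Disjoint f (N e₁ ∪ N e₂) := Finset.disjoint_union_right.2 ⟨hfN _, hfN _⟩
    have J12 : J (N e₁) (N e₂) = 0 := by
      have := c.J_N_biUnion (e := e₁) (S := {e₂}) (by simpa using hne')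
      simpa using this
    obtain ⟨u1, hu1, x1, hx1, a1⟩ := touch_of_T_ne h1
    obtain ⟨u2, hu2, x2, hx2, a2⟩ := touch_of_T_ne h2
    have hconn : Conn (f ∪ (N e₁ ∪ N e₂)) := by
      rw [← Finset.union_assoc]
      exact (hf.conn.union (c.nconn e₁) ⟨x1, hx1, u1, hu1, Or.inr a1.symm⟩).union (c.nconn e₂)
        ⟨x2, Finset.mem_union_left _ hx2, u2, hu2, Or.inr a2.symm⟩
    have hXY : X (f ∪ (N e₁ ∪ N e₂)) = 6 := by
      refine le_antisymm hconn.X_le ?_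
      rw [X_union hd, X_union d12, J_union_right d12, J12, X1, X2, hX, c.J_face_N hf,
        c.J_face_N hf, t1, t2]
      have := T_nonneg f (N e₁) (N e₂)
      omega
    refine hW2 e₁ e₂ hne' _ (Finset.subset_union_left.trans Finset.subset_union_right)
      (Finset.subset_union_right.trans Finset.subset_union_right) hconn (fun v =>
        Finset.disjoint_union_left.2 ⟨hfD v, Finset.disjoint_union_left.2 ⟨c.nd _ _, c.nd _ _⟩⟩)
        hXY ?_
    have hexp : ∀ v, J (f ∪ (N e₁ ∪ N e₂)) (D v) ≤ J f (D v) + J (N e₁) (D v) + J (N e₂) (D v)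
        - 2 * T f (D v) (N e₁) - 2 * T f (D v) (N e₂) := by
      intro v
      rw [J_comm, J_union_right hd, J_union_right d12, J_comm f, J_comm (N e₁), J_comm (N e₂),
        T_union_right d12, T_swap_left (D v) f, T_swap_left (D v) f]
      have := T_nonneg (D v) (N e₁) (N e₂)
      omega
    refine (Finset.sum_le_sum fun v _ => hexp v).trans ?_
    rw [Finset.sum_sub_distrib, Finset.sum_sub_distrib, Finset.sum_add_distrib,
      Finset.sum_add_distrib, ← Finset.mul_sum, ← Finset.mul_sum, ← c.T_D_split, ← c.T_D_split,
      c.sum_J_face_D hf, hsum, c.sum_J_N_D, c.sum_J_N_D, t1, t2]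
    have := hT4 e₁; have := hT4 e₂
    omega
  · have h6 := six_dvd_X f
    have : X f ≤ 0 := by omega
    refine this.trans (Finset.sum_nonneg fun e _ => mul_nonneg (ht0 e) ?_)
    rcases hω e with h | h <;> rw [h] <;> norm_num

theorem card_le {B : Finset (ℤ × ℤ)} (hΛ : Conn Λ) (hXΛ : X Λ = 6) (hB : Conn B) (hBΛ : B ⊆ Λ)
    (hBI : Disjoint B Λ₀) (hΛB : Λ ⊆ Λ₀ ∪ B)
    (hmax : ∀ f, IsFace Λ D N f → f ⊆ Λ₀ → ∀ e, (∃ u ∈ N e, ∃ w ∈ f, Adj u w) →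
      ∃ e' ≠ e, T f (Finset.univ.biUnion D) (N e') ≠ 0)
    (hT4 : ∀ e, T (N e) (Finset.univ.biUnion D) (uncol Λ D N) ≤ 4)
    (hZ : ∀ e, X (N e) = 0 → (∀ v, J (N e) (D v) = 0) → False)
    (hW1 : ∀ e, X (N e) = 6 → ∑ v, J (N e) (D v) ≤ 2 → False)
    (hW2 : ∀ e e', e ≠ e' → ∀ Y, N e ⊆ Y → N e' ⊆ Y → Conn Y → (∀ v, Disjoint Y (D v)) →
      X Y = 6 → ∑ v, J Y (D v) ≤ 4 → False) :
    Fintype.card ε ≤ 3 * Fintype.card ι := by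
  obtain ⟨F, hF, hFU, hFs⟩ := c.exists_faces
  have hBU : B ⊆ uncol Λ D N := fun u hu => mem_uncol.2 ⟨hBΛ hu,
    fun v hv => Finset.disjoint_left.1 hBI hu (c.dsub v hv),
    fun e he => Finset.disjoint_left.1 hBI hu (c.nsub e he)⟩
  obtain ⟨b, hb⟩ := hB.1
  obtain ⟨f₀, hf₀, hbf₀⟩ : ∃ f₀ ∈ F, b ∈ f₀ := by
    have := hBU hb
    rw [← hFU] at this
    simpa using this
  have hBf₀ : B ⊆ f₀ := fun u hu => hB.2 (· ∈ f₀) ⟨b, hb, hbf₀⟩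
    (fun x _ y hy hxy hx => (hF f₀ hf₀).closed x hx y (hBU hy) hxy) u hu
  have hbdd : ∀ f ∈ F.erase f₀, X f ≤
      ∑ e, T f (Finset.univ.biUnion D) (N e) * (if X (N e) = 6 then 1 else 2) := by
    intro f hf
    obtain ⟨hne, hf⟩ := Finset.mem_erase.1 hf
    have hdis : Disjoint f f₀ := (hFs f hf f₀ hf₀ hne).1
    have hbf : b ∉ f := fun h => Finset.disjoint_left.1 hdis h hbf₀
    have hfI : f ⊆ Λ₀ := by
      intro u hu
      rcases Finset.mem_union.1 (hΛB (mem_uncol.1 ((hF f hf).sub hu)).1) with h | h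
      · exact h
      · exact absurd (hBf₀ h) (Finset.disjoint_left.1 hdis hu)
    exact c.X_face_le (hF f hf) hΛ (fun h => hbf (h (hBΛ hb))) (hmax f (hF f hf) hfI) hT4 hW2
  have h0 : X f₀ ≤ 6 := (hF f₀ hf₀).conn.X_le
  have htot := c.X_total hXΛ
  rw [c.X_faces hFU hFs, ← Finset.add_sum_erase _ _ hf₀] at htot
  have hsum : ∑ f ∈ F.erase f₀, X f ≤
      ∑ e, (∑ v, J (N e) (D v)) * (if X (N e) = 6 then 1 else 2) := by
    refine (Finset.sum_le_sum hbdd).trans ?_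
    rw [Finset.sum_comm]
    refine Finset.sum_le_sum fun e _ => ?_
    rw [← Finset.sum_mul]
    refine mul_le_mul_of_nonneg_right ?_ (by split_ifs <;> norm_num)
    rw [← c.sum_T_faces hFU hFs e, ← Finset.add_sum_erase _ _ hf₀]
    have := T_nonneg f₀ (Finset.univ.biUnion D) (N e)
    omega
  have hedge : ∀ e, (∑ v, J (N e) (D v)) * (if X (N e) = 6 then 1 else 2) ≤
      3 * (∑ v, J (N e) (D v)) - X (N e) - 2 := by
    intro e
    have h4 : ∑ v, J (N e) (D v) ≤ 4 := by rw [c.sum_J_N_D]; exact hT4 e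
    have hnn : ∀ v, 0 ≤ J (N e) (D v) := fun v => J_nonneg (c.nd e v)
    have h0 : 0 ≤ ∑ v, J (N e) (D v) := Finset.sum_nonneg fun v _ => hnn v
    have h2 : (2 : ℤ) ∣ ∑ v, J (N e) (D v) := Finset.dvd_sum fun v _ => two_dvd_J (c.nd e v)
    have h6 := six_dvd_X (N e)
    have hle := (c.nconn e).X_le
    by_cases hX : X (N e) = 6
    · have : ¬ ∑ v, J (N e) (D v) ≤ 2 := hW1 e hX
      rw [if_pos hX]
      omega
    · rw [if_neg hX]
      by_cases hX0 : X (N e) = 0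
      · have : ∑ v, J (N e) (D v) ≠ 0 := by
          intro h
          rw [Finset.sum_eq_zero_iff_of_nonneg fun v _ => hnn v] at h
          exact hZ e hX0 fun v => h v (Finset.mem_univ v)
        omega
      · omega
  have hsum2 := Finset.sum_le_sum fun e (_ : e ∈ Finset.univ) => hedge e
  rw [Finset.sum_sub_distrib, Finset.sum_sub_distrib, ← Finset.mul_sum] at hsum2
  simp only [Finset.sum_const, Finset.card_univ, nsmul_eq_mul] at hsum2
  have : (Fintype.card ε : ℤ) ≤ 3 * Fintype.card ι := by linarith
  exact_mod_cast this

end Coloring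

end TriLattice

namespace TriLattice

theorem exists_box (S : Finset (ℤ × ℤ)) : ∃ L : ℤ, 0 < L ∧ S ⊆ box (-L) L (-L) L := by
  induction S using Finset.induction_on with
  | empty => exact ⟨1, by norm_num, Finset.empty_subset _⟩
  | insert u S _ ih =>
    obtain ⟨L, hL, hS⟩ := ih
    refine ⟨L + |u.1| + |u.2|, by positivity, ?_⟩
    have h1 := abs_nonneg u.1; have h2 := abs_nonneg u.2
    have h3 := neg_abs_le u.1; have h4 := neg_abs_le u.2
    have h5 := le_abs_self u.1; have h6 := le_abs_self u.2
    intro v hv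
    rw [mem_box]
    rcases Finset.mem_insert.1 hv with rfl | hv
    · omega
    · have := mem_box.1 (hS hv)
      omega

variable {ι ε : Type*} [Fintype ι] [Fintype ε]

/-- The number of edges in a system of vertex regions and edge regions is at most three times
the number of vertices, provided no edge region can be enlarged to a region with
trivial topology. -/
theorem card_le_of_regions {D : ι → Finset (ℤ × ℤ)} {N₀ : ε → Finset (ℤ × ℤ)}
    (hDc : ∀ v, Conn (D v)) (hDX : ∀ v, X (D v) = 6) (hDs : Sep D)
    (hNc : ∀ e, Conn (N₀ e)) (hNs : Sep N₀) (hND : ∀ e v, Disjoint (N₀ e) (D v))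
    (hT : ∀ e K C, (∀ u ∈ K, ∃ v, u ∈ D v) → Disjoint (N₀ e) C → (∀ v, Disjoint (D v) C) →
      T (N₀ e) K C ≤ 4)
    (hZ : ∀ e Y, N₀ e ⊆ Y → Conn Y → (∀ v, Disjoint Y (D v)) → X Y = 0 →
      (∀ v, J Y (D v) = 0) → False)
    (hW1 : ∀ e Y, N₀ e ⊆ Y → Conn Y → (∀ v, Disjoint Y (D v)) → X Y = 6 →
      ∑ v, J Y (D v) ≤ 2 → False)
    (hW2 : ∀ e e', e ≠ e' → ∀ Y, N₀ e ⊆ Y → N₀ e' ⊆ Y → Conn Y → (∀ v, Disjoint Y (D v)) →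
      X Y = 6 → ∑ v, J Y (D v) ≤ 4 → False) :
    Fintype.card ε ≤ 3 * Fintype.card ι := by
  classical
  obtain ⟨L, hL, hS⟩ := exists_box (Finset.univ.biUnion D ∪ Finset.univ.biUnion N₀)
  set Λ₀ := box (-L) L (-L) L with hI
  set Λ := box (-(L + 1)) (L + 1) (-(L + 1)) (L + 1) with hΛ
  have hDI : ∀ v, D v ⊆ Λ₀ := fun v => (Finset.subset_biUnion_of_mem D (Finset.mem_univ v)).trans
    (Finset.subset_union_left.trans hS)
  have hNI : ∀ e, N₀ e ⊆ Λ₀ := fun v => (Finset.subset_biUnion_of_mem N₀ (Finset.mem_univ v)).trans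
    (Finset.subset_union_right.trans hS)
  have hIΛ : Λ₀ ⊆ Λ := by
    intro u; rw [mem_box, mem_box]; omega
  have hint : ∀ u ∈ Λ₀, ∀ w, Adj u w → w ∈ Λ := by
    intro u hu w; rw [mem_box] at hu ⊢; unfold Adj; omega
  have c₀ : Coloring Λ Λ₀ D N₀ := ⟨hIΛ, hint, hDc, hDX, hDs, hDI, hNc, hNI,
    fun e e' h => (hNs e e' h).1, hND,
    fun e e' h u hu v hv w huv => absurd huv ((hNs e e' h).2 u hu v hv)⟩
  have hT₀ : ∀ e, T (N₀ e) (Finset.univ.biUnion D) (uncol Λ D N₀) ≤ 4 := fun e =>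
    hT e _ _ (fun u hu => by simpa using hu)
      (Finset.disjoint_left.2 fun u hu h => (mem_uncol.1 h).2.2 e hu)
      (fun v => Finset.disjoint_left.2 fun u hu h => (mem_uncol.1 h).2.1 v hu)
  let P : (ε → Finset (ℤ × ℤ)) → Prop := fun N => Coloring Λ Λ₀ D N ∧ (∀ e, N₀ e ⊆ N e) ∧
    ∀ e, T (N e) (Finset.univ.biUnion D) (uncol Λ D N) ≤ 4
  obtain ⟨N, hN, hmax⟩ := Finset.exists_max_image
    ((Fintype.piFinset fun _ : ε => Λ.powerset).filter P) (fun N => ∑ e, (N e).card)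
    ⟨N₀, Finset.mem_filter.2 ⟨Fintype.mem_piFinset.2 fun e =>
      Finset.mem_powerset.2 ((hNI e).trans hIΛ), c₀, fun e => Finset.Subset.refl _, hT₀⟩⟩
  obtain ⟨c, hsub, hT4⟩ := (Finset.mem_filter.1 hN).2
  have hrim := rim_conn (L := L + 1) (by omega)
  refine c.card_le (box_conn (by omega) (by omega)) (box_X (by omega) (by omega)) hrim ?_ ?_ ?_
    ?_ hT4 (fun e => hZ e _ (hsub e) (c.nconn e) (c.nd e))
    (fun e => hW1 e _ (hsub e) (c.nconn e) (c.nd e))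
    (fun e e' hne Y h h' => hW2 e e' hne Y ((hsub e).trans h) ((hsub e').trans h'))
  · intro u; simp only [Finset.mem_union, hΛ, mem_box]; omega
  · rw [Finset.disjoint_left]
    intro u; simp only [Finset.mem_union, hI, mem_box]; omega
  · intro u; simp only [Finset.mem_union, hI, hΛ, mem_box]; omega
  · intro f hf hfI e htouch
    by_contra! hcon
    obtain ⟨c', hT'⟩ := c.merge hf hfI htouch hcon
    have hlt : ∑ e', (N e').card < ∑ e', (Function.update N e (N e ∪ f) e').card := by
      refine Finset.sum_lt_sum (fun e' _ => ?_) ⟨e, Finset.mem_univ _, ?_⟩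
      · by_cases h : e' = e
        · subst h; rw [Function.update_self]; exact Finset.card_le_card Finset.subset_union_left
        · rw [Function.update_of_ne h]
      · rw [Function.update_self, Finset.card_union_of_disjoint]
        · have := Finset.card_pos.2 hf.conn.1
          omega
        · exact Finset.disjoint_right.2 fun u hu => (mem_uncol.1 (hf.sub hu)).2.2 e
    refine absurd hlt (not_lt.2 (hmax _ (Finset.mem_filter.2 ⟨Fintype.mem_piFinset.2 fun e' =>
      Finset.mem_powerset.2 ((c'.nsub e').trans hIΛ), c', fun e' => ?_, hT' 4 hT4⟩)))
    by_cases h : e' = e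
    · subst h; rw [Function.update_self]; exact (hsub _).trans Finset.subset_union_left
    · rw [Function.update_of_ne h]; exact hsub e'

end TriLattice

namespace TriLattice

open CategoryTheory

variable {ι : Type*}

/-- A pair of adjacent cells, one in `Y` and the other in one of the `D v`. -/
def Contact (Y : Finset (ℤ × ℤ)) (D : ι → Finset (ℤ × ℤ)) (c : (ℤ × ℤ) × (ℤ × ℤ)) : Prop :=
  c.1 ∈ Y ∧ (∃ v, c.2 ∈ D v) ∧ Adj c.1 c.2

/-- Two contacts spanning a common triangle. -/
def ContactStep (Y : Finset (ℤ × ℤ)) (D : ι → Finset (ℤ × ℤ)) (c c' : (ℤ × ℤ) × (ℤ × ℤ)) : Prop :=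
  Contact Y D c ∧ Contact Y D c' ∧ (c.2 = c'.2 ∧ Adj c.1 c'.1 ∨ c.1 = c'.1 ∧ Adj c.2 c'.2)

theorem ContactStep.symm {Y : Finset (ℤ × ℤ)} {D : ι → Finset (ℤ × ℤ)}
    {c c' : (ℤ × ℤ) × (ℤ × ℤ)} (h : ContactStep Y D c c') : ContactStep Y D c' c :=
  ⟨h.2.1, h.1, h.2.2.imp (fun h => ⟨h.1.symm, h.2.symm⟩) (fun h => ⟨h.1.symm, h.2.symm⟩)⟩

/-- Two contacts joined by a chain of triangles. -/
def ContactRel (Y : Finset (ℤ × ℤ)) (D : ι → Finset (ℤ × ℤ)) :=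
  Relation.ReflTransGen (ContactStep Y D)

theorem ContactRel.symm {Y : Finset (ℤ × ℤ)} {D : ι → Finset (ℤ × ℤ)}
    {c c' : (ℤ × ℤ) × (ℤ × ℤ)} (h : ContactRel Y D c c') : ContactRel Y D c' c := by
  unfold ContactRel at *
  induction h with
  | refl => exact .refl
  | tail _ h ih => exact ih.head h.symm

theorem ContactRel.trans {Y : Finset (ℤ × ℤ)} {D : ι → Finset (ℤ × ℤ)}
    {c c' c'' : (ℤ × ℤ) × (ℤ × ℤ)} (h : ContactRel Y D c c') (h' : ContactRel Y D c' c'') :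
    ContactRel Y D c c'' :=
  Relation.ReflTransGen.trans h h'

theorem contactRel_of_quot {Y : Finset (ℤ × ℤ)} {D : ι → Finset (ℤ × ℤ)}
    {c c' : (ℤ × ℤ) × (ℤ × ℤ)}
    (h : Quot.mk (ContactStep Y D) c = Quot.mk (ContactStep Y D) c') : ContactRel Y D c c' := by
  have := Quot.eqvGen_exact h
  clear h
  induction this with
  | rel _ _ h => exact .single h
  | refl => exact .refl
  | symm _ _ _ ih => exact ih.symm
  | trans _ _ _ _ _ ih₁ ih₂ => exact ih₁.trans ih₂

/-- A family of pairwise unrelated contacts is at most half the number of junctions. -/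
theorem two_mul_card_contacts_le [Fintype ι] {Y : Finset (ℤ × ℤ)} {D : ι → Finset (ℤ × ℤ)}
    (hY : Conn Y) (hXY : X Y = 6) (hD : ∀ v, Conn (D v)) (hXD : ∀ v, X (D v) = 6)
    (hdis : ∀ v, Disjoint Y (D v)) (hsep : Sep D) (C : Finset ((ℤ × ℤ) × (ℤ × ℤ)))
    (hC : ∀ c ∈ C, Contact Y D c) (hinj : ∀ c ∈ C, ∀ c' ∈ C, ContactRel Y D c c' → c = c') :
    2 * (C.card : ℤ) ≤ ∑ v, J Y (D v) := by
  refine contact_card (fun u d => Quot.mk (ContactStep Y D) (u, d)) hY hXY hD hXD hdis hsep ?_ ?_ C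
    hC fun c hc c' hc' h => hinj c hc c' hc' (contactRel_of_quot h)
  · exact fun u hu u' hu' v d hd h1 h2 h3 => Quot.sound
      ⟨⟨hu, ⟨v, hd⟩, h2⟩, ⟨hu', ⟨v, hd⟩, h3⟩, Or.inl ⟨rfl, h1⟩⟩
  · exact fun u hu v d hd d' hd' h1 h2 h3 => Quot.sound
      ⟨⟨hu, ⟨v, hd⟩, h2⟩, ⟨hu, ⟨v, hd'⟩, h3⟩, Or.inr ⟨rfl, h1⟩⟩

theorem contacts_related_of_le_two [Fintype ι] {Y : Finset (ℤ × ℤ)} {D : ι → Finset (ℤ × ℤ)}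
    (hY : Conn Y) (hXY : X Y = 6) (hD : ∀ v, Conn (D v)) (hXD : ∀ v, X (D v) = 6)
    (hdis : ∀ v, Disjoint Y (D v)) (hsep : Sep D) (hJ : ∑ v, J Y (D v) ≤ 2)
    {c c' : (ℤ × ℤ) × (ℤ × ℤ)} (hc : Contact Y D c) (hc' : Contact Y D c') :
    ContactRel Y D c c' := by
  by_contra h
  have hne : c ≠ c' := by rintro rfl; exact h .refl
  have := two_mul_card_contacts_le hY hXY hD hXD hdis hsep {c, c'} (by simp [hc, hc']) (by
    have h' : ¬ ContactRel Y D c' c := fun h1 => h h1.symm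
    simp [h, h'])
  rw [Finset.card_pair hne] at this
  omega

theorem contacts_related_of_le_four [Fintype ι] {Y : Finset (ℤ × ℤ)} {D : ι → Finset (ℤ × ℤ)}
    (hY : Conn Y) (hXY : X Y = 6) (hD : ∀ v, Conn (D v)) (hXD : ∀ v, X (D v) = 6)
    (hdis : ∀ v, Disjoint Y (D v)) (hsep : Sep D) (hJ : ∑ v, J Y (D v) ≤ 4)
    {c₁ c₂ c₃ : (ℤ × ℤ) × (ℤ × ℤ)} (h1 : Contact Y D c₁) (h2 : Contact Y D c₂)
    (h3 : Contact Y D c₃) :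
    ContactRel Y D c₁ c₂ ∨ ContactRel Y D c₁ c₃ ∨ ContactRel Y D c₂ c₃ := by
  by_contra! h
  obtain ⟨h12, h13, h23⟩ := h
  have n12 : c₁ ≠ c₂ := by rintro rfl; exact h12 .refl
  have n13 : c₁ ≠ c₃ := by rintro rfl; exact h13 .refl
  have n23 : c₂ ≠ c₃ := by rintro rfl; exact h23 .refl
  have := two_mul_card_contacts_le hY hXY hD hXD hdis hsep {c₁, c₂, c₃} (by simp [h1, h2, h3]) (by
    have h' : ¬ ContactRel Y D c₂ c₁ := fun h => h12 h.symm
    have h'' : ¬ ContactRel Y D c₃ c₁ := fun h => h13 h.symm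
    have h''' : ¬ ContactRel Y D c₃ c₂ := fun h => h23 h.symm
    simp [h12, h13, h23, h', h'', h'''])
  rw [Finset.card_eq_three.2 ⟨c₁, c₂, c₃, n12, n13, n23, rfl⟩] at this
  omega

/-- A realization of the lattice in a groupoid, with distinguished morphisms around each of the
regions `D v`; relations are only imposed away from the centres of the regions. -/
structure Realization (C : Type*) [Groupoid C] (D : ι → Finset (ℤ × ℤ)) where
  pt : ℤ × ℤ → C
  seg : ∀ u v, pt u ⟶ pt v
  InB : ι → ∀ {x y : C}, (x ⟶ y) → Prop
  center : ι → ℤ × ℤ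
  center_mem : ∀ v, center v ∈ D v
  inner : ∀ v u, Adj (center v) u → u ∈ D v
  comp_mem : ∀ {v} {x y z : C} {f : x ⟶ y} {g : y ⟶ z}, InB v f → InB v g → InB v (f ≫ g)
  inv_mem : ∀ {v} {x y : C} {f : x ⟶ y}, InB v f → InB v (Groupoid.inv f)
  conn : ∀ {v d d'}, d ∈ D v → d' ∈ D v → d ≠ center v → d' ≠ center v →
    ∃ f : pt d ⟶ pt d', InB v f
  seg_symm : ∀ {u w}, Adj u w → (∀ v, u ≠ center v) → (∀ v, w ≠ center v) →
    seg w u = Groupoid.inv (seg u w)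
  seg_tri : ∀ {u v w}, Adj u v → Adj v w → Adj u w → (∀ x, u ≠ center x) →
    (∀ x, v ≠ center x) → (∀ x, w ≠ center x) → seg u v ≫ seg v w = seg u w
  seg_mem : ∀ {v d d'}, d ∈ D v → d' ∈ D v → d ≠ center v → d' ≠ center v → Adj d d' →
    InB v (seg d d')

namespace Realization

variable {C : Type*} [Groupoid C] {D : ι → Finset (ℤ × ℤ)} (R : Realization C D)

/-- Morphisms obtained by following adjacent cells in `Y`. -/
inductive WalkIn (Y : Finset (ℤ × ℤ)) (u : ℤ × ℤ) : ∀ w, (R.pt u ⟶ R.pt w) → Prop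
  | nil : u ∈ Y → WalkIn Y u u (𝟙 _)
  | snoc {w w' f} : WalkIn Y u w f → Adj w w' → w' ∈ Y → WalkIn Y u w' (f ≫ R.seg w w')

theorem WalkIn.mono {R : Realization C D} {Y Y' : Finset (ℤ × ℤ)} (h : Y ⊆ Y') {u w : ℤ × ℤ}
    {f : R.pt u ⟶ R.pt w} (hf : R.WalkIn Y u w f) : R.WalkIn Y' u w f := by
  induction hf with
  | nil hu => exact .nil (h hu)
  | snoc _ hw hw' ih => exact ih.snoc hw (h hw')

theorem WalkIn.mem {R : Realization C D} {Y : Finset (ℤ × ℤ)} {u w : ℤ × ℤ}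
    {f : R.pt u ⟶ R.pt w} (hf : R.WalkIn Y u w f) : u ∈ Y ∧ w ∈ Y := by
  induction hf with
  | nil hu => exact ⟨hu, hu⟩
  | snoc _ hw hw' ih => exact ⟨ih.1, hw'⟩

theorem id_mem {v : ι} {x y : C} {f : x ⟶ y} (h : R.InB v f) : R.InB v (𝟙 x) := by
  rw [← Groupoid.comp_inv f]; exact R.comp_mem h (R.inv_mem h)

/-- The trace of an edge on the lattice: a walk in `N` together with contacts at both ends. -/
structure Trace (N : Finset (ℤ × ℤ)) where
  a : ι
  b : ι
  d : ℤ × ℤ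
  d' : ℤ × ℤ
  u : ℤ × ℤ
  w : ℤ × ℤ
  hd : d ∈ D a
  hd' : d' ∈ D b
  adj : Adj u d
  adj' : Adj w d'
  W : R.pt u ⟶ R.pt w
  walk : R.WalkIn N u w W

/-- The full morphism of a trace. -/
def Trace.mor {R : Realization C D} {N : Finset (ℤ × ℤ)} (t : R.Trace N) : R.pt t.d ⟶ R.pt t.d' :=
  R.seg t.d t.u ≫ t.W ≫ R.seg t.w t.d'

theorem good_of_not_mem {u : ℤ × ℤ} (h : ∀ v, u ∉ D v) (v : ι) : u ≠ R.center v := by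
  rintro rfl; exact h v (R.center_mem v)

theorem good_of_contact {u d : ℤ × ℤ} (h : ∀ v, u ∉ D v) (hud : Adj u d) (v : ι) :
    d ≠ R.center v := by
  rintro rfl; exact h v (R.inner v u hud.symm)

theorem not_mem_of_disjoint {Y : Finset (ℤ × ℤ)} (hdis : ∀ v, Disjoint Y (D v)) {u : ℤ × ℤ}
    (hu : u ∈ Y) (v : ι) : u ∉ D v := Finset.disjoint_left.1 (hdis v) hu

/-- Over a region with trivial topology, morphisms can be lifted consistently up to loops
at the base point in `InB a`. -/
theorem exists_lift {Y : Finset (ℤ × ℤ)} (hY : Conn Y) (hX : X Y = 6)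
    (hdis : ∀ v, Disjoint Y (D v)) {a : ι} {x₀ : C} (hx₀ : R.InB a (𝟙 x₀)) {r : ℤ × ℤ}
    (hr : r ∈ Y) (p₀ : x₀ ⟶ R.pt r) :
    ∃ p : ∀ u ∈ Y, x₀ ⟶ R.pt u, p r hr = p₀ ∧ ∀ u hu v hv, Adj u v →
      ∃ α : x₀ ⟶ x₀, R.InB a α ∧ p v hv = α ≫ p u hu ≫ R.seg u v := by
  have good : ∀ u ∈ Y, ∀ v, u ≠ R.center v := fun u hu =>
    R.good_of_not_mem (not_mem_of_disjoint hdis hu)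
  obtain ⟨s, hs0, hs1, hs2⟩ := Conn.exists_section (Z := Σ u, (x₀ ⟶ R.pt u))
    (fun u z => z.1 = u)
    (fun u v z z' => z.1 = u ∧ z'.1 = v ∧ ∃ α : x₀ ⟶ x₀, R.InB a α ∧
      z'.2 = α ≫ z.2 ≫ R.seg z.1 z'.1) hY hX
    (by
      rintro u hu v hv ⟨u', p⟩ ⟨v', p'⟩ huv ⟨rfl, rfl, α, hα, h⟩
      refine ⟨rfl, rfl, Groupoid.inv α, R.inv_mem hα, ?_⟩
      dsimp only at *
      rw [R.seg_symm huv (good _ hu) (good _ hv), h]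
      simp)
    (by
      rintro u hu v hv w hw huv hvw huw ⟨u', p⟩ ⟨v', p'⟩ ⟨w', p''⟩ ⟨rfl, rfl, α, hα, h⟩
        ⟨_, rfl, β, hβ, h'⟩
      refine ⟨rfl, rfl, β ≫ α, R.comp_mem hβ hα, ?_⟩
      dsimp only at *
      rw [← R.seg_tri huv hvw huw (good _ hu) (good _ hv) (good _ hw), h', h]
      simp)
    hr (z := ⟨r, p₀⟩) rfl
    (by
      rintro u hu v hv huv _ ⟨u', p⟩ rfl
      exact ⟨⟨v, p ≫ R.seg _ v⟩, rfl, rfl, rfl, 𝟙 _, hx₀, by simp⟩)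
  have hex : ∀ u (hu : u ∈ Y), ∃ p : x₀ ⟶ R.pt u, s u = ⟨u, p⟩ := by
    intro u hu
    have := hs1 u hu
    generalize s u = z at this ⊢
    obtain ⟨u', p⟩ := z
    obtain rfl : u' = u := this
    exact ⟨p, rfl⟩
  choose p hp using hex
  refine ⟨p, ?_, ?_⟩
  · have := (hp r hr).symm.trans hs0
    simpa using this
  · intro u hu v hv huv
    have := hs2 u hu v hv huv
    rw [hp u hu, hp v hv] at this
    exact this.2.2

theorem lift_walk {Y : Finset (ℤ × ℤ)} {a : ι} {x₀ : C} (hx₀ : R.InB a (𝟙 x₀))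
    {p : ∀ u ∈ Y, x₀ ⟶ R.pt u} (hp : ∀ u hu v hv, Adj u v →
      ∃ α : x₀ ⟶ x₀, R.InB a α ∧ p v hv = α ≫ p u hu ≫ R.seg u v) {u w : ℤ × ℤ}
    {f : R.pt u ⟶ R.pt w} (hf : R.WalkIn Y u w f) (hu : u ∈ Y) (hw : w ∈ Y) :
    ∃ α : x₀ ⟶ x₀, R.InB a α ∧ p w hw = α ≫ p u hu ≫ f := by
  induction hf with
  | nil _ => exact ⟨𝟙 _, hx₀, by simp⟩
  | @snoc w w' f hf hww' hw' ih =>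
    obtain ⟨α, hα, h⟩ := ih hf.mem.2
    obtain ⟨β, hβ, h'⟩ := hp w hf.mem.2 w' hw' hww'
    exact ⟨β ≫ α, R.comp_mem hβ hα, by rw [h', h]; simp⟩

theorem lift_contactRel {Y : Finset (ℤ × ℤ)} (hsep : Sep D) (hdis : ∀ v, Disjoint Y (D v)) {a : ι}
    {x₀ : C} (hx₀ : R.InB a (𝟙 x₀))
    {p : ∀ u ∈ Y, x₀ ⟶ R.pt u} (hp : ∀ u hu v hv, Adj u v →
      ∃ α : x₀ ⟶ x₀, R.InB a α ∧ p v hv = α ≫ p u hu ≫ R.seg u v)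
    {c c' : (ℤ × ℤ) × (ℤ × ℤ)} (h : ContactRel Y D c c') (hc : Contact Y D c) :
    ∃ hc' : Contact Y D c', ∃ α : x₀ ⟶ x₀, R.InB a α ∧ ∃ γ : R.pt c.2 ⟶ R.pt c'.2,
      (∀ v, c.2 ∈ D v → c'.2 ∈ D v ∧ R.InB v γ) ∧
      p c'.1 hc'.1 ≫ R.seg c'.1 c'.2 = α ≫ (p c.1 hc.1 ≫ R.seg c.1 c.2) ≫ γ := by
  have good : ∀ c, Contact Y D c → ∀ v, c.2 ≠ R.center v := fun c hc =>
    R.good_of_contact (not_mem_of_disjoint hdis hc.1) hc.2.2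
  have good' : ∀ c, Contact Y D c → ∀ v, c.1 ≠ R.center v := fun c hc =>
    R.good_of_not_mem (not_mem_of_disjoint hdis hc.1)
  unfold ContactRel at h
  induction h with
  | refl =>
    refine ⟨hc, 𝟙 _, hx₀, 𝟙 _, fun v hv => ⟨hv, ?_⟩, by simp⟩
    obtain ⟨f, hf⟩ := R.conn hv hv (good c hc v) (good c hc v)
    exact R.id_mem hf
  | @tail c₁ c₂ _ hs ih =>
    obtain ⟨h1, α, hα, γ, hγ, h⟩ := ih
    obtain ⟨-, h2, hs⟩ := hs
    refine ⟨h2, ?_⟩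
    obtain ⟨u₁, d₁⟩ := c₁
    obtain ⟨u₂, d₂⟩ := c₂
    rcases hs with ⟨hd, hu⟩ | ⟨hu, hd⟩
    · obtain rfl : d₁ = d₂ := hd
      obtain ⟨β, hβ, h'⟩ := hp u₁ h1.1 u₂ h2.1 hu
      refine ⟨β ≫ α, R.comp_mem hβ hα, γ, hγ, ?_⟩
      dsimp only at *
      rw [h', Category.assoc, Category.assoc, R.seg_tri hu h2.2.2 h1.2.2 (good' _ h1) (good' _ h2)
        (good (u₁, d₁) h1), h]
      simp
    · obtain rfl : u₁ = u₂ := hu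
      dsimp only at *
      refine ⟨α, hα, γ ≫ R.seg d₁ d₂, fun v hv => ?_, ?_⟩
      · obtain ⟨hv1, hv2⟩ := hγ v hv
        obtain ⟨v', hv'⟩ := h2.2.1
        have hvv : v = v' := by
          by_contra hne
          exact (hsep v v' hne).2 _ hv1 _ hv' hd
        subst hvv
        exact ⟨hv', R.comp_mem hv2 (R.seg_mem hv1 hv' (good _ h1 v) (good _ h2 v) hd)⟩
      · rw [← R.seg_tri h1.2.2 hd h2.2.2 (good' _ h1) (good _ h1) (good _ h2), ← Category.assoc, h]
        simp

end Realization

end TriLattice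

namespace TriLattice

open CategoryTheory

namespace Realization

variable {ι C : Type*} [Groupoid C] {D : ι → Finset (ℤ × ℤ)} (R : Realization C D)

theorem eq_index (hsep : Sep D) {d : ℤ × ℤ} {v v' : ι} (h : d ∈ D v) (h' : d ∈ D v') : v = v' := by
  by_contra hne
  exact Finset.disjoint_left.1 (hsep v v' hne).1 h h'

section

variable {R} {Y N : Finset (ℤ × ℤ)} (hsep : Sep D)
  (hdis : ∀ v, Disjoint Y (D v)) (t : R.Trace N) (hN : N ⊆ Y)
include hsep hdis hN

theorem Trace.contact_left : Contact Y D (t.u, t.d) :=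
  ⟨hN t.walk.mem.1, ⟨_, t.hd⟩, t.adj⟩

theorem Trace.contact_right : Contact Y D (t.w, t.d') :=
  ⟨hN t.walk.mem.2, ⟨_, t.hd'⟩, t.adj'⟩

theorem Trace.id_mem : R.InB t.a (𝟙 (R.pt t.d)) := by
  have hg := R.good_of_contact (not_mem_of_disjoint hdis (t.contact_left hsep hdis hN).1) t.adj t.a
  obtain ⟨f, hf⟩ := R.conn t.hd t.hd hg hg
  exact R.id_mem hf

theorem Trace.seg_comp : R.seg t.d t.u ≫ R.seg t.u t.d = 𝟙 _ := by
  have h1 := (t.contact_left hsep hdis hN).1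
  have hg := R.good_of_contact (not_mem_of_disjoint hdis h1) t.adj
  rw [R.seg_symm t.adj.symm hg (R.good_of_not_mem (not_mem_of_disjoint hdis h1)),
    Groupoid.comp_inv]

/-- Lifting data for a trace, based at its starting contact. -/
theorem Trace.exists_lift (hY : Conn Y) (hX : X Y = 6) :
    ∃ p : ∀ u ∈ Y, R.pt t.d ⟶ R.pt u,
      (∀ u hu v hv, Adj u v →
        ∃ α : R.pt t.d ⟶ R.pt t.d, R.InB t.a α ∧ p v hv = α ≫ p u hu ≫ R.seg u v) ∧
      (p t.u (hN t.walk.mem.1) ≫ R.seg t.u t.d = 𝟙 _) ∧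
      ∃ α : R.pt t.d ⟶ R.pt t.d, R.InB t.a α ∧
        p t.w (hN t.walk.mem.2) ≫ R.seg t.w t.d' = α ≫ t.mor := by
  have hid := t.id_mem hsep hdis hN
  obtain ⟨p, hp0, hp⟩ := R.exists_lift hY hX hdis hid (hN t.walk.mem.1) (R.seg t.d t.u)
  refine ⟨p, hp, ?_, ?_⟩
  · rw [hp0, t.seg_comp hsep hdis hN]
  · obtain ⟨α, hα, h⟩ := R.lift_walk hid hp (t.walk.mono hN) (hN t.walk.mem.1) (hN t.walk.mem.2)
    exact ⟨α, hα, by rw [h, hp0, Trace.mor]; simp⟩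

theorem Trace.trivial_of_contactRel (hY : Conn Y) (hX : X Y = 6)
    (h : ContactRel Y D (t.u, t.d) (t.w, t.d')) : t.a = t.b ∧ R.InB t.a t.mor := by
  obtain ⟨p, hp, hp0, α, hα, hw⟩ := t.exists_lift hsep hdis hN hY hX
  obtain ⟨_, β, hβ, γ, hγ, h'⟩ := R.lift_contactRel hsep hdis (t.id_mem hsep hdis hN) hp h
    (t.contact_left hsep hdis hN)
  dsimp only at *
  obtain ⟨h1, h2⟩ := hγ _ t.hd
  refine ⟨eq_index hsep h1 t.hd', ?_⟩
  rw [hw, hp0, Category.id_comp] at h'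
  have : t.mor = Groupoid.inv α ≫ β ≫ γ := by rw [← h']; simp
  rw [this]
  exact R.comp_mem (R.inv_mem hα) (R.comp_mem hβ h2)

theorem Trace.parallel_of_contactRel {N' : Finset (ℤ × ℤ)} (t' : R.Trace N') (hN' : N' ⊆ Y)
    (hY : Conn Y) (hX : X Y = 6)
    (h1 : ContactRel Y D (t.u, t.d) (t'.u, t'.d)) (h2 : ContactRel Y D (t.w, t.d') (t'.w, t'.d')) :
    t.a = t'.a ∧ t.b = t'.b ∧ ∃ α β, R.InB t.a α ∧ R.InB t.b β ∧ t'.mor = α ≫ t.mor ≫ β := by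
  obtain ⟨p, hp, hp0, α, hα, hw⟩ := t.exists_lift hsep hdis hN hY hX
  have hid := t.id_mem hsep hdis hN
  obtain ⟨_, β₁, hβ₁, γ₁, hγ₁, e1⟩ := R.lift_contactRel hsep hdis hid hp h1
    (t.contact_left hsep hdis hN)
  obtain ⟨_, β₂, hβ₂, γ₂, hγ₂, e2⟩ := R.lift_contactRel hsep hdis hid hp h2
    (t.contact_right hsep hdis hN)
  obtain ⟨α', hα', e3⟩ := R.lift_walk hid hp (t'.walk.mono hN') (hN' t'.walk.mem.1)
    (hN' t'.walk.mem.2)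
  dsimp only at *
  obtain ⟨k1, k1'⟩ := hγ₁ _ t.hd
  obtain ⟨k2, k2'⟩ := hγ₂ _ t.hd'
  refine ⟨eq_index hsep k1 t'.hd, eq_index hsep k2 t'.hd',
    Groupoid.inv (β₁ ≫ γ₁) ≫ Groupoid.inv α' ≫ β₂ ≫ α, γ₂, ?_, k2', ?_⟩
  · exact R.comp_mem (R.inv_mem (R.comp_mem hβ₁ k1')) (R.comp_mem (R.inv_mem hα')
      (R.comp_mem hβ₂ hα))
  · rw [hp0, Category.id_comp] at e1
    rw [hw, e3] at e2
    have hs := t'.seg_comp hsep hdis hN'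
    have e4 : p t'.u (hN' t'.walk.mem.1) = (β₁ ≫ γ₁) ≫ R.seg t'.d t'.u := by
      rw [← e1, Category.assoc,
        R.seg_symm t'.adj (R.good_of_not_mem (not_mem_of_disjoint hdis (hN' t'.walk.mem.1)))
        (R.good_of_contact (not_mem_of_disjoint hdis (hN' t'.walk.mem.1)) t'.adj)]
      simp
    rw [e4] at e2
    have e5 : α' ≫ (β₁ ≫ γ₁) ≫ t'.mor = β₂ ≫ α ≫ t.mor ≫ γ₂ := by
      unfold Trace.mor at e2 ⊢
      simpa using e2
    have : t'.mor = Groupoid.inv (β₁ ≫ γ₁) ≫ Groupoid.inv α' ≫ (α' ≫ (β₁ ≫ γ₁) ≫ t'.mor) := by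
      simp
    rw [this, e5]
    simp

end

/-- The reversed walk. -/
theorem WalkIn.reverse {Y : Finset (ℤ × ℤ)} (hY : ∀ u ∈ Y, ∀ v, u ≠ R.center v) {u w : ℤ × ℤ}
    {f : R.pt u ⟶ R.pt w} (hf : R.WalkIn Y u w f) : R.WalkIn Y w u (Groupoid.inv f) := by
  have cons : ∀ {w w' u : ℤ × ℤ} {g : R.pt w ⟶ R.pt u}, R.WalkIn Y w u g → Adj w' w → w' ∈ Y →
      R.WalkIn Y w' u (R.seg w' w ≫ g) := by
    intro w w' u g hg h hw'
    induction hg with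
    | nil hw => simpa using (WalkIn.nil hw').snoc h hw
    | snoc _ h1 h2 ih =>
      rw [← Category.assoc]
      exact ih.snoc h1 h2
  induction hf with
  | nil hu => simpa using WalkIn.nil (R := R) hu
  | @snoc w w' f hf h hw' ih =>
    have := cons ih h.symm hw'
    rw [R.seg_symm h (hY _ hf.mem.2) (hY _ hw')] at this
    simpa using this

/-- The reversed trace. -/
def Trace.reverse {R : Realization C D} {N : Finset (ℤ × ℤ)} (hN : ∀ v, Disjoint N (D v))
    (t : R.Trace N) : R.Trace N where
  a := t.b
  b := t.a
  d := t.d'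
  d' := t.d
  u := t.w
  w := t.u
  hd := t.hd'
  hd' := t.hd
  adj := t.adj'
  adj' := t.adj
  W := Groupoid.inv t.W
  walk := t.walk.reverse R fun _ hu => R.good_of_not_mem (not_mem_of_disjoint hN hu)

theorem Trace.reverse_mor {N : Finset (ℤ × ℤ)} (hN : ∀ v, Disjoint N (D v))
    (t : R.Trace N) : (t.reverse hN).mor = Groupoid.inv t.mor := by
  have h1 : R.seg t.d' t.w = Groupoid.inv (R.seg t.w t.d') :=
    R.seg_symm t.adj' (R.good_of_not_mem (not_mem_of_disjoint hN t.walk.mem.2))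
      (R.good_of_contact (not_mem_of_disjoint hN t.walk.mem.2) t.adj')
  have h2 : R.seg t.u t.d = Groupoid.inv (R.seg t.d t.u) := by
    refine R.seg_symm t.adj.symm (R.good_of_contact (not_mem_of_disjoint hN t.walk.mem.1) t.adj)
      (R.good_of_not_mem (not_mem_of_disjoint hN t.walk.mem.1))
  simp only [Trace.mor, Trace.reverse, h1, h2]
  simp [Groupoid.inv_eq_inv]

/-- Two traces in a region with at most four junctions: one of them is trivial or
they are parallel. -/
theorem Trace.of_le_four [Fintype ι] (hsep : Sep D) (hD : ∀ v, Conn (D v))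
    (hXD : ∀ v, X (D v) = 6) {Y N N' : Finset (ℤ × ℤ)} (hY : Conn Y) (hX : X Y = 6)
    (hdis : ∀ v, Disjoint Y (D v)) (hJ : ∑ v, J Y (D v) ≤ 4)
    (t : R.Trace N) (hN : N ⊆ Y) (t' : R.Trace N') (hN' : N' ⊆ Y) :
    (t.a = t.b ∧ R.InB t.a t.mor) ∨ (t'.a = t'.b ∧ R.InB t'.a t'.mor) ∨
    (t.a = t'.a ∧ t.b = t'.b ∧ ∃ α β, R.InB t.a α ∧ R.InB t.b β ∧ t'.mor = α ≫ t.mor ≫ β) ∨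
    (t.b = t'.a ∧ t.a = t'.b ∧ ∃ α β, R.InB t.b α ∧ R.InB t.a β ∧
      t'.mor = α ≫ Groupoid.inv t.mor ≫ β) := by
  have cl := t.contact_left hsep hdis hN
  have cr := t.contact_right hsep hdis hN
  have cl' := t'.contact_left hsep hdis hN'
  have cr' := t'.contact_right hsep hdis hN'
  have triv := fun h => t.trivial_of_contactRel hsep hdis hN hY hX h
  have triv' := fun h => t'.trivial_of_contactRel hsep hdis hN' hY hX h
  have hNd : ∀ v, Disjoint N (D v) := fun v => Finset.disjoint_of_subset_left hN (hdis v)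
  rcases contacts_related_of_le_four hY hX hD hXD hdis hsep hJ cl cr cl' with h | h | h
  · exact Or.inl (triv h)
  · rcases contacts_related_of_le_four hY hX hD hXD hdis hsep hJ cl cr cr' with k | k | k
    · exact Or.inl (triv k)
    · exact Or.inr (Or.inl (triv' (h.symm.trans k)))
    · exact Or.inr (Or.inr (Or.inl (t.parallel_of_contactRel hsep hdis hN t' hN' hY hX h k)))
  · rcases contacts_related_of_le_four hY hX hD hXD hdis hsep hJ cl cr cr' with k | k | k
    · exact Or.inl (triv k)
    · have := (t.reverse hNd).parallel_of_contactRel hsep hdis hN t' hN' hY hX h k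
      rw [Trace.reverse_mor] at this
      exact Or.inr (Or.inr (Or.inr this))
    · exact Or.inr (Or.inl (triv' (h.symm.trans k)))

theorem Trace.of_le_two [Fintype ι] (hsep : Sep D) (hD : ∀ v, Conn (D v))
    (hXD : ∀ v, X (D v) = 6) {Y N : Finset (ℤ × ℤ)} (hY : Conn Y) (hX : X Y = 6)
    (hdis : ∀ v, Disjoint Y (D v)) (hJ : ∑ v, J Y (D v) ≤ 2)
    (t : R.Trace N) (hN : N ⊆ Y) : t.a = t.b ∧ R.InB t.a t.mor :=
  t.trivial_of_contactRel hsep hdis hN hY hX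
    (contacts_related_of_le_two hY hX hD hXD hdis hsep hJ (t.contact_left hsep hdis hN)
      (t.contact_right hsep hdis hN))

end Realization

end TriLattice

namespace TriLattice

open CategoryTheory

namespace Realization

variable {ι C : Type*} [Groupoid C] {D : ι → Finset (ℤ × ℤ)} (R : Realization C D)

/-- Over a region with trivial topology containing exactly one of the `D v`, morphisms can be
lifted so that lifts inside `D v` lie in `InB v`. -/
theorem exists_lift_around (hsep : Sep D) {Y : Finset (ℤ × ℤ)} {a : ι}
    (hY : Conn (Y ∪ D a)) (hX : X (Y ∪ D a) = 6) (hdis : ∀ v, Disjoint Y (D v)) {d : ℤ × ℤ}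
    (hd : d ∈ D a) (hdc : d ≠ R.center a) :
    ∃ p : ∀ u ∈ Y ∪ D a, u ≠ R.center a → (R.pt d ⟶ R.pt u),
      (∀ u hu hc, Adj (R.center a) u → R.InB a (p u hu hc)) ∧
      ∀ u hu hc v hv hc', Adj u v → ∃ α : R.pt d ⟶ R.pt d, R.InB a α ∧
        p v hv hc' = α ≫ p u hu hc ≫ R.seg u v := by
  have hid : R.InB a (𝟙 (R.pt d)) := by
    obtain ⟨f, hf⟩ := R.conn hd hd hdc hdc
    exact R.id_mem hf
  have good : ∀ u ∈ Y ∪ D a, u ≠ R.center a → ∀ v, u ≠ R.center v := by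
    intro u hu hc v h
    by_cases hva : v = a
    · subst hva; exact hc h
    · rcases Finset.mem_union.1 hu with h' | h'
      · exact not_mem_of_disjoint hdis h' v (h ▸ R.center_mem v)
      · exact Finset.disjoint_left.1 (hsep v a hva).1 (h ▸ R.center_mem v) h'
  have seg_mem : ∀ u v, Adj (R.center a) u → Adj (R.center a) v → Adj u v →
      R.InB a (R.seg u v) := fun u v hu hv huv =>
    R.seg_mem (R.inner _ _ hu) (R.inner _ _ hv) hu.ne.symm hv.ne.symm huv
  let valid : ℤ × ℤ → Option (Σ u, (R.pt d ⟶ R.pt u)) → Prop := fun u z =>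
    match z with
    | none => u = R.center a
    | some q => q.1 = u ∧ u ≠ R.center a
  let ρ : ℤ × ℤ → ℤ × ℤ → Option (Σ u, (R.pt d ⟶ R.pt u)) → Option (Σ u, (R.pt d ⟶ R.pt u)) →
      Prop := fun u v z z' =>
    match z, z' with
    | none, none => False
    | none, some q => u = R.center a ∧ q.1 = v ∧ v ≠ R.center a ∧ R.InB a q.2
    | some q, none => v = R.center a ∧ q.1 = u ∧ u ≠ R.center a ∧ R.InB a q.2
    | some q, some q' => q.1 = u ∧ q'.1 = v ∧ u ≠ R.center a ∧ v ≠ R.center a ∧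
        ∃ α : R.pt d ⟶ R.pt d, R.InB a α ∧ q'.2 = α ≫ q.2 ≫ R.seg q.1 q'.1
  obtain ⟨s, hs0, hs1, hs2⟩ := Conn.exists_section valid ρ hY hX
    (by
      rintro u hu v hv (_ | ⟨u', p⟩) (_ | ⟨v', p'⟩) huv h
      · exact h
      · exact h
      · exact h
      · obtain ⟨rfl, rfl, h1, h2, α, hα, h⟩ := h
        refine ⟨rfl, rfl, h2, h1, Groupoid.inv α, R.inv_mem hα, ?_⟩
        dsimp only at *
        rw [R.seg_symm huv (good _ hu h1) (good _ hv h2), h]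
        simp)
    (by
      rintro u hu v hv w hw huv hvw huw (_ | ⟨u', p⟩) (_ | ⟨v', p'⟩) (_ | ⟨w', p''⟩) h h'
      · exact h
      · exact h.elim
      · exact absurd (h.1.trans h'.1.symm) huw.ne
      · obtain ⟨rfl, rfl, h1, h2⟩ := h
        obtain ⟨_, rfl, h3, h4, α, hα, h⟩ := h'
        refine ⟨rfl, rfl, h4, ?_⟩
        dsimp only at *
        rw [h]
        exact R.comp_mem hα (R.comp_mem h2 (seg_mem _ _ huv huw hvw))
      · exact h'.elim
      · obtain ⟨rfl, rfl, h1, h2⟩ := h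
        obtain ⟨_, rfl, h3, h4⟩ := h'
        refine ⟨rfl, rfl, h1, h3, p'' ≫ Groupoid.inv (R.seg u' w') ≫ Groupoid.inv p, ?_, ?_⟩
        · exact R.comp_mem h4 (R.comp_mem (R.inv_mem (seg_mem _ _ huv.symm hvw huw))
            (R.inv_mem h2))
        · simp
      · obtain ⟨rfl, rfl, h1, h2, α, hα, h⟩ := h
        obtain ⟨rfl, _, h3, h4⟩ := h'
        refine ⟨rfl, rfl, h1, ?_⟩
        dsimp only at *
        have : p = Groupoid.inv α ≫ p' ≫ Groupoid.inv (R.seg u' v') := by rw [h]; simp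
        rw [this]
        exact R.comp_mem (R.inv_mem hα) (R.comp_mem h4 (R.inv_mem
          (seg_mem _ _ huw.symm hvw.symm huv)))
      · obtain ⟨rfl, rfl, h1, h2, α, hα, h⟩ := h
        obtain ⟨_, rfl, h3, h4, β, hβ, h'⟩ := h'
        refine ⟨rfl, rfl, h1, h4, β ≫ α, R.comp_mem hβ hα, ?_⟩
        dsimp only at *
        rw [← R.seg_tri huv hvw huw (good _ hu h1) (good _ hv h2) (good _ hw h4), h', h]
        simp)
    (Finset.mem_union_right _ (R.center_mem a)) (z := none) rfl
    (by
      rintro u hu v hv huv hvc (_ | ⟨u', p⟩) hval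
      · obtain rfl : u = R.center a := hval
        obtain ⟨f, hf⟩ := R.conn hd (R.inner _ _ huv) hdc hvc
        exact ⟨some ⟨v, f⟩, ⟨rfl, hvc⟩, rfl, rfl, hvc, hf⟩
      · obtain ⟨rfl, hc⟩ := hval
        exact ⟨some ⟨v, p ≫ R.seg _ v⟩, ⟨rfl, hvc⟩, rfl, rfl, hc, hvc, 𝟙 _, hid, by simp⟩)
  have hex : ∀ u (hu : u ∈ Y ∪ D a), u ≠ R.center a →
      ∃ p : R.pt d ⟶ R.pt u, s u = some ⟨u, p⟩ := by
    intro u hu hc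
    have := hs1 u hu
    generalize s u = z at this ⊢
    obtain (_ | ⟨u', p⟩) := z
    · exact absurd this hc
    · obtain ⟨rfl, _⟩ := this
      exact ⟨p, rfl⟩
  choose p hp using hex
  refine ⟨p, ?_, ?_⟩
  · intro u hu hc hcu
    have := hs2 _ (Finset.mem_union_right _ (R.center_mem a)) u hu hcu
    rw [hp u hu hc, hs0] at this
    exact this.2.2.2
  · intro u hu hc v hv hc' huv
    have := hs2 u hu v hv huv
    rw [hp u hu hc, hp v hv hc'] at this
    exact this.2.2.2.2

/-- A trace in an annular region without junctions is a trivial loop. -/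
theorem Trace.of_zero (hsep : Sep D) (hD : ∀ v, Conn (D v))
    (hXD : ∀ v, X (D v) = 6) {Y N : Finset (ℤ × ℤ)} (hY : Conn Y) (hX : X Y = 0)
    (hdis : ∀ v, Disjoint Y (D v)) (hJ : ∀ v, J Y (D v) = 0)
    (t : R.Trace N) (hN : N ⊆ Y) : t.a = t.b ∧ R.InB t.a t.mor := by
  have hu := hN t.walk.mem.1
  have hw := hN t.walk.mem.2
  have hconn : Conn (Y ∪ D t.a) := hY.union (hD _) ⟨_, hu, _, t.hd, Or.inr t.adj⟩
  have hXa : X (Y ∪ D t.a) = 6 := by rw [X_union (hdis _), hX, hXD, hJ]; rfl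
  have hab : t.a = t.b := by
    by_contra hne
    obtain ⟨hd1, hd2⟩ := hsep _ _ hne
    have hconn2 := hconn.union (hD t.b) ⟨_, Finset.mem_union_left _ hw, _, t.hd', Or.inr t.adj'⟩
    have hdis2 : Disjoint (Y ∪ D t.a) (D t.b) := Finset.disjoint_union_left.2 ⟨hdis _, hd1⟩
    have h := hconn2.X_le
    rw [X_union hdis2, hXa, hXD, J_comm, J_union_right (hdis _), J_comm _ Y, hJ, hd2.symm.J_eq,
      T_swap_right, hd2.symm.T_eq] at h
    norm_num at h
  refine ⟨hab, ?_⟩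
  have hdc : t.d ≠ R.center t.a := R.good_of_contact (not_mem_of_disjoint hdis hu) t.adj t.a
  have hdc' : t.d' ≠ R.center t.a := R.good_of_contact (not_mem_of_disjoint hdis hw) t.adj' t.a
  obtain ⟨p, hp1, hp2⟩ := R.exists_lift_around hsep hconn hXa hdis t.hd hdc
  have hYc : ∀ u ∈ Y, u ≠ R.center t.a := fun u hu =>
    R.good_of_not_mem (not_mem_of_disjoint hdis hu) t.a
  have hid : R.InB t.a (𝟙 (R.pt t.d)) := by
    obtain ⟨f, hf⟩ := R.conn t.hd t.hd hdc hdc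
    exact R.id_mem hf
  have hin : ∀ d (hd : d ∈ D t.a) hc, R.InB t.a (p d (Finset.mem_union_right _ hd) hc) := by
    have := (hD t.a).2 (fun d => ∀ (hd : d ∈ D t.a) hc,
      R.InB t.a (p d (Finset.mem_union_right _ hd) hc))
      ⟨R.center t.a, R.center_mem _, fun _ h => absurd rfl h⟩ (by
        intro u hu v hv huv h hv' hc
        by_cases huc : u = R.center t.a
        · subst huc; exact hp1 _ _ _ huv
        · obtain ⟨α, hα, e⟩ := hp2 u (Finset.mem_union_right _ hu) huc v
            (Finset.mem_union_right _ hv) hc huv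
          rw [e]
          exact R.comp_mem hα (R.comp_mem (h hu huc) (R.seg_mem hu hv huc hc huv)))
    exact fun d hd hc => this d hd hd hc
  have hdb : t.d' ∈ D t.a := hab ▸ t.hd'
  have i1 := hin t.d t.hd hdc
  have i2 := hin t.d' hdb hdc'
  obtain ⟨α, hα, e1⟩ := hp2 t.d (Finset.mem_union_right _ t.hd) hdc t.u
    (Finset.mem_union_left _ hu) (hYc _ hu) t.adj.symm
  obtain ⟨β, hβ, e2⟩ := hp2 t.w (Finset.mem_union_left _ hw) (hYc _ hw) t.d'
    (Finset.mem_union_right _ hdb) hdc' t.adj'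
  obtain ⟨γ, hγ, e3⟩ := R.lift_walk (p := fun u hu => p u (Finset.mem_union_left _ hu) (hYc u hu))
    hid (fun u hu v hv huv => hp2 _ _ _ _ _ _ huv) (t.walk.mono hN) hu hw
  rw [e3, e1] at e2
  have : t.mor = Groupoid.inv (p t.d (Finset.mem_union_right _ t.hd) hdc) ≫ Groupoid.inv α ≫
      Groupoid.inv γ ≫ Groupoid.inv β ≫ p t.d' (Finset.mem_union_right _ hdb) hdc' := by
    rw [e2, Trace.mor]; simp
  rw [this]
  exact R.comp_mem (R.inv_mem i1) (R.comp_mem (R.inv_mem hα) (R.comp_mem (R.inv_mem hγ)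
    (R.comp_mem (R.inv_mem hβ) i2)))

end Realization

end TriLattice

namespace TriLattice

open CategoryTheory

/-- A family of traces that are nontrivial and pairwise neither parallel nor reverse parallel has
at most three times as many members as there are regions. -/
theorem Realization.card_le_of_traces {ι ε C : Type*} [Fintype ι] [Fintype ε] [Groupoid C]
    {D : ι → Finset (ℤ × ℤ)} (R : Realization C D) {N : ε → Finset (ℤ × ℤ)}
    (hDc : ∀ v, Conn (D v)) (hDX : ∀ v, X (D v) = 6) (hDs : Sep D)
    (hNc : ∀ e, Conn (N e)) (hNs : Sep N) (hND : ∀ e v, Disjoint (N e) (D v))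
    (hT : ∀ e K C, (∀ u ∈ K, ∃ v, u ∈ D v) → Disjoint (N e) C → (∀ v, Disjoint (D v) C) →
      T (N e) K C ≤ 4)
    (t : ∀ e, R.Trace (N e)) (ht : ∀ e, (t e).a = (t e).b → ¬ R.InB (t e).a (t e).mor)
    (hpar : ∀ e e', e ≠ e' → (h : (t e).a = (t e').a) → (h' : (t e).b = (t e').b) →
      ∀ α β, R.InB (t e).a α → R.InB (t e).b β → (t e').mor ≠ α ≫ (t e).mor ≫ β)
    (hrev : ∀ e e', e ≠ e' → (h : (t e).b = (t e').a) → (h' : (t e).a = (t e').b) →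
      ∀ α β, R.InB (t e).b α → R.InB (t e).a β →
        (t e').mor ≠ α ≫ Groupoid.inv (t e).mor ≫ β) :
    Fintype.card ε ≤ 3 * Fintype.card ι := by
  refine card_le_of_regions hDc hDX hDs hNc hNs hND hT ?_ ?_ ?_
  · intro e Y hN hY hdis hX hJ
    obtain ⟨h1, h2⟩ := (t e).of_zero R hDs hDc hDX hY hX hdis hJ hN
    exact ht e h1 h2
  · intro e Y hN hY hdis hX hJ
    obtain ⟨h1, h2⟩ := (t e).of_le_two R hDs hDc hDX hY hX hdis hJ hN
    exact ht e h1 h2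
  · intro e e' hne Y hN hN' hY hdis hX hJ
    rcases (t e).of_le_four R hDs hDc hDX hY hX hdis hJ hN (t e') hN' with
      ⟨h1, h2⟩ | ⟨h1, h2⟩ | ⟨h1, h2, α, β, hα, hβ, h⟩ | ⟨h1, h2, α, β, hα, hβ, h⟩
    · exact ht e h1 h2
    · exact ht e' h1 h2
    · exact hpar e e' hne h1 h2 α β hα hβ h
    · exact hrev e e' hne h1 h2 α β hα hβ h

/-- The six neighbours of the origin, in cyclic order. -/
def nbr : Fin 6 → ℤ × ℤ := ![(1, 0), (0, 1), (-1, 1), (-1, 0), (0, -1), (1, -1)]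

theorem nbr_injective : Function.Injective nbr := by decide

theorem exists_nbr {u v : ℤ × ℤ} (h : Adj u v) : ∃ i, v = u + nbr i := by
  obtain ⟨h1, h2, h3, h4⟩ := h
  obtain ⟨x, y⟩ := u
  obtain ⟨x', y'⟩ := v
  dsimp only at *
  have hx : x' - x = -1 ∨ x' - x = 0 ∨ x' - x = 1 := by omega
  have hy : y' - y = -1 ∨ y' - y = 0 ∨ y' - y = 1 := by omega
  have key : ∃ i, (x' - x, y' - y) = nbr i := by
    rcases hx with hx | hx | hx <;> rcases hy with hy | hy | hy <;> rw [hx, hy] <;>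
      first | decide | omega
  obtain ⟨i, hi⟩ := key
  exact ⟨i, by rw [← hi]; ext <;> simp⟩

theorem ind_add (z u v : ℤ × ℤ) : ind (z + u) (z + v) = ind u v := by
  have : Adj (z + u) (z + v) ↔ Adj u v := by
    unfold Adj; simp only [Prod.fst_add, Prod.snd_add]; omega
  simp only [ind, this]

theorem sum_le_sum_nbr (z : ℤ × ℤ) (K : Finset (ℤ × ℤ)) (p : ℤ × ℤ → Prop) [DecidablePred p]
    (hK : ∀ u ∈ K, Adj z u → p u) (f : ℤ × ℤ → ℤ) (hf : ∀ u, 0 ≤ f u)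
    (hf0 : ∀ u, ¬ Adj z u → f u = 0) :
    ∑ u ∈ K, f u ≤ ∑ i, if p (z + nbr i) then f (z + nbr i) else 0 := by
  have h1 : ∑ u ∈ K, f u = ∑ u ∈ K with Adj z u, f u := by
    rw [Finset.sum_filter]
    exact Finset.sum_congr rfl fun u _ => by split_ifs with h; rfl; exact hf0 u h
  have h2 : ∑ i, (if p (z + nbr i) then f (z + nbr i) else 0) =
      ∑ u ∈ Finset.univ.image fun i => z + nbr i, if p u then f u else 0 := by
    rw [Finset.sum_image fun i _ j _ h => nbr_injective (add_left_cancel h)]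
  rw [h1, h2, ← Finset.sum_filter]
  refine Finset.sum_le_sum_of_subset_of_nonneg (fun u hu => ?_) fun u _ _ => hf u
  rw [Finset.mem_filter] at hu ⊢
  obtain ⟨i, rfl⟩ := exists_nbr hu.2
  exact ⟨Finset.mem_image_of_mem _ (Finset.mem_univ i), hK _ hu.1 hu.2⟩

theorem T_singleton_box_le {a b c d : ℤ} (hab : a + 2 ≤ b) (hcd : c + 2 ≤ d) {z : ℤ × ℤ}
    (hz : z ∉ box a b c d) {K C : Finset (ℤ × ℤ)} (hK : ∀ u ∈ K, Adj z u → u ∈ box a b c d)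
    (hC : ∀ u ∈ C, u ∉ box a b c d) : T {z} K C ≤ 2 := by
  have hpos : ∀ u v w, 0 ≤ ind u v * ind v w * ind u w := fun u v w =>
    mul_nonneg (mul_nonneg (ind_nonneg _ _) (ind_nonneg _ _)) (ind_nonneg _ _)
  rw [T, Finset.sum_singleton]
  refine (sum_le_sum_nbr z K (· ∈ box a b c d) hK _ (fun u => Finset.sum_nonneg fun w _ =>
    hpos z u w) fun u h => by simp [ind_of_not_adj h]).trans ?_
  have h2 : ∀ v, ∑ w ∈ C, ind z v * ind v w * ind z w ≤ ∑ i, if z + nbr i ∉ box a b c d then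
      ind z v * ind v (z + nbr i) * ind z (z + nbr i) else 0 := fun v =>
    sum_le_sum_nbr z C (· ∉ box a b c d) (fun u hu _ => hC u hu) _ (hpos z v)
      fun u h => by simp [ind_of_not_adj h]
  have hz0 : ∀ i, ind z (z + nbr i) = 1 := fun i => by
    have := ind_add z 0 (nbr i)
    rw [add_zero] at this
    rw [this]
    clear this h2
    revert i
    decide
  refine (Finset.sum_le_sum fun i _ => show _ ≤ if z + nbr i ∈ box a b c d then
    ∑ j, (if z + nbr j ∉ box a b c d then ind (nbr i) (nbr j) else 0) else 0 from ?_).trans ?_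
  · split_ifs
    · refine (h2 _).trans (le_of_eq (Finset.sum_congr rfl fun j _ => ?_))
      simp only [hz0, ind_add, one_mul, mul_one]
    · exact le_rfl
  have e : ∀ i j, ind (nbr i) (nbr j) = if j = i + 1 ∨ j = i - 1 then 1 else 0 := by decide
  simp only [e, Fin.sum_univ_six]
  obtain ⟨x, y⟩ := z
  have m0 : ((x, y) + nbr 0 ∈ box a b c d) ↔ ((a ≤ x + 1 ∧ x + 1 ≤ b) ∧ (c ≤ y ∧ y ≤ d)) := by
    rw [mem_box]; simp [nbr]; try omega
  have m1 : ((x, y) + nbr 1 ∈ box a b c d) ↔ ((a ≤ x ∧ x ≤ b) ∧ (c ≤ y + 1 ∧ y + 1 ≤ d)) := by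
    rw [mem_box]; simp [nbr]; try omega
  have m2 : ((x, y) + nbr 2 ∈ box a b c d) ↔
      ((a ≤ x - 1 ∧ x - 1 ≤ b) ∧ (c ≤ y + 1 ∧ y + 1 ≤ d)) := by
    rw [mem_box]; simp [nbr]; try omega
  have m3 : ((x, y) + nbr 3 ∈ box a b c d) ↔ ((a ≤ x - 1 ∧ x - 1 ≤ b) ∧ (c ≤ y ∧ y ≤ d)) := by
    rw [mem_box]; simp [nbr]; try omega
  have m4 : ((x, y) + nbr 4 ∈ box a b c d) ↔ ((a ≤ x ∧ x ≤ b) ∧ (c ≤ y - 1 ∧ y - 1 ≤ d)) := by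
    rw [mem_box]; simp [nbr]; try omega
  have m5 : ((x, y) + nbr 5 ∈ box a b c d) ↔
      ((a ≤ x + 1 ∧ x + 1 ≤ b) ∧ (c ≤ y - 1 ∧ y - 1 ≤ d)) := by
    rw [mem_box]; simp [nbr]; try omega
  rw [mem_box] at hz
  by_cases p0 : (x, y) + nbr 0 ∈ box a b c d <;> by_cases p1 : (x, y) + nbr 1 ∈ box a b c d <;>
  by_cases p2 : (x, y) + nbr 2 ∈ box a b c d <;> by_cases p3 : (x, y) + nbr 3 ∈ box a b c d <;>
  by_cases p4 : (x, y) + nbr 4 ∈ box a b c d <;> by_cases p5 : (x, y) + nbr 5 ∈ box a b c d <;>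
  first
  | (exfalso
     simp only [p0, p1, p2, p3, p4, p5, true_iff, false_iff] at m0 m1 m2 m3 m4 m5
     omega)
  | (simp only [p0, p1, p2, p3, p4, p5, not_true_eq_false, not_false_eq_true, if_true, if_false]
     decide)

/-- If all cells of `N` adjacent to one of the boxes lie in `{z, z'}`, then `N` meets few triangles
with one vertex in the boxes and one vertex outside. -/
theorem T_le_four_of_contacts {ι : Type*} {D : ι → Finset (ℤ × ℤ)}
    (hD : ∀ v, ∃ a b c d, a + 2 ≤ b ∧ c + 2 ≤ d ∧ D v = box a b c d) {N : Finset (ℤ × ℤ)}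
    (hND : ∀ v, Disjoint N (D v)) {z z' : ℤ × ℤ} {a b : ι}
    (hz : ∀ u ∈ N, ∀ v, ∀ d ∈ D v, Adj u d → (u = z ∧ v = a) ∨ (u = z' ∧ v = b))
    {K C : Finset (ℤ × ℤ)} (hK : ∀ u ∈ K, ∃ v, u ∈ D v) (hC : ∀ v, Disjoint (D v) C)
    (hza : ∀ v, ∀ d ∈ D v, Adj z d → v = a) (hzb : ∀ v, ∀ d ∈ D v, Adj z' d → v = b) :
    T N K C ≤ 4 := by
  have hsing : ∀ (w : ℤ × ℤ) (v₀ : ι), w ∈ N → (∀ v, ∀ d ∈ D v, Adj w d → v = v₀) →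
      T {w} K C ≤ 2 := by
    intro w v₀ hw h
    obtain ⟨x, y, x', y', h1, h2, e⟩ := hD v₀
    refine T_singleton_box_le h1 h2 (e ▸ Finset.disjoint_left.1 (hND v₀) hw) (fun u hu huw => ?_)
      fun u hu hu' => Finset.disjoint_left.1 (hC v₀) (e ▸ hu') hu
    obtain ⟨v, hv⟩ := hK u hu
    obtain rfl := h v u hv huw
    exact e ▸ hv
  have hT : T N K C = ∑ w ∈ N, T {w} K C := by
    unfold T; exact Finset.sum_congr rfl fun w _ => by rw [Finset.sum_singleton]
  have hzero : ∀ w ∈ N, w ∉ ({z, z'} : Finset (ℤ × ℤ)) → T {w} K C = 0 := by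
    intro w hw h
    unfold T
    rw [Finset.sum_singleton]
    refine Finset.sum_eq_zero fun u hu => Finset.sum_eq_zero fun x _ => ?_
    obtain ⟨v, hv⟩ := hK u hu
    rw [ind_of_not_adj (u := w) (v := u), zero_mul, zero_mul]
    intro hadj
    rcases hz w hw v u hv hadj with ⟨rfl, _⟩ | ⟨rfl, _⟩ <;> simp at h
  have hle : ∀ w ∈ N, T {w} K C ≤ if w ∈ ({z, z'} : Finset (ℤ × ℤ)) then 2 else 0 := by
    intro w hw
    split_ifs with h
    · rcases Finset.mem_insert.1 h with rfl | h
      · exact hsing w a hw hza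
      · obtain rfl := Finset.mem_singleton.1 h
        exact hsing w b hw hzb
    · exact (hzero w hw h).le
  rw [hT]
  refine (Finset.sum_le_sum hle).trans ?_
  rw [← Finset.sum_filter, Finset.sum_const, nsmul_eq_mul]
  have h1 : (N.filter (· ∈ ({z, z'} : Finset (ℤ × ℤ)))).card ≤ 2 :=
    (Finset.card_le_card fun w hw => (Finset.mem_filter.1 hw).2).trans Finset.card_le_two
  have : ((N.filter (· ∈ ({z, z'} : Finset (ℤ × ℤ)))).card : ℤ) ≤ 2 := by exact_mod_cast h1
  linarith

end TriLattice

namespace PlaneCurve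

/-- A continuous curve whose interior avoids `V`. -/
structure IsEdge (V : Set ℂ) (f : I → ℂ) : Prop where
  cont : Continuous f
  interior : ∀ t : I, t ≠ 0 → t ≠ 1 → f t ∉ V

variable {V : Set ℂ}

theorem symm_ne_zero {t : I} (h : t ≠ 1) : σ t ≠ 0 := fun h' => h (by
  have := congrArg σ h'; simpa using this)

theorem symm_ne_one {t : I} (h : t ≠ 0) : σ t ≠ 1 := fun h' => h (by
  have := congrArg σ h'; simpa using this)

theorem _root_.HomotopicIn.symm {f f' : I → ℂ} (h : HomotopicIn V f f') : HomotopicIn V f' f := by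
  obtain ⟨g, hg, h0, h1, h2, h3, h4⟩ := h
  refine ⟨fun p => g (σ p.1, p.2), by fun_prop, ?_, ?_, ?_, ?_, ?_⟩
  · simpa using h1
  · simpa using h0
  · intro s
    simp only [h2, ← h1]
  · intro s
    simp only [h3, ← h1]
  · intro s t hs hs' ht ht'
    exact h4 _ _ (symm_ne_zero hs') (symm_ne_one hs) ht ht'

theorem _root_.HomotopicIn.trans {f f' f'' : I → ℂ} (h : HomotopicIn V f f')
    (hf : IsEdge V f') (h' : HomotopicIn V f' f'') : HomotopicIn V f f'' := by
  obtain ⟨g, hg, h0, h1, h2, h3, h4⟩ := h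
  obtain ⟨g', hg', h0', h1', h2', h3', h4'⟩ := h'
  have e0 : f' 0 = f 0 := by rw [← h1, h2]
  have e1 : f' 1 = f 1 := by rw [← h1, h3]
  have hP : ∀ x : ℝ, x = 1 / 2 → Set.projIcc (0 : ℝ) 1 zero_le_one (2 * x) = 1 := by
    rintro x rfl; norm_num
  have hP' : ∀ x : ℝ, x = 1 / 2 → Set.projIcc (0 : ℝ) 1 zero_le_one (2 * x - 1) = 0 := by
    rintro x rfl; norm_num
  refine ⟨fun p => if (p.1 : ℝ) ≤ 1 / 2 then g (Set.projIcc 0 1 zero_le_one (2 * p.1), p.2)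
    else g' (Set.projIcc 0 1 zero_le_one (2 * p.1 - 1), p.2), ?_, ?_, ?_, ?_, ?_, ?_⟩
  · refine Continuous.if_le ?_ ?_ (by fun_prop) continuous_const ?_
    · exact hg.comp ((continuous_projIcc.comp (by fun_prop)).prodMk continuous_snd)
    · exact hg'.comp ((continuous_projIcc.comp (by fun_prop)).prodMk continuous_snd)
    · intro p hp
      rw [hP _ hp, hP' _ hp, h1, h0']
  · intro t; simp [h0]
  · intro t; norm_num [h1']
  · intro s; dsimp only; split_ifs <;> simp [h2, h2', e0]
  · intro s; dsimp only; split_ifs <;> simp [h3, h3', e1]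
  · intro s t hs hs' ht ht'
    have hs0 : 0 < (s : ℝ) := unitInterval.pos_iff_ne_zero.2 hs
    have hs1 : (s : ℝ) < 1 := unitInterval.lt_one_iff_ne_one.2 hs'
    dsimp only
    rcases lt_trichotomy (s : ℝ) (1 / 2) with h | h | h
    · rw [if_pos h.le]
      refine h4 _ _ (fun h0 => ?_) (fun h0 => ?_) ht ht'
      · rw [Set.projIcc_of_mem _
          (⟨by linarith, by linarith⟩ : 2 * (s : ℝ) ∈ Set.Icc (0 : ℝ) 1)] at h0
        have := congrArg Subtype.val h0
        simp at this
        exact hs this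
      · rw [Set.projIcc_of_mem _
          (⟨by linarith, by linarith⟩ : 2 * (s : ℝ) ∈ Set.Icc (0 : ℝ) 1)] at h0
        have := congrArg Subtype.val h0
        simp at this
        linarith
    · rw [if_pos h.le, hP _ h, h1]
      exact hf.interior t ht ht'
    · rw [if_neg (not_le.2 h)]
      refine h4' _ _ (fun h0 => ?_) (fun h0 => ?_) ht ht'
      · rw [Set.projIcc_of_mem _
          (⟨by linarith, by linarith⟩ : 2 * (s : ℝ) - 1 ∈ Set.Icc (0 : ℝ) 1)] at h0
        have := congrArg Subtype.val h0
        simp at this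
        linarith
      · rw [Set.projIcc_of_mem _
          (⟨by linarith, by linarith⟩ : 2 * (s : ℝ) - 1 ∈ Set.Icc (0 : ℝ) 1)] at h0
        have := congrArg Subtype.val h0
        simp at this
        linarith

theorem _root_.HomotopicIn.reverse {f f' : I → ℂ} (h : HomotopicIn V f f') :
    HomotopicIn V (fun t => f (σ t)) (fun t => f' (σ t)) := by
  obtain ⟨g, hg, h0, h1, h2, h3, h4⟩ := h
  refine ⟨fun p => g (p.1, σ p.2), by fun_prop, fun t => h0 _, fun t => h1 _, ?_, ?_, ?_⟩
  · simpa using h3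
  · simpa using h2
  · intro s t hs hs' ht ht'
    exact h4 _ _ hs hs' (symm_ne_zero ht') (symm_ne_one ht)

/-- Reparametrizations are homotopies. -/
theorem IsEdge.reparam {f : I → ℂ} (h : IsEdge V f) {φ : I → I} (hφ : Continuous φ)
    (h0 : φ 0 = 0) (h1 : φ 1 = 1) : HomotopicIn V f (fun t => f (φ t)) := by
  have hmem : ∀ s t : I, (1 - (s : ℝ)) * t + s * φ t ∈ Set.Icc (0 : ℝ) 1 := fun s t => by
    have := s.2.1; have := s.2.2; have := t.2.1; have := t.2.2
    have := (φ t).2.1; have := (φ t).2.2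
    constructor <;> nlinarith
  refine ⟨fun p => f ⟨_, hmem p.1 p.2⟩, h.cont.comp (by fun_prop), ?_, ?_, ?_, ?_, ?_⟩
  · intro t; simp
  · intro t; simp
  · intro s; simp [h0]
  · intro s; simp only [h1]; congr 1; ext; simp
  · intro s t hs hs' ht ht'
    have hs0 : 0 < (s : ℝ) := unitInterval.pos_iff_ne_zero.2 hs
    have hs1 : (s : ℝ) < 1 := unitInterval.lt_one_iff_ne_one.2 hs'
    have ht0 : 0 < (t : ℝ) := unitInterval.pos_iff_ne_zero.2 ht
    have ht1 : (t : ℝ) < 1 := unitInterval.lt_one_iff_ne_one.2 ht'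
    have := (φ t).2.1; have := (φ t).2.2
    refine h.interior _ (fun h => ?_) (fun h => ?_)
    · have := congrArg Subtype.val h
      simp only [Set.Icc.coe_zero] at this
      nlinarith
    · have := congrArg Subtype.val h
      simp only [Set.Icc.coe_one] at this
      nlinarith

/-- The curve obtained from `F` by replacing its initial part up to time `τ` by a segment. -/
noncomputable def straighten (a : ℂ) (τ : ℝ) (f : I → ℂ) (t : I) : ℂ :=
  a + ((t / max (t : ℝ) τ : ℝ) : ℂ) * (Set.IccExtend zero_le_one f (max t τ) - a)

theorem IsEdge.straighten {f : I → ℂ} (h : IsEdge V f) {a : ℂ} {ρ : ℝ} (ha : f 0 = a) (haV : a ∈ V)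
    (hρ : ∀ z ∈ V, dist z a < ρ → z = a) {τ : ℝ} (h0 : 0 < τ) (h1 : τ < 1)
    (hτ : ∀ t : I, (t : ℝ) ≤ τ → dist (f t) a < ρ) :
    HomotopicIn V f (straighten a τ f) ∧ IsEdge V (straighten a τ f) := by
  set F := Set.IccExtend (zero_le_one' ℝ) f with hF
  have hFc : Continuous F := h.cont.Icc_extend'
  have hF0 : F 0 = a := by rw [hF, Set.IccExtend_of_mem _ _ (by simp)]; exact ha
  have hFt : ∀ t : I, F t = f t := fun t => Set.IccExtend_val _ _ _
  let g : I × I → ℂ := fun p => a + ((p.2 / max (p.2 : ℝ) (p.1 * τ) : ℝ) : ℂ) *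
    (F (max p.2 (p.1 * τ)) - a)
  have hgt : ∀ s t : I, (s : ℝ) * τ ≤ t → g (s, t) = f t := by
    intro s t hst
    simp only [g, max_eq_left hst, hFt]
    by_cases ht : (t : ℝ) = 0
    · have : t = 0 := Subtype.ext ht
      subst this
      simp [ha]
    · rw [div_self ht]; simp
  have hgc : Continuous g := by
    rw [continuous_iff_continuousAt]
    rintro ⟨s, t⟩
    by_cases hm : max (t : ℝ) (s * τ) = 0
    · have ht : (t : ℝ) = 0 := le_antisymm ((le_max_left _ _).trans hm.le) t.2.1
      have hga : g (s, t) = a := by simp [g, ht]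
      rw [ContinuousAt, hga, tendsto_iff_norm_sub_tendsto_zero]
      have hlim : Filter.Tendsto (fun p : I × I => ‖F (max p.2 (p.1 * τ)) - a‖)
          (nhds (s, t)) (nhds 0) := by
        have : Continuous fun p : I × I => ‖F (max p.2 (p.1 * τ)) - a‖ := by fun_prop
        convert this.tendsto (s, t)
        simp [hm, hF0]
      refine squeeze_zero (fun _ => norm_nonneg _) (fun p => ?_) hlim
      have hc : ‖((p.2 / max (p.2 : ℝ) (p.1 * τ) : ℝ) : ℂ)‖ ≤ 1 := by
        rw [Complex.norm_real, Real.norm_of_nonneg (div_nonneg p.2.2.1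
          (p.2.2.1.trans (le_max_left _ _)))]
        exact div_le_one_of_le₀ (le_max_left _ _) (p.2.2.1.trans (le_max_left _ _))
      simp only [g, add_sub_cancel_left, norm_mul]
      exact mul_le_of_le_one_left (norm_nonneg _) hc
    · refine ContinuousAt.add continuousAt_const (ContinuousAt.mul ?_ ?_)
      · refine Complex.continuous_ofReal.continuousAt.comp (ContinuousAt.div (by fun_prop)
          (by fun_prop) hm)
      · have : Continuous fun p : I × I => F (max p.2 (p.1 * τ)) - a := by fun_prop
        exact this.continuousAt
  have hint : ∀ s t : I, s ≠ 0 → t ≠ 0 → t ≠ 1 → g (s, t) ∉ V := by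
    intro s t hs ht ht'
    have hs0 : 0 < (s : ℝ) := unitInterval.pos_iff_ne_zero.2 hs
    have hs1 : (s : ℝ) ≤ 1 := s.2.2
    have ht0 : 0 < (t : ℝ) := unitInterval.pos_iff_ne_zero.2 ht
    rcases le_or_gt ((s : ℝ) * τ) t with hst | hst
    · rw [hgt s t hst]; exact h.interior t ht ht'
    · have hm0 : 0 < (s : ℝ) * τ := mul_pos hs0 h0
      have hm1 : (s : ℝ) * τ ≤ τ := by nlinarith
      let m : I := ⟨s * τ, hm0.le, hm1.trans h1.le⟩
      have hFm : F (s * τ) = f m := hFt m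
      have hmV : f m ∉ V := h.interior m (fun h => hm0.ne' (congrArg Subtype.val h))
        (fun h => (hm1.trans_lt h1).ne (congrArg Subtype.val h))
      have hmd : dist (f m) a < ρ := hτ m hm1
      have hne : f m - a ≠ 0 := fun h => hmV (by rw [sub_eq_zero.1 h]; exact haV)
      have hc0 : 0 < (t : ℝ) / (s * τ) := div_pos ht0 hm0
      have hc1 : (t : ℝ) / (s * τ) < 1 := (div_lt_one hm0).2 hst
      simp only [g, max_eq_right hst.le, hFm]
      intro hV
      have := hρ _ hV (by
        rw [dist_eq_norm, add_sub_cancel_left, norm_mul, Complex.norm_real,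
          Real.norm_of_nonneg hc0.le, ← dist_eq_norm]
        exact (mul_le_of_le_one_left dist_nonneg hc1.le).trans_lt hmd)
      rw [add_eq_left, mul_eq_zero] at this
      rcases this with h | h
      · exact hc0.ne' (Complex.ofReal_eq_zero.1 h)
      · exact hne h
  have hg1 : ∀ t, g (1, t) = PlaneCurve.straighten a τ f t := by
    intro t; simp [g, PlaneCurve.straighten, hF]
  refine ⟨⟨g, hgc, ?_, ?_, ?_, ?_, fun s t hs _ ht ht' => hint s t hs ht ht'⟩, ?_, ?_⟩
  · intro t; exact hgt 0 t (by simpa using t.2.1)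
  · exact hg1
  · intro s; simp [g, ha]
  · intro s; exact hgt s 1 (by
      have := s.2.1; have := s.2.2
      simp only [Set.Icc.coe_one]; nlinarith)
  · have : PlaneCurve.straighten a τ f = fun t => g (1, t) := funext fun t => (hg1 t).symm
    rw [this]
    exact hgc.comp (by fun_prop)
  · intro t ht ht'
    rw [← hg1]
    exact hint 1 t one_ne_zero ht ht'

theorem straighten_of_le (a : ℂ) {τ : ℝ} (f : I → ℂ) {t : I} (h : (t : ℝ) ≤ τ) :
    straighten a τ f t = a + ((t / τ : ℝ) : ℂ) * (Set.IccExtend zero_le_one f τ - a) := by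
  rw [straighten, max_eq_right h]

theorem straighten_of_ge (a : ℂ) {τ : ℝ} (hτ : 0 < τ) (f : I → ℂ) {t : I} (h : τ ≤ t) :
    straighten a τ f t = f t := by
  rw [straighten, max_eq_left h, div_self (hτ.trans_le h).ne', Set.IccExtend_val]
  simp

theorem IsEdge.reverse {f : I → ℂ} (h : IsEdge V f) : IsEdge V fun t => f (σ t) :=
  ⟨h.cont.comp (by fun_prop), fun t ht ht' => h.interior _ (symm_ne_zero ht') (symm_ne_one ht)⟩

end PlaneCurve

namespace PlaneCurve

variable {V : Set ℂ}

/-- The curve following `q` during the middle third, preceded and followed by segments from `a`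
and to `b`. -/
noncomputable def hat (a b : ℂ) (q : I → ℂ) (t : I) : ℂ :=
  Set.IccExtend zero_le_one q (3 * (t : ℝ) - 1) - ((max 0 (1 - 3 * (t : ℝ)) : ℝ) : ℂ) * (q 0 - a) -
    ((max 0 (3 * (t : ℝ) - 2) : ℝ) : ℂ) * (q 1 - b)

theorem hat_of_le (a b : ℂ) (q : I → ℂ) {t : I} (h : (t : ℝ) ≤ 1 / 3) :
    hat a b q t = a + ((3 * t : ℝ) : ℂ) * (q 0 - a) := by
  rw [hat, Set.IccExtend_of_le_left _ _ (by linarith), max_eq_right (by linarith),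
    max_eq_left (by linarith)]
  push_cast
  change q 0 - _ - _ = _
  ring

theorem hat_of_mem (a b : ℂ) (q : I → ℂ) {t : I} (h : 1 / 3 ≤ (t : ℝ)) (h' : (t : ℝ) ≤ 2 / 3) :
    hat a b q t = q ⟨3 * t - 1, by linarith, by linarith⟩ := by
  rw [hat, Set.IccExtend_of_mem _ _ ⟨by linarith, by linarith⟩, max_eq_left (by linarith),
    max_eq_left (by linarith)]
  simp

theorem hat_of_ge (a b : ℂ) (q : I → ℂ) {t : I} (h : 2 / 3 ≤ (t : ℝ)) :
    hat a b q t = b + ((3 * (1 - t) : ℝ) : ℂ) * (q 1 - b) := by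
  rw [hat, Set.IccExtend_of_right_le _ _ (by linarith), max_eq_left (by linarith),
    max_eq_right (by linarith)]
  push_cast
  change q 1 - _ - _ = _
  ring

theorem hat_zero (a b : ℂ) (q : I → ℂ) : hat a b q 0 = a := by
  rw [hat_of_le _ _ _ (by norm_num)]; simp

theorem hat_one (a b : ℂ) (q : I → ℂ) : hat a b q 1 = b := by
  rw [hat_of_ge _ _ _ (by norm_num)]; simp

theorem hat_symm (a b : ℂ) (q : I → ℂ) (t : I) :
    hat a b q (σ t) = hat b a (fun r => q (σ r)) t := by
  have h0 : (σ t : ℝ) = 1 - t := rfl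
  rcases le_total (t : ℝ) (1 / 3) with h | h
  · rw [hat_of_ge _ _ _ (by rw [h0]; linarith), hat_of_le _ _ _ h, h0]; simp
  rcases le_total (t : ℝ) (2 / 3) with h' | h'
  · rw [hat_of_mem _ _ _ (by rw [h0]; linarith) (by rw [h0]; linarith), hat_of_mem _ _ _ h h']
    congr 1; ext; simp; ring
  · rw [hat_of_le _ _ _ (by rw [h0]; linarith), hat_of_ge _ _ _ h', h0]; simp

theorem continuous_hat (a b : ℂ) {q : I → ℂ} (hq : Continuous q) : Continuous (hat a b q) := by
  have := hq.Icc_extend' (h := zero_le_one' ℝ)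
  unfold hat
  fun_prop

/-- Points of a segment from `a` inside a ball containing no other point of `V`. -/
theorem segment_not_mem {a : ℂ} {ρ : ℝ} (haV : a ∈ V) (hρ : ∀ z ∈ V, dist z a < ρ → z = a)
    {x : ℂ} (hx : x ∉ V) (hxa : dist x a < ρ) {c : ℝ} (h0 : 0 < c) (h1 : c ≤ 1) :
    a + (c : ℂ) * (x - a) ∉ V := by
  intro hV
  have hne : x - a ≠ 0 := fun h => hx (by rw [sub_eq_zero.1 h]; exact haV)
  have := hρ _ hV (by
    rw [dist_eq_norm, add_sub_cancel_left, norm_mul, Complex.norm_real,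
      Real.norm_of_nonneg h0.le, ← dist_eq_norm]
    exact (mul_le_of_le_one_left dist_nonneg h1).trans_lt hxa)
  rw [add_eq_left, mul_eq_zero] at this
  rcases this with h | h
  · exact h0.ne' (Complex.ofReal_eq_zero.1 h)
  · exact hne h

theorem hat_not_mem {a b : ℂ} {ρ : ℝ} (haV : a ∈ V) (hbV : b ∈ V)
    (hρa : ∀ z ∈ V, dist z a < ρ → z = a) (hρb : ∀ z ∈ V, dist z b < ρ → z = b) {q : I → ℂ}
    (hq : ∀ t, q t ∉ V) (h0 : dist (q 0) a < ρ) (h1 : dist (q 1) b < ρ) {t : I}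
    (ht : t ≠ 0) (ht' : t ≠ 1) : hat a b q t ∉ V := by
  have ht0 : 0 < (t : ℝ) := unitInterval.pos_iff_ne_zero.2 ht
  have ht1 : (t : ℝ) < 1 := unitInterval.lt_one_iff_ne_one.2 ht'
  rcases le_total (t : ℝ) (1 / 3) with h | h
  · rw [hat_of_le _ _ _ h]
    exact segment_not_mem haV hρa (hq 0) h0 (by linarith) (by linarith)
  rcases le_total (t : ℝ) (2 / 3) with h' | h'
  · rw [hat_of_mem _ _ _ h h']; exact hq _
  · rw [hat_of_ge _ _ _ h']
    exact segment_not_mem hbV hρb (hq 1) h1 (by linarith) (by linarith)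

theorem isEdge_hat {a b : ℂ} {ρ : ℝ} (haV : a ∈ V) (hbV : b ∈ V)
    (hρa : ∀ z ∈ V, dist z a < ρ → z = a) (hρb : ∀ z ∈ V, dist z b < ρ → z = b) {q : I → ℂ}
    (hqc : Continuous q)
    (hq : ∀ t, q t ∉ V) (h0 : dist (q 0) a < ρ) (h1 : dist (q 1) b < ρ) : IsEdge V (hat a b q) :=
  ⟨continuous_hat a b hqc, fun _ => hat_not_mem haV hbV hρa hρb hq h0 h1⟩

/-- An edge is homotopic to the edge following one of its middle parts, provided the rest stays
near the end points. -/
theorem IsEdge.hat {f : I → ℂ} (h : IsEdge V f) {a b : ℂ} {ρ : ℝ} (ha : f 0 = a) (hb : f 1 = b)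
    (haV : a ∈ V) (hbV : b ∈ V) (hρa : ∀ z ∈ V, dist z a < ρ → z = a)
    (hρb : ∀ z ∈ V, dist z b < ρ → z = b) {τ₁ τ₂ : ℝ} (h0 : 0 < τ₁) (h12 : τ₁ ≤ τ₂) (h1 : τ₂ < 1)
    (hτ₁ : ∀ t : I, (t : ℝ) ≤ τ₁ → dist (f t) a < ρ)
    (hτ₂ : ∀ t : I, τ₂ ≤ (t : ℝ) → dist (f t) b < ρ) {q : I → ℂ}
    (hq : ∀ r : I, q r = Set.IccExtend zero_le_one f (τ₁ + r * (τ₂ - τ₁))) :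
    HomotopicIn V f (hat a b q) := by
  set F := Set.IccExtend (zero_le_one' ℝ) f with hF
  have hFt : ∀ t : I, F t = f t := fun t => Set.IccExtend_val _ _ _
  let φ₀ : ℝ → ℝ := fun t => τ₁ * max 0 (min 1 (3 * t)) + (τ₂ - τ₁) * max 0 (min 1 (3 * t - 1)) +
    (1 - τ₂) * max 0 (min 1 (3 * t - 2))
  have φ1 : ∀ t : ℝ, 0 ≤ t → t ≤ 1 / 3 → φ₀ t = τ₁ * (3 * t) := by
    intro t ht ht'
    simp only [φ₀]
    rw [min_eq_right (by linarith), max_eq_right (by linarith), max_eq_left (a := (0 : ℝ))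
      (b := min 1 (3 * t - 1)) (min_le_of_right_le (by linarith)), max_eq_left (a := (0 : ℝ))
      (b := min 1 (3 * t - 2)) (min_le_of_right_le (by linarith))]
    ring
  have φ2 : ∀ t : ℝ, 1 / 3 ≤ t → t ≤ 2 / 3 → φ₀ t = τ₁ + (3 * t - 1) * (τ₂ - τ₁) := by
    intro t ht ht'
    simp only [φ₀]
    rw [min_eq_left (by linarith), min_eq_right (by linarith : 3 * t - 1 ≤ 1),
      max_eq_right (by linarith), max_eq_right (by linarith), max_eq_left (a := (0 : ℝ))
      (b := min 1 (3 * t - 2)) (min_le_of_right_le (by linarith))]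
    ring
  have φ3 : ∀ t : ℝ, 2 / 3 ≤ t → t ≤ 1 → φ₀ t = 1 - 3 * (1 - τ₂) * (1 - t) := by
    intro t ht ht'
    simp only [φ₀]
    rw [min_eq_left (by linarith), min_eq_left (by linarith : 1 ≤ 3 * t - 1),
      min_eq_right (by linarith : 3 * t - 2 ≤ 1),
      max_eq_right (by linarith), max_eq_right (by linarith)]
    ring
  have hφmem : ∀ t : ℝ, 0 < t → t < 1 → 0 < φ₀ t ∧ φ₀ t < 1 := by
    intro t ht ht'
    rcases le_total t (1 / 3) with h | h
    · rw [φ1 t ht.le h]; constructor <;> nlinarith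
    rcases le_total t (2 / 3) with h' | h'
    · rw [φ2 t h h']; constructor <;> nlinarith
    · rw [φ3 t h' ht'.le]; constructor <;> nlinarith
  have e0 : φ₀ 0 = 0 := by rw [φ1 0 le_rfl (by norm_num)]; ring
  have e1 : φ₀ 1 = 1 := by rw [φ3 1 (by norm_num) le_rfl]; ring
  have hφI : ∀ t : I, φ₀ t ∈ Set.Icc (0 : ℝ) 1 := by
    intro t
    rcases eq_or_lt_of_le t.2.1 with h | h
    · rw [← h, e0]; simp
    rcases eq_or_lt_of_le t.2.2 with h' | h'
    · rw [h', e1]; simp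
    · exact ⟨(hφmem t h h').1.le, (hφmem t h h').2.le⟩
  have hφc : Continuous φ₀ := by fun_prop
  let φ : I → I := fun t => ⟨φ₀ t, hφI t⟩
  let f₁ : I → ℂ := fun t => f (φ t)
  have hf₁F : ∀ t : I, f₁ t = F (φ₀ t) := fun t => (hFt (φ t)).symm
  have hom₁ : HomotopicIn V f f₁ := h.reparam (φ := φ)
    (by fun_prop) (Subtype.ext e0) (Subtype.ext e1)
  have edge₁ : IsEdge V f₁ := by
    refine ⟨h.cont.comp (by fun_prop), fun t ht ht' => ?_⟩
    obtain ⟨h2, h3⟩ := hφmem t (unitInterval.pos_iff_ne_zero.2 ht)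
      (unitInterval.lt_one_iff_ne_one.2 ht')
    exact h.interior _ (fun h => h2.ne' (congrArg Subtype.val h))
      (fun h => h3.ne (congrArg Subtype.val h))
  have F₁ : ∀ t : ℝ, 0 ≤ t → t ≤ 1 → Set.IccExtend zero_le_one f₁ t = F (φ₀ t) := by
    intro t ht ht'
    rw [Set.IccExtend_of_mem _ _ ⟨ht, ht'⟩, hf₁F]
  have f₁0 : f₁ 0 = a := by rw [hf₁F]; simp only [Set.Icc.coe_zero, e0, ← ha, ← hFt]
  have f₁1 : f₁ 1 = b := by rw [hf₁F]; simp only [Set.Icc.coe_one, e1, ← hb, ← hFt]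
  obtain ⟨hom₂, edge₂⟩ := edge₁.straighten f₁0 haV hρa (τ := 1 / 3) (by norm_num) (by norm_num)
    (by
      intro t ht
      refine hτ₁ (φ t) ?_
      change φ₀ t ≤ _
      rw [φ1 t t.2.1 ht]; nlinarith)
  set f₂ := PlaneCurve.straighten a (1 / 3) f₁ with hf₂
  obtain ⟨hom₃, edge₃⟩ := edge₂.reverse.straighten (a := b) (τ := 1 / 3) (ρ := ρ)
    (by rw [hf₂, straighten_of_ge _ (by norm_num) _ (by norm_num)]; simpa using f₁1) hbV hρb
    (by norm_num) (by norm_num)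
    (by
      intro t ht
      have h0 : (σ t : ℝ) = 1 - t := rfl
      rw [hf₂, straighten_of_ge _ (by norm_num) _ (by rw [h0]; linarith)]
      refine hτ₂ (φ (σ t)) ?_
      change _ ≤ φ₀ (σ t)
      rw [φ3 _ (by rw [h0]; linarith) (σ t).2.2, h0]; have := t.2.1; nlinarith)
  have hom₃' := hom₃.reverse
  simp only [unitInterval.symm_symm] at hom₃'
  have key : (fun t => PlaneCurve.straighten b (1 / 3) (fun t => f₂ (σ t)) (σ t)) =
      PlaneCurve.hat a b q := by
    funext t
    have h0 : (σ t : ℝ) = 1 - t := rfl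
    rcases le_total (t : ℝ) (1 / 3) with h | h
    · rw [straighten_of_ge _ (by norm_num) _ (by rw [h0]; linarith), hat_of_le _ _ _ h,
        unitInterval.symm_symm, hf₂, straighten_of_le _ _ h, F₁ _ (by norm_num) (by norm_num), hq,
        φ1 _ (by norm_num) (by norm_num)]
      simp only [Set.Icc.coe_zero]
      congr 2
      · push_cast; ring
      · congr 2; ring
    rcases le_total (t : ℝ) (2 / 3) with h' | h'
    · rw [straighten_of_ge _ (by norm_num) _ (by rw [h0]; linarith), hat_of_mem _ _ _ h h',
        unitInterval.symm_symm, hf₂, straighten_of_ge _ (by norm_num) _ h, hf₁F, hq, φ2 _ h h']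
    · rw [straighten_of_le _ _ (by rw [h0]; linarith), hat_of_ge _ _ _ h', hq,
        Set.IccExtend_of_mem _ _ ⟨by norm_num, by norm_num⟩, hf₂,
        straighten_of_ge _ (by norm_num) _ (by change _ ≤ (1 : ℝ) - 1 / 3; norm_num), hf₁F, h0]
      change b + _ * (F (φ₀ (1 - 1 / 3)) - b) = _
      rw [φ2 _ (by norm_num) (by norm_num)]
      simp only [Set.Icc.coe_one]
      congr 2
      · push_cast; ring
      · congr 2; ring
  rw [key] at hom₃'
  exact (hom₁.trans edge₁ hom₂).trans edge₂ hom₃'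

end PlaneCurve

namespace PlaneCurve

variable {V : Set ℂ}

/-- The curve in the plane underlying a path in the complement of `V`. -/
noncomputable def toPlane {x y : {z : ℂ // z ∉ V}} (p : Path x y) (t : I) : ℂ := p t

theorem continuous_toPlane {x y : {z : ℂ // z ∉ V}} (p : Path x y) : Continuous (toPlane p) :=
  continuous_subtype_val.comp p.continuous

theorem toPlane_not_mem {x y : {z : ℂ // z ∉ V}} (p : Path x y) (t : I) : toPlane p t ∉ V :=
  (p t).2

@[simp] theorem toPlane_zero {x y : {z : ℂ // z ∉ V}} (p : Path x y) : toPlane p 0 = x := by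
  simp [toPlane]

@[simp] theorem toPlane_one {x y : {z : ℂ // z ∉ V}} (p : Path x y) : toPlane p 1 = y := by
  simp [toPlane]

theorem toPlane_trans_of_le {x y z : {z : ℂ // z ∉ V}} (p : Path x y) (p' : Path y z) {t : I}
    (h : (t : ℝ) ≤ 1 / 2) :
    toPlane (p.trans p') t = toPlane p ⟨2 * t, by linarith [t.2.1], by linarith⟩ := by
  rw [toPlane, Path.trans_apply, dif_pos h]; rfl

theorem toPlane_trans_of_ge {x y z : {z : ℂ // z ∉ V}} (p : Path x y) (p' : Path y z) {t : I}
    (h : 1 / 2 ≤ (t : ℝ)) :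
    toPlane (p.trans p') t = toPlane p' ⟨2 * t - 1, by linarith, by linarith [t.2.2]⟩ := by
  rcases eq_or_lt_of_le h with h' | h'
  · rw [toPlane_trans_of_le p p' h'.ge]
    have e1 : (⟨2 * (t : ℝ), by linarith [t.2.1], by linarith⟩ : I) = 1 :=
      Subtype.ext (by simp [← h'])
    have e2 : (⟨2 * (t : ℝ) - 1, by linarith, by linarith [t.2.2]⟩ : I) = 0 :=
      Subtype.ext (by simp [← h'])
    rw [e1, e2]; simp
  · rw [toPlane, Path.trans_apply, dif_neg (not_le.2 h')]; rfl

theorem hat_congr {a b : ℂ} {ρ : ℝ} (haV : a ∈ V) (hbV : b ∈ V)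
    (hρa : ∀ z ∈ V, dist z a < ρ → z = a) (hρb : ∀ z ∈ V, dist z b < ρ → z = b)
    {x y : {z : ℂ // z ∉ V}} (hx : dist x.1 a < ρ) (hy : dist y.1 b < ρ) {p p' : Path x y}
    (h : p.Homotopic p') : HomotopicIn V (hat a b (toPlane p)) (hat a b (toPlane p')) := by
  obtain ⟨H⟩ := h
  let P : I → Path x y := fun s => H.eval s
  have hH : ∀ s t, H (s, t) = P s t := fun s t => rfl
  refine ⟨fun q => hat a b (toPlane (P q.1)) q.2, ?_, ?_, ?_, ?_, ?_, ?_⟩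
  · have e : (fun q : I × I => hat a b (toPlane (P q.1)) q.2) = fun q : I × I =>
        (H (q.1, Set.projIcc 0 1 zero_le_one (3 * (q.2 : ℝ) - 1)) : ℂ) -
        ((max 0 (1 - 3 * (q.2 : ℝ)) : ℝ) : ℂ) * (x - a) -
        ((max 0 (3 * (q.2 : ℝ) - 2) : ℝ) : ℂ) * (y - b) := by
      funext q
      rw [hat, toPlane_zero, toPlane_one]
      rfl
    rw [e]
    have : Continuous fun q : I × I => Set.projIcc (0 : ℝ) 1 zero_le_one (3 * (q.2 : ℝ) - 1) :=
      continuous_projIcc.comp (by fun_prop)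
    fun_prop
  · intro t
    change hat a b (toPlane (H.eval 0)) t = _
    rw [Path.Homotopy.eval_zero]
  · intro t
    change hat a b (toPlane (H.eval 1)) t = _
    rw [Path.Homotopy.eval_one]
  · intro s; simp only [hat_zero]
  · intro s; simp only [hat_one]
  · intro s t _ _ ht ht'
    exact hat_not_mem haV hbV hρa hρb (toPlane_not_mem _) (by simpa using hx) (by simpa using hy)
      ht ht'

theorem dist_hat_left {a : ℂ} (b : ℂ) {ρ : ℝ} {q : I → ℂ} (hq : dist (q 0) a < ρ)
    {t : I} (ht : (t : ℝ) ≤ 1 / 3) :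
    dist (hat a b q t) a < ρ := by
  rw [hat_of_le _ _ _ ht, dist_eq_norm, add_sub_cancel_left, norm_mul, Complex.norm_real,
    Real.norm_of_nonneg (by linarith [t.2.1]), ← dist_eq_norm]
  exact (mul_le_of_le_one_left dist_nonneg (by linarith)).trans_lt hq

theorem dist_hat_right (a : ℂ) {b : ℂ} {ρ : ℝ} {q : I → ℂ} (hq : dist (q 1) b < ρ)
    {t : I} (ht : 2 / 3 ≤ (t : ℝ)) :
    dist (hat a b q t) b < ρ := by
  rw [hat_of_ge _ _ _ ht, dist_eq_norm, add_sub_cancel_left, norm_mul, Complex.norm_real,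
    Real.norm_of_nonneg (by linarith [t.2.2]), ← dist_eq_norm]
  exact (mul_le_of_le_one_left dist_nonneg (by linarith)).trans_lt hq

section

variable {a b : ℂ} {ρ : ℝ} (haV : a ∈ V) (hbV : b ∈ V)
    (hρa : ∀ z ∈ V, dist z a < ρ → z = a) (hρb : ∀ z ∈ V, dist z b < ρ → z = b)
    {x y z : {z : ℂ // z ∉ V}}
include haV hbV hρa hρb

theorem isEdge_hat_toPlane (hx : dist x.1 a < ρ) (hy : dist y.1 b < ρ) (p : Path x y) :
    IsEdge V (hat a b (toPlane p)) :=
  isEdge_hat haV hbV hρa hρb (continuous_toPlane p) (toPlane_not_mem p) (by simpa using hx)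
    (by simpa using hy)

theorem hat_trans_left (hz : dist z.1 b < ρ) (α : Path x y)
    (hα : ∀ t, dist (toPlane α t) a < ρ) (p : Path y z) :
    HomotopicIn V (hat a b (toPlane (α.trans p))) (hat a b (toPlane p)) := by
  have hx : dist x.1 a < ρ := by simpa using hα 0
  refine (isEdge_hat_toPlane haV hbV hρa hρb hx hz (α.trans p)).hat (τ₁ := 1 / 2) (τ₂ := 2 / 3)
    (hat_zero _ _ _) (hat_one _ _ _) haV hbV hρa hρb (by norm_num) (by norm_num) (by norm_num)
    ?_ ?_ ?_
  · intro t ht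
    rcases le_total (t : ℝ) (1 / 3) with h | h
    · exact dist_hat_left _ (by simpa using hx) h
    · rw [hat_of_mem _ _ _ h (by linarith), toPlane_trans_of_le _ _ (by dsimp only; linarith)]
      exact hα _
  · intro t ht
    exact dist_hat_right _ (by simpa using hz) ht
  · intro r
    have h0 := r.2.1
    have h1 := r.2.2
    rw [Set.IccExtend_of_mem _ _ ⟨by linarith, by linarith⟩,
      hat_of_mem _ _ _ (by dsimp only; linarith) (by dsimp only; linarith),
      toPlane_trans_of_ge _ _ (by dsimp only; linarith)]
    congr 1; ext; dsimp only; ring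

theorem hat_trans_right (hx : dist x.1 a < ρ) (p : Path x y) (β : Path y z)
    (hβ : ∀ t, dist (toPlane β t) b < ρ) :
    HomotopicIn V (hat a b (toPlane (p.trans β))) (hat a b (toPlane p)) := by
  have hz : dist z.1 b < ρ := by simpa using hβ 1
  refine (isEdge_hat_toPlane haV hbV hρa hρb hx hz (p.trans β)).hat (τ₁ := 1 / 3) (τ₂ := 1 / 2)
    (hat_zero _ _ _) (hat_one _ _ _) haV hbV hρa hρb (by norm_num) (by norm_num) (by norm_num)
    ?_ ?_ ?_
  · intro t ht
    exact dist_hat_left _ (by simpa using hx) ht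
  · intro t ht
    rcases le_total (2 / 3) (t : ℝ) with h | h
    · exact dist_hat_right _ (by simpa using hz) h
    · rw [hat_of_mem _ _ _ (by linarith) h, toPlane_trans_of_ge _ _ (by dsimp only; linarith)]
      exact hβ _
  · intro r
    have h0 := r.2.1
    have h1 := r.2.2
    rw [Set.IccExtend_of_mem _ _ ⟨by linarith, by linarith⟩,
      hat_of_mem _ _ _ (by dsimp only; linarith) (by dsimp only; linarith),
      toPlane_trans_of_le _ _ (by dsimp only; linarith)]
    congr 1; ext; dsimp only; ring

end

/-- The curve obtained from a path near `a` is contractible. -/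
theorem hat_const {a : ℂ} {ρ : ℝ} (haV : a ∈ V) (hρa : ∀ z ∈ V, dist z a < ρ → z = a)
    {x y : {z : ℂ // z ∉ V}} (p : Path x y) (hp : ∀ t, dist (toPlane p t) a < ρ) :
    HomotopicIn V (hat a a (toPlane p)) (fun _ => a) := by
  have hx : dist x.1 a < ρ := by simpa using hp 0
  have hy : dist y.1 a < ρ := by simpa using hp 1
  have hc := continuous_hat a a (continuous_toPlane p)
  refine ⟨fun q => a + ((1 - q.1 : ℝ) : ℂ) * (hat a a (toPlane p) q.2 - a), by fun_prop,
    ?_, ?_, ?_, ?_, ?_⟩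
  · intro t; simp
  · intro t; simp
  · intro s; simp [hat_zero]
  · intro s; simp [hat_one]
  · intro s t hs hs' ht ht'
    refine segment_not_mem haV hρa (hat_not_mem haV haV hρa hρa (toPlane_not_mem _)
      (by simpa using hx) (by simpa using hy) ht ht') ?_ ?_ ?_
    · rcases le_total (t : ℝ) (1 / 3) with h | h
      · exact dist_hat_left _ (by simpa using hx) h
      rcases le_total (2 / 3) (t : ℝ) with h' | h'
      · exact dist_hat_right _ (by simpa using hy) h'
      · rw [hat_of_mem _ _ _ h h']; exact hp _
    · have : (s : ℝ) < 1 := unitInterval.lt_one_iff_ne_one.2 hs'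
      linarith
    · linarith [s.2.1]

/-- Two edges whose middle parts differ by paths near the end points are homotopic. -/
theorem homotopicIn_of_parallel {f f' : I → ℂ} {a b : ℂ} {ρ : ℝ} (haV : a ∈ V) (hbV : b ∈ V)
    (hρa : ∀ z ∈ V, dist z a < ρ → z = a) (hρb : ∀ z ∈ V, dist z b < ρ → z = b)
    {x y x' y' : {z : ℂ // z ∉ V}} {p : Path x y} {p' : Path x' y'} {α : Path x' x} {β : Path y y'}
    (hα : ∀ t, dist (toPlane α t) a < ρ) (hβ : ∀ t, dist (toPlane β t) b < ρ)
    (h : p'.Homotopic (α.trans (p.trans β))) (hf : HomotopicIn V f (hat a b (toPlane p)))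
    (hf' : HomotopicIn V f' (hat a b (toPlane p'))) : HomotopicIn V f f' := by
  have hx' : dist x'.1 a < ρ := by simpa using hα 0
  have hx : dist x.1 a < ρ := by simpa using hα 1
  have hy : dist y.1 b < ρ := by simpa using hβ 0
  have hy' : dist y'.1 b < ρ := by simpa using hβ 1
  have e := @isEdge_hat_toPlane V a b ρ haV hbV hρa hρb
  refine hf.trans (e hx hy p) (HomotopicIn.symm ?_)
  refine hf'.trans (e hx' hy' p') ?_
  refine (hat_congr haV hbV hρa hρb hx' hy' h).trans (e hx' hy' _) ?_
  refine (hat_trans_left haV hbV hρa hρb hy' α hα _).trans (e hx hy' _) ?_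
  exact hat_trans_right haV hbV hρa hρb hx p β hβ

/-- Two edges whose middle parts differ by paths near the end points, and by reversal, are
homotopic up to reversal. -/
theorem homotopicIn_of_reverse {f f' : I → ℂ} {a b : ℂ} {ρ : ℝ} (haV : a ∈ V) (hbV : b ∈ V)
    (hρa : ∀ z ∈ V, dist z a < ρ → z = a) (hρb : ∀ z ∈ V, dist z b < ρ → z = b)
    {x y x' y' : {z : ℂ // z ∉ V}} {p : Path x y} {p' : Path x' y'} {α : Path x' y} {β : Path x y'}
    (hα : ∀ t, dist (toPlane α t) b < ρ) (hβ : ∀ t, dist (toPlane β t) a < ρ)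
    (h : p'.Homotopic (α.trans (p.symm.trans β))) (hf : HomotopicIn V f (hat a b (toPlane p)))
    (hf' : HomotopicIn V f' (hat b a (toPlane p'))) :
    HomotopicIn V (fun t => f (σ t)) f' := by
  refine homotopicIn_of_parallel hbV haV hρb hρa hα hβ h ?_ hf'
  have := hf.reverse
  simp only [hat_symm] at this
  exact this

end PlaneCurve

namespace PlaneCurve

open CategoryTheory

variable {V : Set ℂ}

/-- The fundamental groupoid of the complement of `V`. -/
abbrev Gpd (V : Set ℂ) := FundamentalGroupoid {z : ℂ // z ∉ V}

/-- Morphisms of the fundamental groupoid represented by a path inside `K`. -/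
def PathIn (K : Set ℂ) {x y : Gpd V} (f : x ⟶ y) : Prop :=
  ∃ p : Path x.as y.as, Path.Homotopic.Quotient.mk p = f ∧ ∀ t, toPlane p t ∈ K

theorem PathIn.mono {K K' : Set ℂ} (hK : K ⊆ K') {x y : Gpd V} {f : x ⟶ y} (h : PathIn K f) :
    PathIn K' f := by
  obtain ⟨p, hp, h⟩ := h
  exact ⟨p, hp, fun t => hK (h t)⟩

theorem PathIn.source {K : Set ℂ} {x y : Gpd V} {f : x ⟶ y} (h : PathIn K f) : x.as.1 ∈ K := by
  obtain ⟨p, hp, h⟩ := h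
  simpa using h 0

theorem PathIn.target {K : Set ℂ} {x y : Gpd V} {f : x ⟶ y} (h : PathIn K f) : y.as.1 ∈ K := by
  obtain ⟨p, hp, h⟩ := h
  simpa using h 1

theorem PathIn.comp {K : Set ℂ} {x y z : Gpd V} {f : x ⟶ y} {g : y ⟶ z} (hf : PathIn K f)
    (hg : PathIn K g) : PathIn K (f ≫ g) := by
  obtain ⟨p, rfl, hp⟩ := hf
  obtain ⟨q, rfl, hq⟩ := hg
  refine ⟨p.trans q, Path.Homotopic.Quotient.mk_trans p q, fun t => ?_⟩
  rcases le_total (t : ℝ) (1 / 2) with h | h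
  · rw [toPlane_trans_of_le _ _ h]; exact hp _
  · rw [toPlane_trans_of_ge _ _ h]; exact hq _

theorem PathIn.inv {K : Set ℂ} {x y : Gpd V} {f : x ⟶ y} (hf : PathIn K f) :
    PathIn K (Groupoid.inv f) := by
  obtain ⟨p, rfl, hp⟩ := hf
  exact ⟨p.symm, rfl, fun t => hp _⟩

theorem PathIn.id {K : Set ℂ} {x : Gpd V} (hx : x.as.1 ∈ K) : PathIn K (𝟙 x) :=
  ⟨Path.refl _, rfl, fun _ => hx⟩

/-- Inside a convex set that avoids `V` all paths are homotopic. -/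
theorem PathIn.eq {K : Set ℂ} (hK : Convex ℝ K) (hKV : Disjoint K V) {x y : Gpd V} {f g : x ⟶ y}
    (hf : PathIn K f) (hg : PathIn K g) : f = g := by
  obtain ⟨p, rfl, hp⟩ := hf
  obtain ⟨q, rfl, hq⟩ := hg
  refine Path.Homotopic.Quotient.eq.2 ⟨?_⟩
  have hmem : ∀ s t : I, (1 - (s : ℝ)) • toPlane p t + (s : ℝ) • toPlane q t ∈ K := fun s t =>
    hK (hp t) (hq t) (by linarith [s.2.2]) s.2.1 (by ring)
  refine ⟨⟨⟨fun r => ⟨(1 - (r.1 : ℝ)) • toPlane p r.2 + (r.1 : ℝ) • toPlane q r.2,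
    fun h => Set.disjoint_left.1 hKV (hmem r.1 r.2) h⟩, ?_⟩, ?_, ?_⟩, ?_⟩
  · have hp := continuous_toPlane p
    have hq := continuous_toPlane q
    refine Continuous.subtype_mk ?_ _
    fun_prop
  · intro t; ext; simp [toPlane]
  · intro t; ext; simp [toPlane]
  · intro s t ht
    rcases ht with rfl | rfl
    · apply Subtype.ext
      simp only [ContinuousMap.coe_mk, toPlane_zero]
      change _ = ((p 0 : {z : ℂ // z ∉ V}) : ℂ)
      rw [p.source, ← add_smul]; simp
    · apply Subtype.ext
      simp only [ContinuousMap.coe_mk, toPlane_one]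
      change _ = ((p 1 : {z : ℂ // z ∉ V}) : ℂ)
      rw [p.target, ← add_smul]; simp

theorem exists_pathIn_of_isPathConnected {K : Set ℂ} (hK : IsPathConnected K)
    (hKV : Disjoint K V) {x y : Gpd V}
    (hx : x.as.1 ∈ K) (hy : y.as.1 ∈ K) : ∃ f : x ⟶ y, PathIn K f := by
  obtain ⟨p, hp⟩ := hK.joinedIn _ hx _ hy
  let p' : Path x.as y.as :=
    ⟨⟨fun t => ⟨p t, fun h => Set.disjoint_left.1 hKV (hp t) h⟩,
      Continuous.subtype_mk p.continuous _⟩, Subtype.ext p.source, Subtype.ext p.target⟩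
  exact ⟨Path.Homotopic.Quotient.mk p', p', rfl, hp⟩

theorem exists_pathIn_of_convex {K : Set ℂ} (hK : Convex ℝ K) (hKV : Disjoint K V) {x y : Gpd V}
    (hx : x.as.1 ∈ K) (hy : y.as.1 ∈ K) : ∃ f : x ⟶ y, PathIn K f :=
  exists_pathIn_of_isPathConnected (hK.isPathConnected ⟨_, hx⟩) hKV hx hy

theorem one_lt_rank_complex : 1 < Module.rank ℝ ℂ := by
  rw [Complex.rank_real_complex]; exact_mod_cast Nat.one_lt_two

theorem isPathConnected_ball_diff (a : ℂ) {ρ : ℝ} (hρ : 0 < ρ) :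
    IsPathConnected (Metric.ball a ρ \ {a}) := by
  have := (isPathConnected_compl_singleton_of_one_lt_rank one_lt_rank_complex (0 : ℂ)).image
    (f := OpenPartialHomeomorph.univBall a ρ) (OpenPartialHomeomorph.continuous_univBall a ρ)
  convert this using 1
  have h1 := (OpenPartialHomeomorph.univBall a ρ).image_source_eq_target
  rw [OpenPartialHomeomorph.univBall_source, OpenPartialHomeomorph.univBall_target _ hρ] at h1
  have hinj := (OpenPartialHomeomorph.univBall a ρ).injOn
  rw [OpenPartialHomeomorph.univBall_source, Set.injOn_univ] at hinj
  rw [Set.compl_eq_univ_sdiff, Set.image_sdiff hinj, h1, Set.image_singleton,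
    OpenPartialHomeomorph.univBall_apply_zero]

theorem exists_pathIn_ball {a : ℂ} {ρ : ℝ} (hρ : ∀ z ∈ V, dist z a < ρ → z = a) {x y : Gpd V}
    (ha : a ∈ V) (hx : dist x.as.1 a < ρ) (hy : dist y.as.1 a < ρ) :
    ∃ f : x ⟶ y, PathIn (Metric.ball a ρ) f := by
  have h : ∀ z : {z : ℂ // z ∉ V}, z.1 ≠ a := fun z h => z.2 (h ▸ ha)
  obtain ⟨f, hf⟩ := exists_pathIn_of_isPathConnected (V := V) (x := x) (y := y)
    (isPathConnected_ball_diff a (dist_nonneg.trans_lt hx))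
    (Set.disjoint_left.2 fun z hz hzV => hz.2 (hρ z hzV hz.1)) ⟨hx, h x.as⟩ ⟨hy, h y.as⟩
  exact ⟨f, hf.mono Set.sdiff_subset⟩

theorem exists_hom (hV : V.Finite) (x y : Gpd V) : Nonempty (x ⟶ y) := by
  obtain ⟨f, -⟩ := exists_pathIn_of_isPathConnected (V := V) (x := x) (y := y)
    (hV.countable.isPathConnected_compl_of_one_lt_rank one_lt_rank_complex)
    disjoint_compl_left x.as.2 y.as.2
  exact ⟨f⟩

end PlaneCurve

namespace PlaneCurve

open CategoryTheory TriLattice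

variable {V : Set ℂ}

/-- The convex set cut out by bounds on the three directions of the triangular lattice. -/
def hexagon (x x' y y' s s' : ℝ) : Set ℂ :=
  {z | (x ≤ z.re ∧ z.re ≤ x') ∧ (y ≤ z.im ∧ z.im ≤ y') ∧ (s ≤ z.re + z.im ∧ z.re + z.im ≤ s')}

theorem le_combination {a b m x y : ℝ} (ha : 0 ≤ a) (hb : 0 ≤ b) (hab : a + b = 1) (hx : m ≤ x)
    (hy : m ≤ y) : m ≤ a * x + b * y := by
  obtain rfl : b = 1 - a := by linarith
  nlinarith

theorem combination_le {a b m x y : ℝ} (ha : 0 ≤ a) (hb : 0 ≤ b) (hab : a + b = 1) (hx : x ≤ m)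
    (hy : y ≤ m) : a * x + b * y ≤ m := by
  obtain rfl : b = 1 - a := by linarith
  nlinarith

theorem convex_hexagon (x x' y y' s s' : ℝ) : Convex ℝ (hexagon x x' y y' s s') := by
  rintro z ⟨⟨h1, h2⟩, ⟨h3, h4⟩, h5, h6⟩ w ⟨⟨k1, k2⟩, ⟨k3, k4⟩, k5, k6⟩ a b ha hb hab
  have e1 : (a • z + b • w).re = a * z.re + b * w.re := by simp
  have e2 : (a • z + b • w).im = a * z.im + b * w.im := by simp
  have e3 : a * z.re + b * w.re + (a * z.im + b * w.im) =
    a * (z.re + z.im) + b * (w.re + w.im) := by ring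
  simp only [hexagon, Set.mem_ofPred_eq, e1, e2, e3]
  exact ⟨⟨le_combination ha hb hab h1 k1, combination_le ha hb hab h2 k2⟩,
    ⟨le_combination ha hb hab h3 k3, combination_le ha hb hab h4 k4⟩,
    le_combination ha hb hab h5 k5, combination_le ha hb hab h6 k6⟩

/-- The position in the plane of a lattice cell. -/
noncomputable def pos (h : ℝ) (u : ℤ × ℤ) : ℂ := ⟨h * u.1, h * u.2⟩

/-- The triangle spanned by three pairwise adjacent cells. -/
noncomputable def triangle (h : ℝ) (u v w : ℤ × ℤ) : Set ℂ :=
  hexagon (h * (min u.1 (min v.1 w.1) : ℤ)) (h * (max u.1 (max v.1 w.1) : ℤ))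
    (h * (min u.2 (min v.2 w.2) : ℤ)) (h * (max u.2 (max v.2 w.2) : ℤ))
    (h * (min (u.1 + u.2) (min (v.1 + v.2) (w.1 + w.2)) : ℤ))
    (h * (max (u.1 + u.2) (max (v.1 + v.2) (w.1 + w.2)) : ℤ))

theorem pos_mem_hexagon {h : ℝ} (hh : 0 < h) {u : ℤ × ℤ} {x x' y y' s s' : ℤ}
    (h1 : x ≤ u.1) (h2 : u.1 ≤ x') (h3 : y ≤ u.2) (h4 : u.2 ≤ y') (h5 : s ≤ u.1 + u.2)
    (h6 : u.1 + u.2 ≤ s') :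
    pos h u ∈ hexagon (h * (x : ℤ)) (h * (x' : ℤ)) (h * (y : ℤ)) (h * (y' : ℤ)) (h * (s : ℤ))
      (h * (s' : ℤ)) := by
  have key : ∀ {p q : ℤ}, p ≤ q → h * (p : ℝ) ≤ h * q := fun hpq =>
    mul_le_mul_of_nonneg_left (by exact_mod_cast hpq) hh.le
  have e : h * (u.1 : ℝ) + h * u.2 = h * ((u.1 + u.2 : ℤ) : ℝ) := by push_cast; ring
  simp only [hexagon, Set.mem_ofPred_eq, pos, e]
  exact ⟨⟨key h1, key h2⟩, ⟨key h3, key h4⟩, key h5, key h6⟩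

theorem left_mem_triangle {h : ℝ} (hh : 0 < h) (u v w : ℤ × ℤ) : pos h u ∈ triangle h u v w :=
  pos_mem_hexagon hh (by omega) (by omega) (by omega) (by omega) (by omega) (by omega)

theorem mid_mem_triangle {h : ℝ} (hh : 0 < h) (u v w : ℤ × ℤ) : pos h v ∈ triangle h u v w :=
  pos_mem_hexagon hh (by omega) (by omega) (by omega) (by omega) (by omega) (by omega)

theorem right_mem_triangle {h : ℝ} (hh : 0 < h) (u v w : ℤ × ℤ) : pos h w ∈ triangle h u v w :=
  pos_mem_hexagon hh (by omega) (by omega) (by omega) (by omega) (by omega) (by omega)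

theorem exists_cell {h : ℝ} (hh : 0 < h) (z : ℂ) : ∃ c : ℤ × ℤ, |z.re - h * c.1| < h ∧
    |z.im - h * c.2| < h ∧ |z.re + z.im - h * (c.1 + c.2)| < h := by
  obtain ⟨c, h1, h2, h3⟩ : ∃ c : ℤ × ℤ, |z.re / h - c.1| < 1 ∧ |z.im / h - c.2| < 1 ∧
      |z.re / h + z.im / h - (c.1 + c.2)| < 1 := by
    have a1 := Int.floor_le (z.re / h)
    have a2 := Int.lt_floor_add_one (z.re / h)
    have b1 := Int.floor_le (z.im / h)
    have b2 := Int.lt_floor_add_one (z.im / h)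
    rcases lt_trichotomy (z.re / h + z.im / h) (⌊z.re / h⌋ + ⌊z.im / h⌋ + 1) with H | H | H
    · refine ⟨(⌊z.re / h⌋, ⌊z.im / h⌋), ?_, ?_, ?_⟩ <;> rw [abs_lt] <;> push_cast <;>
        constructor <;> linarith
    · refine ⟨(⌊z.re / h⌋ + 1, ⌊z.im / h⌋), ?_, ?_, ?_⟩ <;> rw [abs_lt] <;> push_cast <;>
        constructor <;> linarith
    · refine ⟨(⌊z.re / h⌋ + 1, ⌊z.im / h⌋ + 1), ?_, ?_, ?_⟩ <;> rw [abs_lt] <;> push_cast <;>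
        constructor <;> linarith
  have key : ∀ x y : ℝ, |x / h - y| < 1 → |x - h * y| < h := fun x y hxy => by
    have : x - h * y = h * (x / h - y) := by field_simp
    rw [this, abs_mul, abs_of_pos hh]
    exact mul_lt_of_lt_one_right hh hxy
  refine ⟨c, key _ _ h1, key _ _ h2, key _ _ ?_⟩
  rwa [add_div]

open Classical in
/-- The cell containing a point of the plane. -/
noncomputable def cell (h : ℝ) (z : ℂ) : ℤ × ℤ :=
  if hh : 0 < h then (exists_cell hh z).choose else 0

theorem cell_spec {h : ℝ} (hh : 0 < h) (z : ℂ) : |z.re - h * (cell h z).1| < h ∧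
    |z.im - h * (cell h z).2| < h ∧ |z.re + z.im - h * ((cell h z).1 + (cell h z).2)| < h := by
  rw [cell, dif_pos hh]; exact (exists_cell hh z).choose_spec

set_option synthInstance.maxHeartbeats 200000 in
set_option synthInstance.maxSize 1000 in
theorem eq_of_between_aux : ∀ v1 ∈ Finset.Icc (-1 : ℤ) 1, ∀ v2 ∈ Finset.Icc (-1 : ℤ) 1,
    ∀ w1 ∈ Finset.Icc (-1 : ℤ) 1, ∀ w2 ∈ Finset.Icc (-1 : ℤ) 1,
    ∀ c1 ∈ Finset.Icc (-1 : ℤ) 1, ∀ c2 ∈ Finset.Icc (-1 : ℤ) 1,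
    (-1 ≤ v1 + v2 ∧ v1 + v2 ≤ 1) → (-1 ≤ w1 + w2 ∧ w1 + w2 ≤ 1) →
    ((-1 ≤ w1 - v1 ∧ w1 - v1 ≤ 1) ∧ (-1 ≤ w2 - v2 ∧ w2 - v2 ≤ 1) ∧
      (-1 ≤ w1 - v1 + (w2 - v2) ∧ w1 - v1 + (w2 - v2) ≤ 1)) →
    (0 ≤ c1 ∨ v1 ≤ c1 ∨ w1 ≤ c1) → (c1 ≤ 0 ∨ c1 ≤ v1 ∨ c1 ≤ w1) →
    (0 ≤ c2 ∨ v2 ≤ c2 ∨ w2 ≤ c2) → (c2 ≤ 0 ∨ c2 ≤ v2 ∨ c2 ≤ w2) →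
    (0 ≤ c1 + c2 ∨ v1 + v2 ≤ c1 + c2 ∨ w1 + w2 ≤ c1 + c2) →
    (c1 + c2 ≤ 0 ∨ c1 + c2 ≤ v1 + v2 ∨ c1 + c2 ≤ w1 + w2) →
    (c1 = 0 ∧ c2 = 0) ∨ (c1 = v1 ∧ c2 = v2) ∨ (c1 = w1 ∧ c2 = w2) := by
  decide +kernel

theorem eq_of_between {u v w c : ℤ × ℤ} (huv : u = v ∨ Adj u v) (hvw : v = w ∨ Adj v w)
    (huw : u = w ∨ Adj u w) (h1 : min u.1 (min v.1 w.1) ≤ c.1) (h2 : c.1 ≤ max u.1 (max v.1 w.1))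
    (h3 : min u.2 (min v.2 w.2) ≤ c.2) (h4 : c.2 ≤ max u.2 (max v.2 w.2))
    (h5 : min (u.1 + u.2) (min (v.1 + v.2) (w.1 + w.2)) ≤ c.1 + c.2)
    (h6 : c.1 + c.2 ≤ max (u.1 + u.2) (max (v.1 + v.2) (w.1 + w.2))) :
    c = u ∨ c = v ∨ c = w := by
  simp only [min_le_iff, le_max_iff] at h1 h2 h3 h4 h5 h6
  have key : ∀ {p q : ℤ × ℤ}, p = q ∨ Adj p q → (-1 ≤ q.1 - p.1 ∧ q.1 - p.1 ≤ 1) ∧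
      (-1 ≤ q.2 - p.2 ∧ q.2 - p.2 ≤ 1) ∧
      (-1 ≤ q.1 - p.1 + (q.2 - p.2) ∧ q.1 - p.1 + (q.2 - p.2) ≤ 1) := by
    rintro p q (rfl | h)
    · simp
    · exact ⟨h.1, h.2.1, h.2.2.1⟩
  have a := key huv
  have b := key huw
  have d := key hvw
  clear key huv huw hvw
  obtain ⟨v1, hv1⟩ : ∃ v1, v1 = v.1 - u.1 := ⟨_, rfl⟩
  obtain ⟨v2, hv2⟩ : ∃ v2, v2 = v.2 - u.2 := ⟨_, rfl⟩
  obtain ⟨w1, hw1⟩ : ∃ w1, w1 = w.1 - u.1 := ⟨_, rfl⟩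
  obtain ⟨w2, hw2⟩ : ∃ w2, w2 = w.2 - u.2 := ⟨_, rfl⟩
  obtain ⟨c1, hc1⟩ : ∃ c1, c1 = c.1 - u.1 := ⟨_, rfl⟩
  obtain ⟨c2, hc2⟩ : ∃ c2, c2 = c.2 - u.2 := ⟨_, rfl⟩
  rw [← hv1, ← hv2] at a
  rw [← hw1, ← hw2] at b
  have k1 : 0 ≤ c1 ∨ v1 ≤ c1 ∨ w1 ≤ c1 := by clear * - h1 hv1 hw1 hc1; omega
  have k2 : c1 ≤ 0 ∨ c1 ≤ v1 ∨ c1 ≤ w1 := by clear * - h2 hv1 hw1 hc1; omega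
  have k3 : 0 ≤ c2 ∨ v2 ≤ c2 ∨ w2 ≤ c2 := by clear * - h3 hv2 hw2 hc2; omega
  have k4 : c2 ≤ 0 ∨ c2 ≤ v2 ∨ c2 ≤ w2 := by clear * - h4 hv2 hw2 hc2; omega
  have k5 : 0 ≤ c1 + c2 ∨ v1 + v2 ≤ c1 + c2 ∨ w1 + w2 ≤ c1 + c2 := by
    clear * - h5 hv1 hw1 hc1 hv2 hw2 hc2; omega
  have k6 : c1 + c2 ≤ 0 ∨ c1 + c2 ≤ v1 + v2 ∨ c1 + c2 ≤ w1 + w2 := by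
    clear * - h6 hv1 hw1 hc1 hv2 hw2 hc2; omega
  have q1 : -1 ≤ c1 ∧ c1 ≤ 1 := by
    obtain ⟨⟨a1, a2⟩, -⟩ := a
    obtain ⟨⟨b1, b2⟩, -⟩ := b
    clear * - k1 k2 a1 a2 b1 b2
    omega
  have q2 : -1 ≤ c2 ∧ c2 ≤ 1 := by
    obtain ⟨-, ⟨a1, a2⟩, -⟩ := a
    obtain ⟨-, ⟨b1, b2⟩, -⟩ := b
    clear * - k3 k4 a1 a2 b1 b2
    omega
  have d' : (-1 ≤ w1 - v1 ∧ w1 - v1 ≤ 1) ∧ (-1 ≤ w2 - v2 ∧ w2 - v2 ≤ 1) ∧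
    (-1 ≤ w1 - v1 + (w2 - v2) ∧ w1 - v1 + (w2 - v2) ≤ 1) := by
    clear k1 k2 k3 k4 k5 k6 h1 h2 h3 h4 h5 h6 a b
    omega
  clear h1 h2 h3 h4 h5 h6 d
  have main : (c1 = 0 ∧ c2 = 0) ∨ (c1 = v1 ∧ c2 = v2) ∨ (c1 = w1 ∧ c2 = w2) := by
    exact eq_of_between_aux v1 (Finset.mem_Icc.2 a.1) v2 (Finset.mem_Icc.2 a.2.1)
      w1 (Finset.mem_Icc.2 b.1) w2
      (Finset.mem_Icc.2 b.2.1) c1 (Finset.mem_Icc.2 q1) c2 (Finset.mem_Icc.2 q2)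
      a.2.2 b.2.2 d' k1 k2 k3 k4 k5 k6
  rcases main with h | h | h
  · exact Or.inl (Prod.ext (by omega) (by omega))
  · exact Or.inr (Or.inl (Prod.ext (by omega) (by omega)))
  · exact Or.inr (Or.inr (Prod.ext (by omega) (by omega)))

theorem cell_eq_of_mem_triangle {h : ℝ} (hh : 0 < h) {u v w : ℤ × ℤ} (huv : u = v ∨ Adj u v)
    (hvw : v = w ∨ Adj v w) (huw : u = w ∨ Adj u w) {z : ℂ} (hz : z ∈ triangle h u v w) :
    cell h z = u ∨ cell h z = v ∨ cell h z = w := by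
  obtain ⟨⟨h1, h2⟩, ⟨h3, h4⟩, h5, h6⟩ := hz
  obtain ⟨k1, k2, k3⟩ := cell_spec hh z
  rw [abs_lt] at k1 k2 k3
  have low : ∀ {x : ℝ} {p q : ℤ}, h * (p : ℝ) ≤ x → x - h * q < h → p ≤ q := fun {x p q} a b => by
    have : h * (p : ℝ) < h * (q + 1 : ℤ) := by push_cast; linarith
    have := lt_of_mul_lt_mul_left this hh.le
    exact Int.lt_add_one_iff.1 (by exact_mod_cast this)
  have upp : ∀ {x : ℝ} {p q : ℤ}, x ≤ h * (p : ℝ) → -h < x - h * q → q ≤ p := fun {x p q} a b => by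
    have : h * (q : ℝ) < h * (p + 1 : ℤ) := by push_cast; linarith
    have := lt_of_mul_lt_mul_left this hh.le
    exact Int.lt_add_one_iff.1 (by exact_mod_cast this)
  exact eq_of_between huv hvw huw (low h1 k1.2) (upp h2 k1.1) (low h3 k2.2) (upp h4 k2.1)
    (low h5 (by push_cast; exact k3.2)) (upp h6 (by push_cast; exact k3.1))

theorem disjoint_triangle {h : ℝ} (hh : 0 < h) {u v w : ℤ × ℤ} (huv : u = v ∨ Adj u v)
    (hvw : v = w ∨ Adj v w) (huw : u = w ∨ Adj u w) (hu : ∀ z ∈ V, cell h z ≠ u)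
    (hv : ∀ z ∈ V, cell h z ≠ v) (hw : ∀ z ∈ V, cell h z ≠ w) : Disjoint (triangle h u v w) V := by
  refine Set.disjoint_left.2 fun z hz hzV => ?_
  rcases cell_eq_of_mem_triangle hh huv hvw huw hz with h | h | h
  exacts [hu z hzV h, hv z hzV h, hw z hzV h]

theorem convex_triangle (h : ℝ) (u v w : ℤ × ℤ) : Convex ℝ (triangle h u v w) :=
  convex_hexagon _ _ _ _ _ _

end PlaneCurve

namespace PlaneCurve

open CategoryTheory TriLattice

variable {V : Set ℂ}

/-- The compatibility conditions between the mesh `h` of the lattice, the radius `r` of the boxes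
around the points of `V`, and the radius `ρ` of the balls containing these boxes. -/
structure Mesh (V : Set ℂ) (ρ h : ℝ) (r : ℤ) : Prop where
  finite : V.Finite
  sep : ∀ a ∈ V, ∀ b ∈ V, a ≠ b → 2 * ρ ≤ dist a b
  pos : 0 < h
  one_le : 1 ≤ r
  lt : 2 * (r + 2) * h < ρ

theorem dist_le_add {z w : ℂ} {s t : ℝ} (h : |z.re - w.re| ≤ s) (h' : |z.im - w.im| ≤ t) :
    dist z w ≤ s + t := by
  rw [dist_eq_norm]
  refine (Complex.norm_le_abs_re_add_abs_im _).trans ?_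
  simpa using add_le_add h h'

theorem abs_mul_sub_mul_le {h : ℝ} (hh : 0 < h) {p q k : ℤ} (h1 : p - q ≤ k) (h2 : q - p ≤ k) :
    |h * (p : ℝ) - h * q| ≤ k * h := by
  have : |(p : ℝ) - q| ≤ k := by
    rw [abs_le]
    exact ⟨by have : (q : ℝ) - p ≤ k := by exact_mod_cast h2
              linarith, by exact_mod_cast h1⟩
  rw [← mul_sub, abs_mul, abs_of_pos hh, mul_comm]
  exact mul_le_mul_of_nonneg_right this hh.le

theorem dist_pos_le {h : ℝ} (hh : 0 < h) {u w : ℤ × ℤ} (huw : Adj u w) :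
    dist (pos h u) (pos h w) ≤ 2 * h := by
  obtain ⟨⟨h1, h2⟩, ⟨h3, h4⟩, -⟩ := huw
  have := dist_le_add (abs_mul_sub_mul_le hh (p := u.1) (q := w.1) (k := 1) (by omega) (by omega))
    (abs_mul_sub_mul_le hh (p := u.2) (q := w.2) (k := 1) (by omega) (by omega))
    (z := pos h u) (w := pos h w)
  push_cast at this
  linarith

theorem dist_pos_cell_lt {h : ℝ} (hh : 0 < h) (z : ℂ) : dist (pos h (cell h z)) z < 2 * h := by
  obtain ⟨h1, h2, -⟩ := cell_spec hh z
  rw [abs_sub_comm] at h1 h2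
  rw [dist_eq_norm]
  refine (Complex.norm_le_abs_re_add_abs_im _).trans_lt ?_
  simp only [Complex.sub_re, Complex.sub_im, pos]
  linarith

/-- The box of radius `r` around the cell containing `z`. -/
noncomputable def around (h : ℝ) (r : ℤ) (z : ℂ) : Finset (ℤ × ℤ) :=
  box ((cell h z).1 - r) ((cell h z).1 + r) ((cell h z).2 - r) ((cell h z).2 + r)

theorem dist_around_lt {h : ℝ} (hh : 0 < h) {r : ℤ} {z : ℂ} {d : ℤ × ℤ} (hd : d ∈ around h r z) :
    dist (pos h d) z < 2 * (r + 1) * h := by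
  rw [around, mem_box] at hd
  have h1 := dist_le_add (abs_mul_sub_mul_le hh (p := d.1) (q := (cell h z).1) (k := r)
    (by omega) (by omega)) (abs_mul_sub_mul_le hh (p := d.2) (q := (cell h z).2) (k := r)
    (by omega) (by omega)) (z := pos h d) (w := pos h (cell h z))
  have := dist_triangle (pos h d) (pos h (cell h z)) z
  have := dist_pos_cell_lt hh z
  linarith

variable {ρ h : ℝ} {r : ℤ} (M : Mesh V ρ h r)
include M

namespace Mesh

theorem radius_pos : 0 < ρ := by
  have : (0 : ℝ) < r + 2 := by exact_mod_cast (by linarith [M.one_le] : (0 : ℤ) < r + 2)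
  have := mul_pos this M.pos
  linarith [M.lt]

theorem eq_of_dist_lt {a : ℂ} (ha : a ∈ V) : ∀ z ∈ V, dist z a < ρ → z = a := by
  intro z hz h
  by_contra hne
  linarith [M.sep z hz a ha hne, M.radius_pos]

theorem dist_pos_lt {a : ℂ} {d : ℤ × ℤ} (hd : d ∈ around h r a) :
    dist (PlaneCurve.pos h d) a < ρ := by
  have := dist_around_lt M.pos hd
  linarith [M.lt, M.pos]

theorem conn_around (z : ℂ) : Conn (around h r z) :=
  box_conn (by linarith [M.one_le]) (by linarith [M.one_le])

theorem X_around (z : ℂ) : X (around h r z) = 6 :=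
  box_X (by linarith [M.one_le]) (by linarith [M.one_le])

theorem sep_around : Sep fun v : V => around h r (v : ℂ) := by
  intro a b hab
  have hsep := M.sep a a.2 b b.2 fun h => hab (Subtype.ext h)
  have h0 := M.pos
  have h1 := M.lt
  constructor
  · refine Finset.disjoint_left.2 fun d hd hd' => ?_
    have k1 := M.dist_pos_lt hd
    have k2 := M.dist_pos_lt hd'
    linarith [dist_triangle_left (a : ℂ) b (PlaneCurve.pos h d)]
  · intro d hd d' hd' hdd
    have k1 := dist_around_lt M.pos hd
    have k2 := dist_around_lt M.pos hd'
    have k3 := dist_pos_le M.pos hdd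
    have k4 := dist_triangle_left (a : ℂ) b (PlaneCurve.pos h d)
    have k5 := dist_triangle (PlaneCurve.pos h d) (PlaneCurve.pos h d') b
    linarith

theorem cell_mem_around (z : ℂ) : cell h z ∈ around h r z := by
  have := M.one_le
  rw [around, mem_box]; omega

theorem cell_ne {a : ℂ} (ha : a ∈ V) {d : ℤ × ℤ} (hd : d ∈ around h r a) (hne : d ≠ cell h a) :
    ∀ z ∈ V, cell h z ≠ d := by
  rintro z hz rfl
  by_cases hza : z = a
  · subst hza; exact hne rfl
  · exact Finset.disjoint_left.1 (M.sep_around ⟨z, hz⟩ ⟨a, ha⟩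
      (fun h => hza (congrArg Subtype.val h))).1 (M.cell_mem_around z) hd

open Classical in
/-- The object of the fundamental groupoid at a cell. -/
noncomputable def pt (u : ℤ × ℤ) : Gpd V :=
  if hu : PlaneCurve.pos h u ∉ V then ⟨⟨PlaneCurve.pos h u, hu⟩⟩ else
    ⟨⟨_, M.finite.exists_notMem.choose_spec⟩⟩

theorem pt_as {u : ℤ × ℤ} (hu : PlaneCurve.pos h u ∉ V) : (M.pt u).as.1 = PlaneCurve.pos h u := by
  rw [pt, dif_pos hu]

open Classical in
/-- The morphism of the fundamental groupoid given by the segment between two cells. -/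
noncomputable def seg (u w : ℤ × ℤ) : M.pt u ⟶ M.pt w :=
  if hs : ∃ f : M.pt u ⟶ M.pt w, PathIn (segment ℝ (PlaneCurve.pos h u) (PlaneCurve.pos h w)) f then
    hs.choose
  else (exists_hom M.finite _ _).some

theorem pos_not_mem {u : ℤ × ℤ} (hu : ∀ z ∈ V, cell h z ≠ u) : PlaneCurve.pos h u ∉ V := by
  have := disjoint_triangle M.pos (.inl rfl) (.inl rfl) (.inl rfl) hu hu hu
  exact Set.disjoint_left.1 this (left_mem_triangle M.pos _ _ _)

theorem pathIn_seg {u w : ℤ × ℤ} (hu : ∀ z ∈ V, cell h z ≠ u) (hw : ∀ z ∈ V, cell h z ≠ w)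
    (huw : Adj u w) : PathIn (segment ℝ (PlaneCurve.pos h u) (PlaneCurve.pos h w)) (M.seg u w) := by
  have hs : ∃ f : M.pt u ⟶ M.pt w,
      PathIn (segment ℝ (PlaneCurve.pos h u) (PlaneCurve.pos h w)) f := by
    refine exists_pathIn_of_convex (convex_segment _ _) ?_ ?_ ?_
    · refine (disjoint_triangle M.pos (.inl rfl) (.inr huw) (.inr huw) hu hu hw).mono_left ?_
      exact (convex_triangle h u u w).segment_subset (left_mem_triangle M.pos _ _ _)
        (right_mem_triangle M.pos _ _ _)
    · rw [M.pt_as (M.pos_not_mem hu)]; exact left_mem_segment _ _ _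
    · rw [M.pt_as (M.pos_not_mem hw)]; exact right_mem_segment _ _ _
  rw [seg, dif_pos hs]
  exact hs.choose_spec

/-- The realization of the lattice in the fundamental groupoid of the complement of `V`. -/
noncomputable def realization :
    Realization (Gpd V) fun v : V => around h r (v : ℂ) where
  pt := M.pt
  seg := M.seg
  InB v _ _ f := PathIn (Metric.ball (v : ℂ) ρ) f
  center v := cell h v
  center_mem v := M.cell_mem_around v
  inner v u huv := by
    have := M.one_le
    obtain ⟨⟨h1, h2⟩, ⟨h3, h4⟩, -⟩ := huv
    rw [around, mem_box]; omega
  comp_mem hf hg := hf.comp hg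
  inv_mem hf := hf.inv
  conn := by
    intro v d d' hd hd' hne hne'
    refine exists_pathIn_ball (M.eq_of_dist_lt v.2) v.2 ?_ ?_
    · rw [M.pt_as (M.pos_not_mem (M.cell_ne v.2 hd hne))]; exact M.dist_pos_lt hd
    · rw [M.pt_as (M.pos_not_mem (M.cell_ne v.2 hd' hne'))]; exact M.dist_pos_lt hd'
  seg_symm := by
    intro u w huw hu hw
    have hu' : ∀ z ∈ V, cell h z ≠ u := fun z hz => (hu ⟨z, hz⟩).symm
    have hw' : ∀ z ∈ V, cell h z ≠ w := fun z hz => (hw ⟨z, hz⟩).symm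
    have hd := disjoint_triangle M.pos (.inl rfl) (.inr huw) (.inr huw) hu' hu' hw'
    have hsub := (convex_triangle h u u w).segment_subset (left_mem_triangle M.pos _ _ _)
        (right_mem_triangle M.pos _ _ _)
    refine PathIn.eq (convex_segment _ _) (hd.mono_left hsub) ?_ (M.pathIn_seg hu' hw' huw).inv
    rw [segment_symm]
    exact M.pathIn_seg hw' hu' huw.symm
  seg_tri := by
    intro u v w huv hvw huw hu hv hw
    have hu' : ∀ z ∈ V, cell h z ≠ u := fun z hz => (hu ⟨z, hz⟩).symm
    have hv' : ∀ z ∈ V, cell h z ≠ v := fun z hz => (hv ⟨z, hz⟩).symm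
    have hw' : ∀ z ∈ V, cell h z ≠ w := fun z hz => (hw ⟨z, hz⟩).symm
    have hd := disjoint_triangle M.pos (.inr huv) (.inr hvw) (.inr huw) hu' hv' hw'
    have hc := convex_triangle h u v w
    have h1 := left_mem_triangle M.pos u v w
    have h2 := mid_mem_triangle M.pos u v w
    have h3 := right_mem_triangle M.pos u v w
    exact PathIn.eq hc hd
      (((M.pathIn_seg hu' hv' huv).mono (hc.segment_subset h1 h2)).comp
        ((M.pathIn_seg hv' hw' hvw).mono (hc.segment_subset h2 h3)))
      ((M.pathIn_seg hu' hw' huw).mono (hc.segment_subset h1 h3))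
  seg_mem := by
    intro v d d' hd hd' hne hne' hdd
    exact (M.pathIn_seg (M.cell_ne v.2 hd hne) (M.cell_ne v.2 hd' hne') hdd).mono
      ((convex_ball _ _).segment_subset (M.dist_pos_lt hd) (M.dist_pos_lt hd'))

end Mesh

end PlaneCurve

namespace PlaneCurve

open CategoryTheory TriLattice

variable {V : Set ℂ}

theorem abs_floor_sub_floor_le {h x y : ℝ} (hh : 0 < h) (hxy : |x - y| < h) :
    ⌊x / h⌋ - ⌊y / h⌋ ≤ 1 ∧ ⌊y / h⌋ - ⌊x / h⌋ ≤ 1 := by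
  have : |x / h - y / h| < 1 := by
    rw [← sub_div, abs_div, abs_of_pos hh, div_lt_one hh]; exact hxy
  rw [abs_lt] at this
  have h1 := Int.floor_le (x / h)
  have h2 := Int.lt_floor_add_one (x / h)
  have h3 := Int.floor_le (y / h)
  have h4 := Int.lt_floor_add_one (y / h)
  constructor
  · have : (⌊x / h⌋ : ℝ) < (⌊y / h⌋ + 2 : ℤ) := by push_cast; linarith
    have : ⌊x / h⌋ < ⌊y / h⌋ + 2 := by exact_mod_cast this
    omega
  · have : (⌊y / h⌋ : ℝ) < (⌊x / h⌋ + 2 : ℤ) := by push_cast; linarith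
    have : ⌊y / h⌋ < ⌊x / h⌋ + 2 := by exact_mod_cast this
    omega

theorem abs_mul_floor_sub_lt {h : ℝ} (x : ℝ) (hh : 0 < h) : |h * ⌊x / h⌋ - x| ≤ h := by
  have h1 := Int.floor_le (x / h)
  have h2 := Int.lt_floor_add_one (x / h)
  rw [le_div_iff₀ hh] at h1
  rw [div_lt_iff₀ hh] at h2
  rw [abs_le]
  constructor <;> nlinarith

theorem eq_or_adj_of_fst {x x' y : ℤ} (h : x' - x ≤ 1 ∧ x - x' ≤ 1) :
    (x, y) = (x', y) ∨ Adj (x, y) (x', y) := by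
  by_cases e : x = x'
  · exact Or.inl (by rw [e])
  · refine Or.inr ⟨?_, ?_, ?_, ?_⟩ <;> dsimp only <;> omega

theorem eq_or_adj_of_snd {x y y' : ℤ} (h : y' - y ≤ 1 ∧ y - y' ≤ 1) :
    (x, y) = (x, y') ∨ Adj (x, y) (x, y') := by
  by_cases e : y = y'
  · exact Or.inl (by rw [e])
  · refine Or.inr ⟨?_, ?_, ?_, ?_⟩ <;> dsimp only <;> omega

/-- A curve in the plane is followed by a sequence of consecutively adjacent cells. -/
theorem exists_cells {γ : I → ℂ} (hγ : Continuous γ) {h : ℝ} (hh : 0 < h) :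
    ∃ (s : ℕ → I) (p : ℕ → ℤ × ℤ) (m m' : ℕ), Monotone s ∧ s 0 = 0 ∧ (s m : ℝ) = 1 / 2 ∧
      s m' = 1 ∧ m ≤ m' ∧ (∀ k, dist (pos h (p k)) (γ (s k)) < 4 * h) ∧
      (∀ k, p k = p (k + 1) ∨ Adj (p k) (p (k + 1))) ∧
      ∀ k t, s k ≤ t → t ≤ s (k + 1) → dist (γ t) (γ (s k)) < h := by
  obtain ⟨δ, hδ, hu⟩ := Metric.uniformContinuous_iff.1
    (CompactSpace.uniformContinuous_of_continuous hγ) h hh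
  obtain ⟨M, hM⟩ := exists_nat_gt (1 / δ)
  have hM0 : 0 < M := by
    have := (one_div_pos.2 hδ).trans hM
    exact_mod_cast this
  have hMr : (0 : ℝ) < M := by exact_mod_cast hM0
  have hMδ : 1 / (M : ℝ) < δ := by
    rw [div_lt_iff₀ hδ] at hM
    rw [div_lt_iff₀ hMr]; linarith
  let T : ℕ → I := fun j => Set.projIcc 0 1 zero_le_one ((j : ℝ) / (2 * M))
  have hTmono : Monotone T := fun i j hij => Set.monotone_projIcc _ (by
    have : (i : ℝ) ≤ j := by exact_mod_cast hij
    gcongr)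
  have hT : ∀ j t, T j ≤ t → t ≤ T (j + 1) → dist (γ t) (γ (T j)) < h := by
    intro j t h1 h2
    refine hu ?_
    have h1' : ((T j : I) : ℝ) ≤ t := h1
    rw [Subtype.dist_eq, Real.dist_eq, abs_of_nonneg (sub_nonneg.2 h1')]
    have h3 : ((T (j + 1) : I) : ℝ) - T j ≤ 1 / (2 * M) := by
      have e : ((j + 1 : ℕ) : ℝ) / (2 * M) = (j : ℝ) / (2 * M) + 1 / (2 * M) := by
        push_cast; ring
      have h0 : 0 < 1 / (2 * (M : ℝ)) := by positivity
      simp only [T, Set.coe_projIcc, e]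
      rcases le_total ((j : ℝ) / (2 * M)) 1 with k1 | k1
      · rw [min_eq_right k1, max_eq_right (by positivity)]
        linarith [min_le_right (1 : ℝ) ((j : ℝ) / (2 * M) + 1 / (2 * M)),
          le_max_right (0 : ℝ) ((j : ℝ) / (2 * M))]
      · rw [min_eq_left k1, min_eq_left (by linarith)]; simp
    have h4 : (t : ℝ) ≤ T (j + 1) := h2
    have h5 : 1 / (2 * (M : ℝ)) ≤ 1 / M := by
      apply one_div_le_one_div_of_le hMr; linarith
    linarith
  have hT' : ∀ j, dist (γ (T (j + 1))) (γ (T j)) < h := fun j =>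
    hT j _ (hTmono (Nat.le_succ j)) le_rfl
  let A : ℕ → ℤ := fun j => ⌊(γ (T j)).re / h⌋
  let B : ℕ → ℤ := fun j => ⌊(γ (T j)).im / h⌋
  refine ⟨fun k => T (k / 2), fun k => (A ((k + 1) / 2), B (k / 2)), 2 * M, 4 * M,
    fun i j hij => hTmono (Nat.div_le_div_right hij), ?_, ?_, ?_, by omega, ?_, ?_, ?_⟩
  · simp only [T, Nat.zero_div, Nat.cast_zero, zero_div, Set.projIcc_left]; rfl
  · have e : ((M : ℝ)) / (2 * M) = 1 / 2 := by field_simp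
    simp only [T, Nat.mul_div_cancel_left M two_pos, e, Set.coe_projIcc]
    norm_num
  · have e : (((4 * M / 2 : ℕ)) : ℝ) / (2 * M) = 1 := by
      rw [show 4 * M / 2 = 2 * M by omega]; push_cast; field_simp
    simp only [T, e, Set.projIcc_right]; rfl
  · intro k
    have h2 : |h * (B (k / 2) : ℝ) - (γ (T (k / 2))).im| ≤ h := abs_mul_floor_sub_lt _ hh
    have h1 : |h * (A ((k + 1) / 2) : ℝ) - (γ (T (k / 2))).re| ≤ 2 * h := by
      have h3 : |h * (A ((k + 1) / 2) : ℝ) - (γ (T ((k + 1) / 2))).re| ≤ h :=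
        abs_mul_floor_sub_lt _ hh
      have h4 : |(γ (T ((k + 1) / 2))).re - (γ (T (k / 2))).re| ≤ h := by
        rcases (by omega : (k + 1) / 2 = k / 2 ∨ (k + 1) / 2 = k / 2 + 1) with e | e
        · rw [e]; simpa using hh.le
        · rw [e]
          have := Complex.abs_re_le_norm (γ (T (k / 2 + 1)) - γ (T (k / 2)))
          rw [← dist_eq_norm, Complex.sub_re] at this
          exact this.trans (hT' _).le
      have := abs_sub_le (h * (A ((k + 1) / 2) : ℝ)) (γ (T ((k + 1) / 2))).re
        (γ (T (k / 2))).re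
      linarith
    have := dist_le_add (z := pos h (A ((k + 1) / 2), B (k / 2))) (w := γ (T (k / 2))) h1 h2
    linarith
  · intro k
    have hA : ∀ j, A (j + 1) - A j ≤ 1 ∧ A j - A (j + 1) ≤ 1 := fun j => by
      refine abs_floor_sub_floor_le hh ?_
      have := Complex.abs_re_le_norm (γ (T (j + 1)) - γ (T j))
      rw [← dist_eq_norm, Complex.sub_re] at this
      exact this.trans_lt (hT' j)
    have hB : ∀ j, B (j + 1) - B j ≤ 1 ∧ B j - B (j + 1) ≤ 1 := fun j => by
      refine abs_floor_sub_floor_le hh ?_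
      have := Complex.abs_im_le_norm (γ (T (j + 1)) - γ (T j))
      rw [← dist_eq_norm, Complex.sub_im] at this
      exact this.trans_lt (hT' j)
    dsimp only
    rcases Nat.even_or_odd' k with ⟨j, rfl | rfl⟩
    · rw [show (2 * j + 1) / 2 = j by omega, show 2 * j / 2 = j by omega,
        show (2 * j + 1 + 1) / 2 = j + 1 by omega]
      exact eq_or_adj_of_fst (hA j)
    · rw [show (2 * j + 1 + 1) / 2 = j + 1 by omega, show (2 * j + 1) / 2 = j by omega,
        show (2 * j + 1 + 1 + 1) / 2 = j + 1 by omega]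
      exact eq_or_adj_of_snd (hB j)
  · intro k t h1 h2
    exact hT _ _ h1 (h2.trans (hTmono (by omega)))

end PlaneCurve

namespace PlaneCurve

open CategoryTheory TriLattice

variable {V : Set ℂ}

/-- The class of a subpath in the fundamental groupoid. -/
noncomputable def sub {x y : {z : ℂ // z ∉ V}} (γ : Path x y) (s t : I) : (⟨γ s⟩ : Gpd V) ⟶ ⟨γ t⟩ :=
  Path.Homotopic.Quotient.mk (γ.subpath s t)

theorem sub_comp {x y : {z : ℂ // z ∉ V}} (γ : Path x y) (s t r : I) :
    sub γ s t ≫ sub γ t r = sub γ s r :=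
  (Path.Homotopic.Quotient.mk_trans _ _).symm.trans
    (Path.Homotopic.Quotient.eq.2 ⟨Path.Homotopy.subpathTransSubpath γ s t r⟩)

theorem sub_self {x y : {z : ℂ // z ∉ V}} (γ : Path x y) (s : I) : sub γ s s = 𝟙 _ := by
  rw [sub, Path.subpath_self]; rfl

theorem pathIn_sub {x y : {z : ℂ // z ∉ V}} (γ : Path x y) {s t : I} (hst : s ≤ t) {K : Set ℂ}
    (hK : ∀ r, s ≤ r → r ≤ t → toPlane γ r ∈ K) : PathIn K (sub γ s t) := by
  refine ⟨γ.subpath s t, rfl, fun r => ?_⟩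
  have : γ.subpath s t r ∈ Set.range (γ.subpath s t) := ⟨r, rfl⟩
  rw [Path.range_subpath_of_le _ _ _ hst] at this
  obtain ⟨q, hq, e⟩ := this
  rw [toPlane, ← e]
  exact hK q hq.1 hq.2

variable {ρ h : ℝ} {r : ℤ} (M : Mesh V ρ h r)
include M

/-- A path far from `V` is homotopic to a walk along the cells that follow it. -/
theorem Mesh.exists_walk {x y : {z : ℂ // z ∉ V}} (γ : Path x y) {s : ℕ → I} {p : ℕ → ℤ × ℤ}
    (hs : Monotone s) (hp : ∀ k, dist (PlaneCurve.pos h (p k)) (toPlane γ (s k)) < 4 * h)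
    (hadj : ∀ k, p k = p (k + 1) ∨ Adj (p k) (p (k + 1)))
    (hstep : ∀ k t, s k ≤ t → t ≤ s (k + 1) → dist (toPlane γ t) (toPlane γ (s k)) < h)
    (hfar : ∀ t, ∀ z ∈ V, 6 * h ≤ dist z (toPlane γ t)) {i j : ℕ} (hij : i ≤ j) :
    ∃ (W : M.pt (p i) ⟶ M.pt (p j)) (α : M.pt (p i) ⟶ ⟨γ (s i)⟩) (β : ⟨γ (s j)⟩ ⟶ M.pt (p j)),
      M.realization.WalkIn ((Finset.Icc i j).image p) (p i) (p j) W ∧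
      PathIn (Metric.ball (toPlane γ (s i)) (4 * h)) α ∧
      PathIn (Metric.ball (toPlane γ (s j)) (4 * h)) β ∧ W = α ≫ sub γ (s i) (s j) ≫ β := by
  have h0 := M.pos
  have hgood : ∀ k, ∀ z ∈ V, cell h z ≠ p k := by
    intro k z hz e
    have h1 := dist_pos_cell_lt h0 z
    rw [e] at h1
    have := hfar (s k) z hz
    have := dist_triangle_left z (toPlane γ (s k)) (PlaneCurve.pos h (p k))
    linarith [hp k]
  have hdis : ∀ t, Disjoint (Metric.ball (toPlane γ t) (6 * h)) V := fun t =>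
    Set.disjoint_left.2 fun z hz hzV => (hfar t z hzV).not_gt hz
  have hsub : ∀ t, Metric.ball (toPlane γ t) (4 * h) ⊆ Metric.ball (toPlane γ t) (6 * h) :=
    fun t => Metric.ball_subset_ball (by linarith)
  have hpt : ∀ k, (M.pt (p k)).as.1 ∈ Metric.ball (toPlane γ (s k)) (4 * h) := fun k => by
    rw [M.pt_as (M.pos_not_mem (hgood k))]; exact hp k
  have hself : ∀ t, (⟨γ t⟩ : Gpd V).as.1 ∈ Metric.ball (toPlane γ t) (4 * h) := fun t =>
    Metric.mem_ball_self (by linarith)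
  obtain ⟨α, hα⟩ : ∃ α : M.pt (p i) ⟶ ⟨γ (s i)⟩,
      PathIn (Metric.ball (toPlane γ (s i)) (4 * h)) α :=
    exists_pathIn_of_convex (convex_ball _ _) ((hdis _).mono_left (hsub _)) (hpt i) (hself _)
  have hβ : ∀ k, ∃ β : (⟨γ (s k)⟩ : Gpd V) ⟶ M.pt (p k),
      PathIn (Metric.ball (toPlane γ (s k)) (4 * h)) β := fun k =>
    exists_pathIn_of_convex (convex_ball _ _) ((hdis _).mono_left (hsub _)) (hself _) (hpt k)
  suffices H : ∀ w, w = p j → ∀ β : (⟨γ (s j)⟩ : Gpd V) ⟶ M.pt w,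
      PathIn (Metric.ball (toPlane γ (s j)) (6 * h)) β →
      ∀ f : M.pt (p i) ⟶ M.pt w, f = α ≫ sub γ (s i) (s j) ≫ β →
      M.realization.WalkIn ((Finset.Icc i j).image p) (p i) w f by
    obtain ⟨β, hβ⟩ := hβ j
    exact ⟨_, α, β, H _ rfl β (hβ.mono (hsub _)) _ rfl, hα, hβ, rfl⟩
  induction j, hij using Nat.le_induction with
  | base =>
    rintro w rfl β hβ f hf
    have e : α ≫ sub γ (s i) (s i) ≫ β = 𝟙 _ := by
      rw [sub_self, Category.id_comp]
      exact PathIn.eq (convex_ball _ _) (hdis _) ((hα.mono (hsub _)).comp hβ)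
        (PathIn.id (hsub _ (hpt i)))
    obtain rfl : f = 𝟙 (M.pt (p i)) := hf.trans e
    exact .nil (Finset.mem_image_of_mem p (by simp))
  | succ j hij ih =>
    rintro w rfl β hβ' f hf
    obtain ⟨β₀, hβ₀⟩ := hβ (j + 1)
    have hsubj : Metric.ball (toPlane γ (s (j + 1))) (4 * h) ⊆
        Metric.ball (toPlane γ (s j)) (6 * h) := by
      refine Metric.ball_subset_ball' ?_
      linarith [hstep j (s (j + 1)) (hs (Nat.le_succ j)) le_rfl]
    have hββ : β = β₀ :=
      PathIn.eq (convex_ball _ _) (hdis _) hβ' (hβ₀.mono (hsub _))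
    have hmid : PathIn (Metric.ball (toPlane γ (s j)) (6 * h)) (sub γ (s j) (s (j + 1))) :=
      pathIn_sub γ (hs (Nat.le_succ j)) fun t h1 h2 => by
        have := hstep j t h1 h2
        exact this.trans (by linarith)
    have hmidβ := hmid.comp (hβ₀.mono hsubj)
    have hmono : (Finset.Icc i j).image p ⊆ (Finset.Icc i (j + 1)).image p :=
      Finset.image_subset_image (Finset.Icc_subset_Icc_right (Nat.le_succ j))
    rw [hββ, ← sub_comp γ (s i) (s j) (s (j + 1)), Category.assoc] at hf
    rcases hadj j with e | e
    · exact (ih _ e.symm _ hmidβ _ hf).mono hmono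
    · obtain ⟨β₁, hβ₁⟩ := hβ j
      have e' : sub γ (s j) (s (j + 1)) ≫ β₀ = β₁ ≫ M.seg (p j) (p (j + 1)) := by
        refine PathIn.eq (convex_ball _ _) (hdis _) hmidβ ((hβ₁.mono (hsub _)).comp
          ((M.pathIn_seg (hgood _) (hgood _) e).mono ((convex_ball _ _).segment_subset ?_ ?_)))
        · exact hsub _ (hp j)
        · exact hsubj (hp (j + 1))
      rw [e', ← Category.assoc (sub γ (s i) (s j)), ← Category.assoc α] at hf
      subst hf
      exact (((ih _ rfl β₁ (hβ₁.mono (hsub _)) _ rfl).mono hmono).snoc e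
        (Finset.mem_image_of_mem p (by simp; omega)))

end PlaneCurve

namespace PlaneCurve

open CategoryTheory TriLattice

variable {V : Set ℂ}

theorem exists_last_lt {P : ℕ → Prop} {m : ℕ} (h0 : P 0) (hm : ¬ P m) :
    ∃ i < m, P i ∧ ∀ k, i < k → k ≤ m → ¬ P k := by
  classical
  have hP : P (Nat.findGreatest P m) := Nat.findGreatest_spec (Nat.zero_le m) h0
  refine ⟨Nat.findGreatest P m, ?_, hP, fun k => Nat.findGreatest_is_greatest⟩
  exact (Nat.findGreatest_le m).lt_of_ne fun e => hm (e ▸ hP)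

theorem exists_first_gt {P : ℕ → Prop} {m m' : ℕ} (hmm : m ≤ m') (h : P m') (hm : ¬ P m) :
    ∃ j, m < j ∧ P j ∧ ∀ k, m ≤ k → k < j → ¬ P k := by
  classical
  have hex : ∃ k, m ≤ k ∧ P k := ⟨m', hmm, h⟩
  obtain ⟨h1, h2⟩ := Nat.find_spec hex
  refine ⟨Nat.find hex, h1.lt_of_ne fun e => hm (e ▸ h2), h2, fun k hk hlt hPk => ?_⟩
  exact Nat.find_min hex hlt ⟨hk, hPk⟩

/-- A cell that lies in a box around `z`, or is adjacent to it. -/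
def Near (h : ℝ) (r : ℤ) (z : ℂ) (u : ℤ × ℤ) : Prop := ∃ d ∈ around h r z, u = d ∨ Adj u d

theorem Near.dist_lt {h : ℝ} (hh : 0 < h) {r : ℤ} {z : ℂ} {u : ℤ × ℤ} (hu : Near h r z u) :
    dist (pos h u) z < 2 * (r + 2) * h := by
  obtain ⟨d, hd, e⟩ := hu
  have h1 := dist_around_lt hh hd
  have h2 : dist (pos h u) (pos h d) ≤ 2 * h := by
    rcases e with rfl | e
    · rw [dist_self]; linarith
    · exact dist_pos_le hh e
  linarith [dist_triangle (pos h u) (pos h d) z]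

theorem Near.dist_lt' {h : ℝ} (hh : 0 < h) {r : ℤ} {z w : ℂ} {u : ℤ × ℤ} (hu : Near h r z u)
    (hw : dist (pos h u) w < 4 * h) : dist w z < (2 * r + 8) * h := by
  linarith [hu.dist_lt hh, dist_triangle_left w z (pos h u)]

theorem mem_around_of_dist_le {h : ℝ} (hh : 0 < h) {r : ℤ} {z w : ℂ} {u : ℤ × ℤ}
    (hu : dist (pos h u) w < 4 * h) (hw : dist w z ≤ (r - 6) * h) : u ∈ around h r z := by
  have h1 : dist (pos h u) (pos h (cell h z)) < r * h := by
    have := dist_pos_cell_lt hh z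
    have := dist_triangle (pos h u) w z
    have := dist_triangle_right (pos h u) (pos h (cell h z)) z
    linarith
  rw [dist_eq_norm] at h1
  have key : ∀ k l : ℤ, |h * (k : ℝ) - h * l| < r * h → l - r ≤ k ∧ k ≤ l + r := by
    intro k l hkl
    rw [← mul_sub, abs_mul, abs_of_pos hh, mul_comm, mul_lt_mul_iff_left₀ hh, abs_lt] at hkl
    have e1 : -r < k - l := by exact_mod_cast hkl.1
    have e2 : k - l < r := by exact_mod_cast hkl.2
    omega
  rw [around, mem_box]
  exact ⟨key _ _ ((Complex.abs_re_le_norm _).trans_lt h1),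
    key _ _ ((Complex.abs_im_le_norm _).trans_lt h1)⟩

variable {ρ h : ℝ} {r : ℤ} (M : Mesh V ρ h r)
include M

theorem Mesh.ne_cell_of_adj {v : ℂ} {u d : ℤ × ℤ} (hu : u ∉ around h r v) (hud : Adj u d) :
    d ≠ cell h v := by
  rintro rfl
  have := M.one_le
  obtain ⟨⟨h1, h2⟩, ⟨h3, h4⟩, -⟩ := hud
  exact hu (by rw [around, mem_box]; omega)

/-- A path joining the neighbourhoods of two points of `V` leaves a trace on the lattice. -/
theorem Mesh.exists_trace (hρ : (2 * r + 12) * h ≤ ρ) {x y : {z : ℂ // z ∉ V}} (γ : Path x y)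
    (a b : V) (ha : dist (toPlane γ 0) a ≤ (r - 6) * h) (hb : dist (toPlane γ 1) b ≤ (r - 6) * h)
    (hfst : ∀ t : I, (t : ℝ) ≤ 1 / 2 → ∀ z ∈ V, dist (toPlane γ t) z < (2 * r + 8) * h → z = a)
    (hsnd : ∀ t : I, 1 / 2 ≤ (t : ℝ) → ∀ z ∈ V, dist (toPlane γ t) z < (2 * r + 8) * h → z = b)
    (hmid : ∀ t : I, (t : ℝ) = 1 / 2 → ∀ z ∈ V, (2 * r + 8) * h ≤ dist (toPlane γ t) z)
    (hfar : ∀ t, ∀ z ∈ V, 6 * h ≤ dist z (toPlane γ t)) :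
    ∃ (s t : I) (N : Finset (ℤ × ℤ)) (R : M.realization.Trace N)
      (α : M.pt R.d ⟶ ⟨γ s⟩) (β : ⟨γ t⟩ ⟶ M.pt R.d'),
      (s : ℝ) ≤ 1 / 2 ∧ 1 / 2 ≤ (t : ℝ) ∧ dist (toPlane γ s) a < (2 * r + 8) * h ∧
      dist (toPlane γ t) b < (2 * r + 8) * h ∧ R.a = a ∧ R.b = b ∧ Conn N ∧
      (∀ v : V, Disjoint N (around h r v)) ∧
      (∀ K C : Finset (ℤ × ℤ), (∀ u ∈ K, ∃ v : V, u ∈ around h r v) →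
        (∀ v : V, Disjoint (around h r v) C) → T N K C ≤ 4) ∧
      (∀ u ∈ N, ∃ q, dist (PlaneCurve.pos h u) (toPlane γ q) < 4 * h) ∧
      PathIn (Metric.ball (a : ℂ) ρ) α ∧ PathIn (Metric.ball (b : ℂ) ρ) β ∧
      R.mor = α ≫ sub γ s t ≫ β := by
  have h0 := M.pos
  obtain ⟨s, p, m, m', hs, hs0, hsm, hsm', hmm, hp, hadj, hstep⟩ :=
    exists_cells (continuous_toPlane γ) M.pos
  have near_fst : ∀ k ≤ m, ∀ z ∈ V, Near h r z (p k) → z = a := fun k hk z hz hn =>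
    hfst (s k) (hsm ▸ hs hk) z hz (hn.dist_lt' h0 (hp k))
  have near_snd : ∀ k, m ≤ k → ∀ z ∈ V, Near h r z (p k) → z = b := fun k hk z hz hn =>
    hsnd (s k) (hsm ▸ hs hk) z hz (hn.dist_lt' h0 (hp k))
  have near_mid : ∀ z ∈ V, ¬ Near h r z (p m) := fun z hz hn =>
    (hmid (s m) hsm z hz).not_gt (hn.dist_lt' h0 (hp m))
  have near_succ : ∀ k z, p k ∈ around h r z → Near h r z (p (k + 1)) := fun k z hk =>
    ⟨p k, hk, (hadj k).imp Eq.symm Adj.symm⟩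
  have near_pred : ∀ k z, p (k + 1) ∈ around h r z → Near h r z (p k) := fun k z hk =>
    ⟨p (k + 1), hk, hadj k⟩
  obtain ⟨i, him, hPi, hi⟩ := exists_last_lt (P := fun k => Near h r a (p k))
    ⟨p 0, mem_around_of_dist_le h0 (hp 0) (hs0 ▸ ha), .inl rfl⟩ (near_mid a a.2)
  obtain ⟨j, hmj, hPj, hj⟩ := exists_first_gt (P := fun k => Near h r b (p k)) hmm
    ⟨p m', mem_around_of_dist_le h0 (hp m') (hsm' ▸ hb), .inl rfl⟩ (near_mid b b.2)
  have hij : i ≤ j := (him.trans hmj).le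
  have contact : ∀ k, i ≤ k → k ≤ j → ∀ z ∈ V, Near h r z (p k) →
      (k = i ∧ z = a) ∨ k = j ∧ z = b := by
    intro k hik hkj z hz hn
    rcases le_total k m with hk | hk
    · obtain rfl := near_fst k hk z hz hn
      exact .inl ⟨not_lt.1 (fun hlt => hi k hlt hk hn) |>.antisymm hik, rfl⟩
    · obtain rfl := near_snd k hk z hz hn
      exact .inr ⟨hkj.antisymm (not_lt.1 fun hlt => hj k hk hlt hn), rfl⟩
  have avoid : ∀ k, i ≤ k → k ≤ j → ∀ z ∈ V, p k ∉ around h r z := by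
    intro k hik hkj z hz hn
    rcases contact k hik hkj z hz ⟨_, hn, .inl rfl⟩ with ⟨rfl, rfl⟩ | ⟨rfl, rfl⟩
    · exact hi (k + 1) (Nat.lt_succ_self k) him (near_succ k _ hn)
    · obtain ⟨l, rfl⟩ : ∃ l, k = l + 1 := ⟨k - 1, by omega⟩
      exact hj l (by omega) (Nat.lt_succ_self l) (near_pred l _ hn)
  obtain ⟨d, hd, hda⟩ : ∃ d ∈ around h r (a : ℂ), Adj (p i) d := by
    obtain ⟨d, hd, e | e⟩ := hPi
    · exact absurd (e ▸ hd) (avoid i le_rfl hij a a.2)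
    · exact ⟨d, hd, e⟩
  obtain ⟨d', hd', hda'⟩ : ∃ d ∈ around h r (b : ℂ), Adj (p j) d := by
    obtain ⟨d, hd, e | e⟩ := hPj
    · exact absurd (e ▸ hd) (avoid j hij le_rfl b b.2)
    · exact ⟨d, hd, e⟩
  obtain ⟨W, α, β, hW, hα, hβ, e⟩ := M.exists_walk γ hs hp hadj hstep hfar hij
  have hcell : ∀ k, i ≤ k → k ≤ j → ∀ z ∈ V, cell h z ≠ p k := fun k hik hkj z hz e =>
    avoid k hik hkj z hz (e ▸ M.cell_mem_around z)
  have hdi := hPi.dist_lt' h0 (hp i)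
  have hdj := hPj.dist_lt' h0 (hp j)
  have hballa : Metric.ball (toPlane γ (s i)) (4 * h) ⊆ Metric.ball (a : ℂ) ρ :=
    Metric.ball_subset_ball' (by linarith)
  have hballb : Metric.ball (toPlane γ (s j)) (4 * h) ⊆ Metric.ball (b : ℂ) ρ :=
    Metric.ball_subset_ball' (by linarith)
  have hsega : PathIn (Metric.ball (a : ℂ) ρ) (M.seg d (p i)) :=
    (M.pathIn_seg (M.cell_ne a.2 hd (M.ne_cell_of_adj (avoid i le_rfl hij a a.2) hda))
      (hcell i le_rfl hij) hda.symm).mono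
      ((convex_ball _ _).segment_subset (M.dist_pos_lt hd) (hballa (hp i)))
  have hsegb : PathIn (Metric.ball (b : ℂ) ρ) (M.seg (p j) d') :=
    (M.pathIn_seg (hcell j hij le_rfl)
      (M.cell_ne b.2 hd' (M.ne_cell_of_adj (avoid j hij le_rfl b b.2) hda')) hda').mono
      ((convex_ball _ _).segment_subset (hballb (hp j)) (M.dist_pos_lt hd'))
  have hdisj : ∀ v : V, Disjoint ((Finset.Icc i j).image p) (around h r v) := by
    intro v
    rw [Finset.disjoint_left]
    intro u hu
    obtain ⟨k, hk, rfl⟩ := Finset.mem_image.1 hu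
    exact avoid k (Finset.mem_Icc.1 hk).1 (Finset.mem_Icc.1 hk).2 v v.2
  refine ⟨s i, s j, (Finset.Icc i j).image p, ⟨a, b, d, d', p i, p j, hd, hd', hda, hda', W, hW⟩,
    M.seg d (p i) ≫ α, β ≫ M.seg (p j) d', hsm ▸ hs him.le, hsm ▸ hs hmj.le, hdi, hdj, rfl, rfl,
    ?_, hdisj, ?_, ?_, hsega.comp (hα.mono hballa), (hβ.mono hballb).comp hsegb, ?_⟩
  · clear hdisj hW e W α β hα hβ hcell hdj hballb hsegb hda' hd' d' avoid contact hj hPj hmj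
    induction j, hij using Nat.le_induction with
    | base => rw [Finset.Icc_self, Finset.image_singleton]; exact conn_singleton _
    | succ k hik ih =>
      rw [← Finset.insert_Icc_right_eq_Icc_add_one (Nat.le_succ_of_le hik), Finset.image_insert]
      have hk : p k ∈ (Finset.Icc i k).image p :=
        Finset.mem_image_of_mem p (Finset.mem_Icc.2 ⟨hik, le_rfl⟩)
      rcases hadj k with e | e
      · rw [← e, Finset.insert_eq_of_mem hk]; exact ih
      · exact ih.insert_cell hk e.symm
  · intro K C hK hC
    refine T_le_four_of_contacts (D := fun v : V => around h r v) ?_ hdisj (z := p i) (z' := p j)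
      (a := a) (b := b) ?_ hK hC ?_ ?_
    · have := M.one_le
      exact fun v => ⟨_, _, _, _, by omega, by omega, rfl⟩
    · intro u hu v d hd hud
      obtain ⟨k, hk, rfl⟩ := Finset.mem_image.1 hu
      obtain ⟨h1, h2⟩ := Finset.mem_Icc.1 hk
      exact (contact k h1 h2 v v.2 ⟨d, hd, .inr hud⟩).imp
        (And.imp (congrArg p) Subtype.ext) (And.imp (congrArg p) Subtype.ext)
    · exact fun v d hd hud => Subtype.ext (near_fst i him.le v v.2 ⟨d, hd, .inr hud⟩)
    · exact fun v d hd hud => Subtype.ext (near_snd j hmj.le v v.2 ⟨d, hd, .inr hud⟩)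
  · intro u hu
    obtain ⟨k, hk, rfl⟩ := Finset.mem_image.1 hu
    exact ⟨s k, hp k⟩
  · subst e
    change M.seg d (p i) ≫ (α ≫ sub γ (s i) (s j) ≫ β) ≫ M.seg (p j) d' = _
    simp only [Category.assoc]
    rfl

end PlaneCurve

namespace PlaneCurve

variable {V : Set ℂ}

theorem exists_time {f : I → ℂ} (hf : Continuous f) {ρ : ℝ} (hρ : 0 < ρ) {τ' : ℝ} (hτ' : 0 < τ') :
    ∃ τ, 0 < τ ∧ τ < τ' ∧ (∀ t : I, (t : ℝ) ≤ τ → dist (f t) (f 0) < ρ) ∧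
      ∀ t : I, 1 - τ ≤ (t : ℝ) → dist (f t) (f 1) < ρ := by
  obtain ⟨δ, hδ, hu⟩ := Metric.uniformContinuous_iff.1
    (CompactSpace.uniformContinuous_of_continuous hf) ρ hρ
  obtain ⟨τ, h0, h1⟩ := exists_between (lt_min hδ hτ')
  rw [lt_min_iff] at h1
  refine ⟨τ, h0, h1.2, fun t ht => hu ?_, fun t ht => hu ?_⟩
  · rw [Subtype.dist_eq, Real.dist_eq, abs_lt]
    constructor <;> push_cast <;> linarith [t.2.1]
  · rw [Subtype.dist_eq, Real.dist_eq, abs_lt]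
    constructor <;> push_cast <;> linarith [t.2.2]

theorem exists_pos_le_dist {X Y : Set ℂ} (hX : IsCompact X) (hY : IsCompact Y) (h : Disjoint X Y) :
    ∃ η > 0, ∀ x ∈ X, ∀ y ∈ Y, η ≤ dist x y := by
  obtain ⟨η, hη, h⟩ := Metric.exists_pos_forall_lt_edist hX hY.isClosed h
  refine ⟨η, by exact_mod_cast hη, fun x hx y hy => ?_⟩
  have := h x hx y hy
  rw [edist_nndist, ENNReal.coe_lt_coe] at this
  exact_mod_cast this.le

/-- The middle part of an edge, together with what it remembers of the edge. -/
theorem IsEdge.exists_core {f : I → ℂ} (h : IsEdge V f) (hV : V.Finite) (h0 : f 0 ∈ V)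
    (h1 : f 1 ∈ V) {ρ : ℝ} (hρ : 0 < ρ) (hsep : ∀ a ∈ V, ∀ b ∈ V, a ≠ b → 2 * ρ ≤ dist a b) :
    ∃ ρ₃ > 0, ∀ ε, 0 < ε → ε ≤ ρ → ε ≤ ρ₃ → ∃ (x y : {z : ℂ // z ∉ V}) (γ : Path x y),
      (∀ t, ∃ T, T ≠ 0 ∧ T ≠ 1 ∧ toPlane γ t = f T) ∧
      dist (toPlane γ 0) (f 0) < ε / 8 ∧ dist (toPlane γ 1) (f 1) < ε / 8 ∧
      (∀ t : I, (t : ℝ) ≤ 1 / 2 → ∀ z ∈ V, dist (toPlane γ t) z < ε → z = f 0) ∧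
      (∀ t : I, 1 / 2 ≤ (t : ℝ) → ∀ z ∈ V, dist (toPlane γ t) z < ε → z = f 1) ∧
      (∀ t : I, (t : ℝ) = 1 / 2 → ∀ z ∈ V, ε ≤ dist (toPlane γ t) z) ∧
      ∀ s t : I, (s : ℝ) ≤ 1 / 2 → 1 / 2 ≤ (t : ℝ) → dist (toPlane γ s) (f 0) < ε →
        dist (toPlane γ t) (f 1) < ε →
        HomotopicIn V f (PlaneCurve.hat (f 0) (f 1) (toPlane (γ.subpath s t))) := by
  have hfar : ∀ a ∈ V, ∀ z ∈ V, ∀ w, dist w z < ρ → dist w a < ρ → z = a := by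
    intro a ha z hz w hwz hwa
    by_contra hne
    linarith [hsep z hz a ha hne, dist_triangle_left z a w]
  obtain ⟨τ, hτ, hτ2, hτ0, hτ1⟩ := exists_time h.cont hρ (one_half_pos (α := ℝ))
  have hint : ∀ t : I, τ ≤ (t : ℝ) → (t : ℝ) ≤ 1 - τ → f t ∉ V := fun t ht ht' =>
    h.interior t (by rintro rfl; rw [Set.Icc.coe_zero] at ht; linarith)
      (by rintro rfl; rw [Set.Icc.coe_one] at ht'; linarith)
  have hmid : IsClosed {t : I | τ ≤ (t : ℝ) ∧ (t : ℝ) ≤ 1 - τ} :=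
    (isClosed_le continuous_const continuous_subtype_val).inter
      (isClosed_le continuous_subtype_val continuous_const)
  obtain ⟨ρ₃, hρ₃, hd⟩ := exists_pos_le_dist (hmid.isCompact.image h.cont) hV.isCompact (by
    rw [Set.disjoint_left]
    rintro _ ⟨t, ht, rfl⟩
    exact hint t ht.1 ht.2)
  refine ⟨ρ₃, hρ₃, fun ε hε hερ hε₃ => ?_⟩
  obtain ⟨t₀, ht₀, htτ, hn0, hn1⟩ := exists_time h.cont (by linarith : 0 < ε / 8) hτ
  have hT : ∀ q : I, t₀ ≤ t₀ + q * (1 - 2 * t₀) ∧ t₀ + q * (1 - 2 * t₀) ≤ 1 - t₀ := by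
    intro q
    have := q.2.1; have := q.2.2
    constructor <;> nlinarith
  let T : I → I := fun q => ⟨t₀ + q * (1 - 2 * t₀), by linarith [hT q], by linarith [hT q]⟩
  have hTv : ∀ q, (T q : ℝ) = t₀ + q * (1 - 2 * t₀) := fun q => rfl
  have hTc : Continuous T := by fun_prop
  have hT0 : ∀ q, T q ≠ 0 := fun q e => by
    have := congrArg Subtype.val e
    rw [hTv, Set.Icc.coe_zero] at this
    linarith [hT q]
  have hT1 : ∀ q, T q ≠ 1 := fun q e => by
    have := congrArg Subtype.val e
    rw [hTv, Set.Icc.coe_one] at this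
    linarith [hT q]
  let γ : Path (⟨f (T 0), h.interior _ (hT0 _) (hT1 _)⟩ : {z : ℂ // z ∉ V})
      ⟨f (T 1), h.interior _ (hT0 _) (hT1 _)⟩ :=
    { toFun q := ⟨f (T q), h.interior _ (hT0 _) (hT1 _)⟩
      continuous_toFun := (h.cont.comp hTc).subtype_mk _
      source' := rfl
      target' := rfl }
  have hγ : ∀ q, toPlane γ q = f (T q) := fun q => rfl
  have hfst : ∀ t : I, (t : ℝ) ≤ 1 / 2 → ∀ z ∈ V, dist (f (T t)) z < ε → (T t : ℝ) < τ := by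
    intro t ht z hz hdz
    by_contra! hlt
    have h2 : (T t : ℝ) ≤ 1 - τ := by rw [hTv]; nlinarith
    exact (hd _ ⟨T t, ⟨hlt, h2⟩, rfl⟩ z hz).not_gt (hdz.trans_le hε₃)
  have hsnd : ∀ t : I, 1 / 2 ≤ (t : ℝ) → ∀ z ∈ V, dist (f (T t)) z < ε → 1 - τ < (T t : ℝ) := by
    intro t ht z hz hdz
    by_contra! hlt
    have h2 : τ ≤ (T t : ℝ) := by rw [hTv]; nlinarith
    exact (hd _ ⟨T t, ⟨h2, hlt⟩, rfl⟩ z hz).not_gt (hdz.trans_le hε₃)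
  refine ⟨_, _, γ, fun t => ⟨T t, hT0 t, hT1 t, rfl⟩, ?_, ?_, ?_, ?_, ?_, ?_⟩
  · exact hn0 _ (by rw [hTv]; simp)
  · exact hn1 _ (by rw [hTv]; simp; linarith)
  · exact fun t ht z hz hdz => hfar _ h0 z hz _ (hdz.trans_le hερ) (hτ0 _ (hfst t ht z hz hdz).le)
  · exact fun t ht z hz hdz => hfar _ h1 z hz _ (hdz.trans_le hερ) (hτ1 _ (hsnd t ht z hz hdz).le)
  · intro t ht z hz
    by_contra! hdz
    linarith [hfst t ht.le z hz hdz, hsnd t ht.ge z hz hdz]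
  · intro s t hs ht hds hdt
    have h2 := hfst s hs _ h0 hds
    have h3 := hsnd t ht _ h1 hdt
    refine h.hat rfl rfl h0 h1 (fun z hz hd => hfar _ h0 z hz z (by simpa using hρ) hd)
      (fun z hz hd => hfar _ h1 z hz z (by simpa using hρ) hd)
      (τ₁ := T s) (τ₂ := T t) (by linarith [hT s, hTv s]) (by linarith) (by linarith [hT t, hTv t])
      (fun q hq => hτ0 q (by linarith)) (fun q hq => hτ1 q (by linarith)) fun q => ?_
    have e : (T s : ℝ) + q * (T t - T s) = T (Set.Icc.convexComb s t q) := by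
      simp only [hTv, Set.Icc.coe_convexComb]; ring
    rw [e, Set.IccExtend_val]
    rfl

end PlaneCurve

namespace PlaneCurve

open CategoryTheory TriLattice

variable {V : Set ℂ}

section Morphisms

variable {a b : ℂ} {ρ : ℝ} (haV : a ∈ V) (hbV : b ∈ V)
  (hρa : ∀ z ∈ V, dist z a < ρ → z = a) (hρb : ∀ z ∈ V, dist z b < ρ → z = b)
  {f f' : I → ℂ} {x y x' y' : {z : ℂ // z ∉ V}} {p : Path x y} {p' : Path x' y'}
  {X Y X' Y' : Gpd V} {α : X ⟶ ⟨x⟩} {β : ⟨y⟩ ⟶ Y} {α' : X' ⟶ ⟨x'⟩} {β' : ⟨y'⟩ ⟶ Y'}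

include haV hρa in
theorem homotopicIn_const_of_mor (hf : HomotopicIn V f (hat a a (toPlane p)))
    (hα : PathIn (Metric.ball a ρ) α) (hβ : PathIn (Metric.ball a ρ) β)
    (h : PathIn (Metric.ball a ρ) (α ≫ (Path.Homotopic.Quotient.mk p : (⟨x⟩ : Gpd V) ⟶ ⟨y⟩) ≫ β)) :
    HomotopicIn V f fun _ => a := by
  have h' := (hα.inv.comp h).comp hβ.inv
  simp only [Groupoid.inv_eq_inv, Category.assoc, IsIso.inv_hom_id_assoc, IsIso.hom_inv_id,
    Category.comp_id] at h'
  obtain ⟨q, hq, hq'⟩ := h'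
  refine hf.trans (isEdge_hat_toPlane haV haV hρa hρa hα.target hβ.source p) ?_
  refine (hat_congr haV haV hρa hρa hα.target hβ.source
    (Path.Homotopic.Quotient.eq.1 hq.symm)).trans
    (isEdge_hat_toPlane haV haV hρa hρa hα.target hβ.source q) (hat_const haV hρa q hq')

include haV hbV hρa hρb

theorem homotopicIn_of_mor (hf : HomotopicIn V f (hat a b (toPlane p)))
    (hf' : HomotopicIn V f' (hat a b (toPlane p')))
    (hα : PathIn (Metric.ball a ρ) α) (hβ : PathIn (Metric.ball b ρ) β)
    (hα' : PathIn (Metric.ball a ρ) α') (hβ' : PathIn (Metric.ball b ρ) β')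
    {ξ : X' ⟶ X} {ζ : Y ⟶ Y'} (hξ : PathIn (Metric.ball a ρ) ξ) (hζ : PathIn (Metric.ball b ρ) ζ)
    (h : α' ≫ (Path.Homotopic.Quotient.mk p' : (⟨x'⟩ : Gpd V) ⟶ ⟨y'⟩) ≫ β' =
      ξ ≫ (α ≫ (Path.Homotopic.Quotient.mk p : (⟨x⟩ : Gpd V) ⟶ ⟨y⟩) ≫ β) ≫ ζ) :
    HomotopicIn V f f' := by
  obtain ⟨q, hq, hq'⟩ := hα'.inv.comp (hξ.comp hα)
  obtain ⟨s, hs, hs'⟩ := hβ.comp (hζ.comp hβ'.inv)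
  refine homotopicIn_of_parallel haV hbV hρa hρb hq' hs' (Path.Homotopic.Quotient.eq.1 ?_) hf hf'
  have e : (Path.Homotopic.Quotient.mk p' : (⟨x'⟩ : Gpd V) ⟶ ⟨y'⟩) = (Groupoid.inv α' ≫ ξ ≫ α) ≫
      (Path.Homotopic.Quotient.mk p : (⟨x⟩ : Gpd V) ⟶ ⟨y⟩) ≫ β ≫ ζ ≫ Groupoid.inv β' := by
    rw [← cancel_epi α', ← cancel_mono β', Category.assoc, h]
    simp
  rw [← hq, ← hs] at e
  exact e

theorem homotopicIn_symm_of_mor (hf : HomotopicIn V f (hat a b (toPlane p)))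
    (hf' : HomotopicIn V f' (hat b a (toPlane p')))
    (hα : PathIn (Metric.ball a ρ) α) (hβ : PathIn (Metric.ball b ρ) β)
    (hα' : PathIn (Metric.ball b ρ) α') (hβ' : PathIn (Metric.ball a ρ) β')
    {ξ : X' ⟶ Y} {ζ : X ⟶ Y'} (hξ : PathIn (Metric.ball b ρ) ξ) (hζ : PathIn (Metric.ball a ρ) ζ)
    (h : α' ≫ (Path.Homotopic.Quotient.mk p' : (⟨x'⟩ : Gpd V) ⟶ ⟨y'⟩) ≫ β' =
      ξ ≫ Groupoid.inv (α ≫ (Path.Homotopic.Quotient.mk p : (⟨x⟩ : Gpd V) ⟶ ⟨y⟩) ≫ β) ≫ ζ) :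
    HomotopicIn V (fun t => f (σ t)) f' := by
  obtain ⟨q, hq, hq'⟩ := hα'.inv.comp (hξ.comp hβ.inv)
  obtain ⟨s, hs, hs'⟩ := hα.inv.comp (hζ.comp hβ'.inv)
  refine homotopicIn_of_reverse haV hbV hρa hρb hq' hs' (Path.Homotopic.Quotient.eq.1 ?_) hf hf'
  have e : (Path.Homotopic.Quotient.mk p' : (⟨x'⟩ : Gpd V) ⟶ ⟨y'⟩) =
      (Groupoid.inv α' ≫ ξ ≫ Groupoid.inv β) ≫
      Groupoid.inv (Path.Homotopic.Quotient.mk p : (⟨x⟩ : Gpd V) ⟶ ⟨y⟩) ≫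
      Groupoid.inv α ≫ ζ ≫ Groupoid.inv β' := by
    rw [← cancel_epi α', ← cancel_mono β', Category.assoc, h]
    simp [Groupoid.inv_eq_inv]
  rw [← hq, ← hs] at e
  exact e

end Morphisms

end PlaneCurve

namespace PlaneCurve

open CategoryTheory TriLattice

variable {V : Set ℂ}

theorem exists_pos_le_of_finite {κ : Type*} [Finite κ] {g : κ → ℝ} (hg : ∀ i, 0 < g i) :
    ∃ ε > 0, ∀ i, ε ≤ g i := by
  cases isEmpty_or_nonempty κ
  · exact ⟨1, one_pos, fun i => isEmptyElim i⟩
  · obtain ⟨i, hi⟩ := Finite.exists_min g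
    exact ⟨g i, hg i, hi⟩

/-- A family of pairwise disjoint and pairwise non-homotopic edges, none of them a trivial loop,
has at most three times as many members as there are vertices. -/
theorem card_le_three_mul_ncard (hV : V.Finite) {κ : Type*} [Fintype κ] (f : κ → I → ℂ)
    (hf : ∀ e, IsEdge V (f e)) (h0 : ∀ e, f e 0 ∈ V) (h1 : ∀ e, f e 1 ∈ V)
    (hdis : ∀ e e', e ≠ e' → ∀ t t' : I, t ≠ 0 → t ≠ 1 → t' ≠ 0 → t' ≠ 1 → f e t ≠ f e' t')
    (hpar : ∀ e e', e ≠ e' → ¬ EdgeHomotopic V (f e) (f e'))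
    (hloop : ∀ e, ¬ IsTrivialLoop V (f e)) : Fintype.card κ ≤ 3 * V.ncard := by
  have := hV.to_subtype
  have := Fintype.ofFinite V
  obtain ⟨ρ, hρ, hsep⟩ : ∃ ρ > 0, ∀ a ∈ V, ∀ b ∈ V, a ≠ b → 2 * ρ ≤ dist a b := by
    obtain ⟨ρ, hρ, h⟩ := exists_pos_le_of_finite (κ := {q : V × V // q.1 ≠ q.2})
      (g := fun q => dist (q.1.1 : ℂ) q.1.2 / 2)
      fun q => half_pos (dist_pos.2 fun e => q.2 (Subtype.ext e))
    refine ⟨ρ, hρ, fun a ha b hb hab => ?_⟩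
    linarith [h ⟨⟨⟨a, ha⟩, ⟨b, hb⟩⟩, fun e => hab (congrArg Subtype.val e)⟩]
  choose ρ₃ hρ₃ hcore using fun e => (hf e).exists_core hV (h0 e) (h1 e) hρ hsep
  obtain ⟨ε, hε, hερ, hε₃⟩ : ∃ ε > 0, ε ≤ ρ ∧ ∀ e, ε ≤ ρ₃ e := by
    obtain ⟨ε, hε, h⟩ := exists_pos_le_of_finite hρ₃
    exact ⟨min ρ ε, lt_min hρ hε, min_le_left _ _, fun e => (min_le_right _ _).trans (h e)⟩
  choose x y γ hγ hγ0 hγ1 hfst hsnd hmid hhat using fun e => hcore e ε hε hερ (hε₃ e)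
  have hcpt : ∀ e, IsCompact (Set.range (toPlane (γ e))) := fun e =>
    isCompact_range (continuous_toPlane _)
  obtain ⟨η₁, hη₁, hηV⟩ : ∃ η > 0, ∀ e t, ∀ z ∈ V, η ≤ dist z (toPlane (γ e) t) := by
    choose η hη h using fun e => exists_pos_le_dist hV.isCompact (hcpt e) (by
      rw [Set.disjoint_right]
      rintro _ ⟨t, rfl⟩
      exact toPlane_not_mem _ t)
    obtain ⟨η', hη', h'⟩ := exists_pos_le_of_finite hη
    exact ⟨η', hη', fun e t z hz => (h' e).trans (h e z hz _ ⟨t, rfl⟩)⟩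
  obtain ⟨η₂, hη₂, hηe⟩ : ∃ η > 0, ∀ e e', e ≠ e' → ∀ t t',
      η ≤ dist (toPlane (γ e) t) (toPlane (γ e') t') := by
    choose η hη h using fun q : {q : κ × κ // q.1 ≠ q.2} =>
      exists_pos_le_dist (hcpt q.1.1) (hcpt q.1.2) (by
        rw [Set.disjoint_left]
        rintro _ ⟨t, rfl⟩ ⟨t', e⟩
        obtain ⟨T, hT0, hT1, hT⟩ := hγ q.1.1 t
        obtain ⟨T', hT0', hT1', hT'⟩ := hγ q.1.2 t'
        exact hdis _ _ q.2 T T' hT0 hT1 hT0' hT1' (hT.symm.trans (e.symm.trans hT')))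
    obtain ⟨η', hη', h'⟩ := exists_pos_le_of_finite hη
    exact ⟨η', hη', fun e e' hne t t' => (h' _).trans (h ⟨(e, e'), hne⟩ _ ⟨t, rfl⟩ _ ⟨t', rfl⟩)⟩
  obtain ⟨r, h, hr, hh, hrε, hηh₁, hηh₂⟩ : ∃ (r : ℤ) (h : ℝ), 10 ≤ r ∧ 0 < h ∧
      (2 * r + 12) * h = ε ∧ 10 * h ≤ η₁ ∧ 10 * h ≤ η₂ := by
    obtain ⟨k, hk⟩ := exists_nat_gt (10 * ε / min η₁ η₂)
    have hη := lt_min hη₁ hη₂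
    have hk0 : (0 : ℝ) ≤ k := k.cast_nonneg
    rw [div_lt_iff₀ hη] at hk
    have hpos : (0 : ℝ) < 2 * ((k + 10 : ℕ) : ℤ) + 12 := by push_cast; linarith
    have key : 10 * (ε / (2 * ((k + 10 : ℕ) : ℤ) + 12)) ≤ min η₁ η₂ := by
      rw [← mul_div_assoc, div_le_iff₀ hpos]
      push_cast
      nlinarith
    exact ⟨(k + 10 : ℕ), ε / (2 * ((k + 10 : ℕ) : ℤ) + 12), by push_cast; omega,
      div_pos hε hpos, mul_div_cancel₀ _ hpos.ne', key.trans (min_le_left _ _),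
      key.trans (min_le_right _ _)⟩
  have hr' : (10 : ℝ) ≤ r := by exact_mod_cast hr
  have hε8 : ε / 8 ≤ (r - 6) * h := by nlinarith
  have M : Mesh V ρ h r := ⟨hV, hsep, hh, by omega, by linarith⟩
  choose s t N R α β hs ht hsa htb hRa hRb hNc hND hT hNnear hα hβ hmor using fun e =>
    M.exists_trace (hrε.le.trans hερ) (γ e) ⟨f e 0, h0 e⟩ ⟨f e 1, h1 e⟩ ((hγ0 e).le.trans hε8)
      ((hγ1 e).le.trans hε8) (fun t ht z hz hd => hfst e t ht z hz (hd.trans_le (by linarith)))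
      (fun t ht z hz hd => hsnd e t ht z hz (hd.trans_le (by linarith)))
      (fun t ht z hz => le_trans (by linarith) (hmid e t ht z hz))
      (fun t z hz => le_trans (by linarith) (hηV e t z hz))
  have hhom := fun e => hhat e (s e) (t e) (hs e) (ht e) ((hsa e).trans_le (by linarith))
    ((htb e).trans_le (by linarith))
  replace hα : ∀ e, PathIn (Metric.ball (f e 0) ρ) (α e) := hα
  replace hβ : ∀ e, PathIn (Metric.ball (f e 1) ρ) (β e) := hβ
  have hball : ∀ a ∈ V, ∀ z ∈ V, dist z a < ρ → z = a := fun a ha => M.eq_of_dist_lt ha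
  have hRa' : ∀ e, ((R e).a : ℂ) = f e 0 := fun e => congrArg Subtype.val (hRa e)
  have hRb' : ∀ e, ((R e).b : ℂ) = f e 1 := fun e => congrArg Subtype.val (hRb e)
  rw [Set.ncard_eq_toFinset_card', Set.toFinset_card]
  refine M.realization.card_le_of_traces (N := N) (fun v => M.conn_around v)
    (fun v => M.X_around v) M.sep_around hNc ?_ hND
    (fun e K C hK _ hC => hT e K C hK hC) R ?_ ?_ ?_
  · intro e e' hne
    have far : ∀ u ∈ N e, ∀ w ∈ N e', 2 * h < dist (pos h u) (pos h w) := by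
      intro u hu w hw
      obtain ⟨q, hq⟩ := hNnear e u hu
      obtain ⟨q', hq'⟩ := hNnear e' w hw
      have h1 := hηe e e' hne q q'
      have h2 := dist_triangle_left (toPlane (γ e) q) (toPlane (γ e') q') (pos h u)
      have h3 := dist_triangle (pos h u) (pos h w) (toPlane (γ e') q')
      linarith
    constructor
    · rw [Finset.disjoint_left]
      intro u hu hu'
      have := far u hu u hu'
      rw [dist_self] at this
      linarith
    · exact fun u hu w hw huw => (dist_pos_le hh huw).not_gt (far u hu w hw)
  · intro e hab hin
    have hin' : PathIn (Metric.ball ((R e).a : ℂ) ρ) (R e).mor := hin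
    have hab' : f e 1 = f e 0 := by rw [← hRa', ← hRb', hab]
    have hf := hhom e
    have hβ' := hβ e
    rw [hRa', hmor] at hin'
    rw [hab'] at hf hβ'
    exact hloop e (.inl (homotopicIn_const_of_mor (h0 e) (hball _ (h0 e)) hf (hα e) hβ' hin'))
  · intro e e' hne hab hab' ξ ζ hξ hζ heq
    have hξ' : PathIn (Metric.ball ((R e).a : ℂ) ρ) ξ := hξ
    have hζ' : PathIn (Metric.ball ((R e).b : ℂ) ρ) ζ := hζ
    have h2 : f e' 0 = f e 0 := by rw [← hRa', ← hRa', hab]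
    have h3 : f e' 1 = f e 1 := by rw [← hRb', ← hRb', hab']
    have hf := hhom e'
    have hα' := hα e'
    have hβ' := hβ e'
    rw [hRa'] at hξ'
    rw [hRb'] at hζ'
    rw [h2, h3] at hf
    rw [h2] at hα'
    rw [h3] at hβ'
    rw [hmor, hmor] at heq
    exact hpar e e' hne (.inl (homotopicIn_of_mor (h0 e) (h1 e) (hball _ (h0 e))
      (hball _ (h1 e)) (hhom e) hf (hα e) (hβ e) hα' hβ' hξ' hζ' heq))
  · intro e e' hne hab hab' ξ ζ hξ hζ heq
    have hξ' : PathIn (Metric.ball ((R e).b : ℂ) ρ) ξ := hξ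
    have hζ' : PathIn (Metric.ball ((R e).a : ℂ) ρ) ζ := hζ
    have h2 : f e' 0 = f e 1 := by rw [← hRa', ← hRb', hab]
    have h3 : f e' 1 = f e 0 := by rw [← hRb', ← hRa', hab']
    have hf := hhom e'
    have hα' := hα e'
    have hβ' := hβ e'
    rw [hRb'] at hξ'
    rw [hRa'] at hζ'
    rw [h2, h3] at hf
    rw [h2] at hα'
    rw [h3] at hβ'
    rw [hmor, hmor] at heq
    exact hpar e e' hne (.inr (homotopicIn_symm_of_mor (h0 e) (h1 e) (hball _ (h0 e))
      (hball _ (h1 e)) (hhom e) hf (hα e) (hβ e) hα' hβ' hξ' hζ' heq))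

end PlaneCurve

namespace PlaneDrawing

variable {n m : ℕ}

/-- The graph on the edges of a drawing in which two edges are adjacent if they do not cross. -/
def noncrossingGraph (D : PlaneDrawing n m) : SimpleGraph (Fin m) where
  Adj e e' := e ≠ e' ∧ (e, e') ∉ D.crossingEdgePairs
  symm := ⟨fun _ _ h => ⟨h.1.symm, fun ⟨_, t, t', h0, h1, h0', h1', heq⟩ =>
    h.2 ⟨h.1, t', t, h0', h1', h0, h1, heq.symm⟩⟩⟩
  loopless := ⟨fun _ h => h.1 rfl⟩

theorem cliqueFree_noncrossingGraph (D : PlaneDrawing n m) (hD : D.NonHomotopic) :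
    D.noncrossingGraph.CliqueFree (3 * n + 1) := by
  intro s hs
  have hle := PlaneCurve.card_le_three_mul_ncard D.finV (fun e : s => D.f e)
    (fun e => ⟨D.cont e, D.interior_not_mem e⟩) (fun e => D.source_mem e)
    (fun e => D.target_mem e)
    (fun e e' hne t t' h0 h1 h0' h1' heq =>
      have hadj := hs.isClique e.2 e'.2 fun h => hne (Subtype.ext h)
      hadj.2 ⟨hadj.1, t, t', h0, h1, h0', h1', heq⟩)
    (fun e e' hne => hD.1 e e' fun h => hne (Subtype.ext h)) (fun e => hD.2 e)
  rw [Fintype.card_coe, hs.card_eq, D.cardV] at hle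
  omega

open Classical in
theorem sq_eq_add_ncard_crossingEdgePairs (D : PlaneDrawing n m) :
    m ^ 2 = m + 2 * D.noncrossingGraph.edgeFinset.card + D.crossingEdgePairs.ncard := by
  have hcross : D.crossingEdgePairs.ncard =
      (Finset.univ.filter (· ∈ D.crossingEdgePairs)).card := by
    rw [← Set.ncard_coe_finset]
    congr 1
    ext
    simp
  have hdiag : (Finset.univ.filter fun q : Fin m × Fin m => q.1 = q.2).card = m := by
    have h := Finset.diag_card (Finset.univ : Finset (Fin m))
    rw [Finset.card_univ, Fintype.card_fin] at h
    refine (congrArg Finset.card (Finset.ext fun q => ?_)).trans h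
    simp [Finset.mem_diag]
  have hoff := Finset.card_filter_add_card_filter_not (s := (Finset.univ : Finset (Fin m × Fin m)))
    (fun q => q.1 = q.2)
  have hsplit := Finset.card_filter_add_card_filter_not
    (s := Finset.univ.filter fun q : Fin m × Fin m => ¬ q.1 = q.2) (· ∈ D.crossingEdgePairs)
  rw [Finset.filter_filter, Finset.filter_filter] at hsplit
  have hmem : (Finset.univ.filter fun q : Fin m × Fin m =>
      ¬ q.1 = q.2 ∧ q ∈ D.crossingEdgePairs) =
      Finset.univ.filter (· ∈ D.crossingEdgePairs) :=
    Finset.filter_congr fun q _ => ⟨And.right, fun h => ⟨h.1, h⟩⟩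
  have hadj : (Finset.univ.filter fun q : Fin m × Fin m =>
      ¬ q.1 = q.2 ∧ q ∉ D.crossingEdgePairs).card = 2 * D.noncrossingGraph.edgeFinset.card := by
    rw [SimpleGraph.two_mul_card_edgeFinset]
    refine congrArg Finset.card (Finset.ext fun q => ?_)
    rw [Finset.mem_filter, Finset.mem_filter]
    rfl
  rw [hmem, hadj, ← hcross] at hsplit
  simp only [Finset.card_univ, Fintype.card_prod, Fintype.card_fin, hdiag] at hoff
  rw [sq]
  omega

end PlaneDrawing

/-- In every non-homotopic drawing in the plane with `n > 1` vertices and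
`m > 4n` edges, the number of (unordered) crossing pairs of edges is at least `m² / (24n)`. -/
theorem crossing_pairs_lower_bound (n m : ℕ) (hn : 1 < n) (hm : 4 * n < m)
    (D : PlaneDrawing n m) (hD : D.NonHomotopic) :
    (m : ℝ) ^ 2 / (24 * n) ≤ (D.crossingEdgePairs.ncard : ℝ) / 2 := by
  classical
  have hturan := (D.cliqueFree_noncrossingGraph hD).card_edgeFinset_le
  simp only [Fintype.card_fin] at hturan
  rw [← SimpleGraph.card_edgeFinset_turanGraph] at hturan
  have hbound := (Nat.mul_le_mul_left (2 * (3 * n)) hturan).trans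
    SimpleGraph.mul_card_edgeFinset_turanGraph_le
  have hcount := D.sq_eq_add_ncard_crossingEdgePairs
  have hn0 : (0 : ℝ) < n := by exact_mod_cast hn.pos
  have hm' : (4 * n : ℝ) ≤ m := by exact_mod_cast hm.le
  have hbound' : (2 * (3 * n) * D.noncrossingGraph.edgeFinset.card : ℝ) ≤
      (3 * n - 1) * m ^ 2 := by
    have h : 1 ≤ 3 * n := by omega
    have := (Nat.cast_le (α := ℝ)).2 hbound
    push_cast [h] at this
    exact this
  have hcount' : (m ^ 2 : ℝ) =
      m + 2 * D.noncrossingGraph.edgeFinset.card + D.crossingEdgePairs.ncard := by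
    exact_mod_cast hcount
  rw [div_le_div_iff₀ (by positivity) two_pos]
  nlinarith [mul_le_mul_of_nonneg_left hm' (Nat.cast_nonneg (α := ℝ) m)]
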